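/- arXiv:1704.05089 — 3 statements merged into one kernel-verified Lean document; each statement's English description precedes it below -/
import Mathlib

section
/- There exists r₀ such that for every integer r ≥ r₀, setting T := r^{5r²}, there exist a finite set L of lines in ℝ² and a finite set P of points in ℝ² such that: (i) every line of L contains at least r points of P; (ii) for every point p ∈ P, the number of points q ∈ P with q ≠ p such that some line of L contains both p and q is at most T; and (iii) P cannot be partitioned into two sets P₁ and P₂ such that every line of L contains a point of P₁ and a point of P₂. -/
/-- A line in the plane: a one-dimensional affine subspace of ℝ², viewed as a set of points. -/
def IsLine (L : Set (Fin 2 → ℝ)) : Prop :=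
  ∃ u v : Fin 2 → ℝ, v ≠ 0 ∧ L = {p | ∃ t : ℝ, p = u + t • v}

namespace DNC
open Finset

/-- Union bound in powers of two. -/
lemma union_bound {Ω ι : Type*} [Fintype Ω] (I : Finset ι) (P : ι → Ω → Prop) (p q M : ℕ)
    (hI : #I ≤ 2 ^ q)
    (h : ∀ i ∈ I, 2 ^ (p + q) * Nat.card {ω // P i ω} ≤ M) :
    2 ^ p * Nat.card {ω // ∃ i ∈ I, P i ω} ≤ M := by
  classical
  have e1 : ∀ Q : Ω → Prop, Nat.card {ω // Q ω} = #{ω | Q ω} := by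
    intro Q
    rw [Nat.card_eq_fintype_card, Fintype.card_subtype]
  simp only [e1] at h ⊢
  have h2 : #(I.biUnion fun i => univ.filter (P i)) ≤ ∑ i ∈ I, #(univ.filter (P i)) :=
    card_biUnion_le
  have h3 : 2 ^ q * (2 ^ p * ∑ i ∈ I, #(univ.filter (P i))) ≤ 2 ^ q * M := by
    calc 2 ^ q * (2 ^ p * ∑ i ∈ I, #(univ.filter (P i)))
        = ∑ i ∈ I, 2 ^ (p + q) * #(univ.filter (P i)) := by
          rw [mul_sum, mul_sum]; apply sum_congr rfl; intros; ring
      _ ≤ ∑ i ∈ I, M := sum_le_sum h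
      _ = #I * M := by simp
      _ ≤ _ := Nat.mul_le_mul_right _ hI
  have h4 := Nat.le_of_mul_le_mul_left h3 (by positivity)
  refine le_trans (Nat.mul_le_mul_left _ (le_trans
    (card_le_card (t := I.biUnion fun i => univ.filter (P i)) ?_) h2)) h4
  intro ω; simp

/-- Chernoff type bound. -/
lemma chernoff {X : Type*} [Fintype X] [DecidableEq X] (D : Finset X) (e : ℕ) (β : Bool)
    (hD : 8 * e ≤ #D) :
    2 ^ e * Nat.card {ς : X → Bool // #{y ∈ D | ς y = β} < e} ≤ 2 ^ Fintype.card X := by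
  classical
  obtain ⟨D0, hD0, hc⟩ := exists_subset_card_eq hD
  rw [Nat.card_eq_fintype_card, Fintype.card_subtype]
  set W : Finset (X → Bool) := {ς | #{y ∈ D | ς y = β} < e} with hW
  let w : X → Bool → ℕ := fun y b => if y ∈ D0 then (if b = β then 1 else 16) else 1
  have hsum : ∑ ς : X → Bool, ∏ y, w y (ς y) = ∏ y, ∑ b, w y b := by
    rw [Finset.prod_univ_sum, Fintype.piFinset_univ]
  have hs2 : ∀ y, ∑ b, w y b = if y ∈ D0 then 17 else 2 := by
    intro y
    by_cases hy : y ∈ D0 <;> cases β <;> simp [w, hy]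
  have hp : (∏ y, ∑ b, w y b) * 2 ^ (8 * e) = 17 ^ (8 * e) * 2 ^ Fintype.card X := by
    simp only [hs2]
    rw [prod_ite]
    simp only [prod_const]
    have a1 : #(univ.filter fun y => y ∈ D0) = 8 * e := by simp [hc]
    have a2 : #(univ.filter fun y => y ∉ D0) + 8 * e = Fintype.card X := by
      rw [← a1, add_comm, card_filter_add_card_filter_not]; rfl
    rw [a1, ← a2, pow_add]; ring
  have hlow : ∀ ς ∈ W, 16 ^ (7 * e) ≤ ∏ y, w y (ς y) := by
    intro ς hς
    have hς' : #{y ∈ D | ς y = β} < e := by simpa [hW] using hς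
    have b1 : ∏ y, w y (ς y) = ∏ y ∈ D0, (if ς y = β then 1 else 16) := by
      rw [← prod_subset (subset_univ D0)]
      · apply prod_congr rfl; intro y hy; simp [w, hy]
      · intro y _ hy; simp [w, hy]
    rw [b1, prod_ite]
    simp only [prod_const, one_pow, one_mul]
    apply Nat.pow_le_pow_right (by norm_num)
    have c1 : #{y ∈ D0 | ς y = β} + #{y ∈ D0 | ¬ ς y = β} = #D0 :=
      card_filter_add_card_filter_not _
    have c2 : #{y ∈ D0 | ς y = β} ≤ #{y ∈ D | ς y = β} :=
      card_le_card (filter_subset_filter _ hD0)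
    omega
  have h1 : #W * 16 ^ (7 * e) ≤ ∑ ς : X → Bool, ∏ y, w y (ς y) := by
    calc #W * 16 ^ (7 * e) = ∑ ς ∈ W, 16 ^ (7 * e) := by simp
      _ ≤ ∑ ς ∈ W, ∏ y, w y (ς y) := sum_le_sum hlow
      _ ≤ _ := sum_le_sum_of_subset (subset_univ _)
  rw [hsum] at h1
  have h2 : 17 ^ (8 * e) ≤ 2 ^ (33 * e) := by
    rw [pow_mul, pow_mul]; exact Nat.pow_le_pow_left (by norm_num) _
  have h3 : #W * 16 ^ (7 * e) * 2 ^ (8 * e) ≤ 2 ^ (33 * e) * 2 ^ Fintype.card X := by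
    calc _ ≤ (∏ y, ∑ b, w y b) * 2 ^ (8 * e) := Nat.mul_le_mul_right _ h1
      _ = _ := hp
      _ ≤ _ := Nat.mul_le_mul_right _ h2
  have h4 : 2 ^ (33 * e) * (2 ^ e * #W) ≤ 2 ^ (33 * e) * 2 ^ Fintype.card X := by
    calc 2 ^ (33 * e) * (2 ^ e * #W) ≤ 2 ^ (33 * e) * (2 ^ (3 * e) * #W) := by
          gcongr <;> omega
      _ = #W * 16 ^ (7 * e) * 2 ^ (8 * e) := by
          rw [show (16 : ℕ) = 2 ^ 4 by norm_num, ← pow_mul]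
          rw [mul_assoc, ← pow_add, ← mul_assoc, ← pow_add, mul_comm]; congr 2; ring
      _ ≤ _ := h3
  exact Nat.le_of_mul_le_mul_left h4 (by positivity)

/-- One coordinate of a product resampled. -/
lemma resample {ι Ω : Type*} [Fintype ι] [DecidableEq ι] [Fintype Ω] (x0 : ι)
    (p : (ι → Ω) → Prop) (q : (ι → Ω) → Ω → Prop) (G M : ℕ)
    (hp : ∀ σ w, p σ → p (Function.update σ x0 w))
    (hq : ∀ σ w v, q (Function.update σ x0 w) v ↔ q σ v)
    (hM : M = Fintype.card Ω) (hM0 : 0 < M)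
    (hb : ∀ σ, G * Nat.card {v // q σ v} ≤ M) :
    G * Nat.card {σ // p σ ∧ q σ (σ x0)} ≤ Nat.card {σ // p σ} := by
  classical
  let Φ : {σ // p σ ∧ q σ (σ x0)} × Ω ≃ Σ σ : {σ // p σ}, {v // q σ.1 v} :=
    { toFun := fun t => ⟨⟨Function.update t.1.1 x0 t.2, hp _ _ t.1.2.1⟩,
        ⟨t.1.1 x0, (hq _ _ _).2 t.1.2.2⟩⟩
      invFun := fun t => ⟨⟨Function.update t.1.1 x0 t.2.1, hp _ _ t.1.2, by
        rw [hq]; simpa using t.2.2⟩, t.1.1 x0⟩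
      left_inv := by
        rintro ⟨⟨σ, h1, h2⟩, v⟩
        simp
      right_inv := by
        rintro ⟨⟨σ, h1⟩, ⟨v, h2⟩⟩
        have : Function.update (Function.update σ x0 v) x0 (σ x0) = σ := by simp
        apply Sigma.ext
        · simp
        · simp only
          refine (Subtype.heq_iff_coe_eq ?_).2 ?_
          · intro u; simp
          · simp }
  have h1 := Nat.card_congr Φ
  rw [Nat.card_prod, Nat.card_sigma, Nat.card_eq_fintype_card (α := Ω), ← hM] at h1
  have h2 : M * (G * Nat.card {σ // p σ ∧ q σ (σ x0)}) ≤ M * Nat.card {σ // p σ} := by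
    calc _ = G * (Nat.card {σ // p σ ∧ q σ (σ x0)} * M) := by ring
      _ = ∑ σ : {σ // p σ}, G * Nat.card {v // q σ.1 v} := by rw [h1, mul_sum]
      _ ≤ ∑ σ : {σ // p σ}, M := sum_le_sum fun σ _ => hb _
      _ = _ := by simp [Nat.card_eq_fintype_card]; ring
  exact Nat.le_of_mul_le_mul_left h2 hM0

lemma indep {ι Ω : Type*} [Fintype ι] [DecidableEq ι] [Fintype Ω] [Nonempty Ω]
    (S F : Finset ι) (hSF : Disjoint F S)
    (q : (ι → Ω) → ι → Ω → Prop) (g : ℕ)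
    (hq : ∀ σ σ' : ι → Ω, (∀ x ∈ S, σ x = σ' x) → ∀ x v, q σ x v ↔ q σ' x v)
    (hb : ∀ σ x, 2 ^ g * Nat.card {v // q σ x v} ≤ Fintype.card Ω) :
    2 ^ (g * #F) * Nat.card {σ : ι → Ω // ∀ x ∈ F, q σ x (σ x)} ≤ Fintype.card (ι → Ω) := by
  classical
  induction F using Finset.induction_on with
  | empty =>
    simp [Nat.card_eq_fintype_card]
  | insert x0 F hx ih =>
    have ih' := ih (disjoint_of_subset_left (subset_insert _ _) hSF)
    have hx0 : x0 ∉ S := disjoint_left.1 hSF (mem_insert_self _ _)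
    have hupd : ∀ (σ : ι → Ω) w, ∀ x ∈ S, Function.update σ x0 w x = σ x := by
      intro σ w x hxS
      rw [Function.update_of_ne]; rintro rfl; exact hx0 hxS
    have := resample x0 (fun σ => ∀ x ∈ F, q σ x (σ x)) (fun σ v => q σ x0 v) (2 ^ g) _
      (by
        intro σ w h x hxF
        rw [hq _ _ (hupd σ w), Function.update_of_ne]
        · exact h x hxF
        · rintro rfl; exact hx hxF)
      (by intro σ w v; exact hq _ _ (hupd σ w) _ _) rfl Fintype.card_pos (fun σ => hb σ x0)
    have e : Nat.card {σ : ι → Ω // ∀ x ∈ insert x0 F, q σ x (σ x)} =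
        Nat.card {σ : ι → Ω // (∀ x ∈ F, q σ x (σ x)) ∧ q σ x0 (σ x0)} := by
      apply Nat.card_congr
      apply Equiv.subtypeEquivRight
      intro σ
      simp [and_comm]
    rw [e, card_insert_of_notMem hx]
    calc _ = 2 ^ (g * #F) * (2 ^ g * Nat.card {σ : ι → Ω // (∀ x ∈ F, q σ x (σ x)) ∧ q σ x0 (σ x0)}) := by
          rw [mul_add, pow_add, mul_one, mul_assoc]
      _ ≤ _ := le_trans (Nat.mul_le_mul_left _ this) ih'

/-- Extraction of weight. -/
lemma weight {ι : Type*} [DecidableEq ι] (w : ι → ℕ) (m0 s e : ℕ) (J' : Finset ι) (he : 0 < e)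
    (H : ∀ J ⊆ J', m0 ≤ #J → ∃ S ⊆ J, #S ≤ s ∧ e ≤ ∑ x ∈ S, w x) :
    ∀ J ⊆ J', #J * e ≤ s * ∑ x ∈ J, w x + m0 * e := by
  intro J
  induction J using Finset.strongInduction with
  | H J ih =>
    intro hJ
    by_cases hm : m0 ≤ #J
    · obtain ⟨S, hS, hs, hw⟩ := H J hJ hm
      have hne : S.Nonempty := by
        by_contra hn
        rw [not_nonempty_iff_eq_empty] at hn
        subst hn
        simp at hw; omega
      have := ih (J \ S) (sdiff_ssubset hS hne) (sdiff_subset.trans hJ)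
      have e1 : ∑ x ∈ J \ S, w x + ∑ x ∈ S, w x = ∑ x ∈ J, w x := sum_sdiff hS
      have e2 : #(J \ S) + #S = #J := card_sdiff_add_card_eq_card hS
      rw [← e1, ← e2]
      have : #S * e ≤ s * ∑ x ∈ S, w x := Nat.mul_le_mul hs hw
      nlinarith
    · push Not at hm
      have := Nat.mul_le_mul_right e hm.le
      omega

lemma greedy {ι X : Type*} [DecidableEq ι] [Fintype X] [DecidableEq X]
    (A B : ι → Finset X) (J : Finset ι) (h d : ℕ) (hX : 0 < Fintype.card X)
    (hprog : ∀ S ⊆ J, #S ≤ 2 * h → 4 * d * #(S.biUnion A ∩ S.biUnion B) < Fintype.card X →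
      ∃ x ∈ J \ S, Fintype.card X ≤ h * #(A x \ S.biUnion A) ∨
        Fintype.card X ≤ h * #(B x \ S.biUnion B)) :
    ∃ S ⊆ J, #S ≤ 2 * h + 1 ∧ Fintype.card X ≤ 4 * d * #(S.biUnion A ∩ S.biUnion B) := by
  by_contra hcon
  push Not at hcon
  have key : ∀ m, m ≤ 2 * h + 1 → ∃ S ⊆ J, #S = m ∧
      m * Fintype.card X ≤ h * (#(S.biUnion A) + #(S.biUnion B)) := by
    intro m
    induction m with
    | zero => intro _; exact ⟨∅, by simp, by simp, by simp⟩
    | succ m ih =>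
      intro hm
      obtain ⟨S, hS, hc, hΦ⟩ := ih (by omega)
      obtain ⟨x, hx, hg⟩ := hprog S hS (by omega) (hcon S hS (by omega))
      rw [mem_sdiff] at hx
      refine ⟨insert x S, insert_subset hx.1 hS, by rw [card_insert_of_notMem hx.2, hc], ?_⟩
      have u : ∀ C : ι → Finset X, #((insert x S).biUnion C) = #(C x \ S.biUnion C) + #(S.biUnion C) := by
        intro C
        rw [biUnion_insert, ← sdiff_union_self_eq_union, card_union_of_disjoint sdiff_disjoint]
      rw [u, u]
      rcases hg with hg | hg <;> nlinarith
  obtain ⟨S, _, _, hΦ⟩ := key _ le_rfl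
  have a1 : #(S.biUnion A) ≤ Fintype.card X := card_le_univ _
  have a2 : #(S.biUnion B) ≤ Fintype.card X := card_le_univ _
  nlinarith
end DNC

namespace DNC
open Finset

lemma cov_aux {X : Type*} [DecidableEq X] (U AS BS : Finset X) (d N : ℕ)
    (h : N ≤ 2 * d * #U) (c1 : 8 * d * #(U \ AS) < N) (c2 : 8 * d * #(U \ BS) < N)
    (c3 : 4 * d * #(AS ∩ BS) < N) : False := by
  have hcov : #U ≤ #(U \ AS) + #(U \ BS) + #(AS ∩ BS) := by
    have : U ⊆ ((U \ AS) ∪ (U \ BS)) ∪ (AS ∩ BS) := by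
      intro y hy
      simp only [mem_union, mem_sdiff, mem_inter]; tauto
    have h1 := card_le_card this
    have h2 := card_union_le ((U \ AS) ∪ (U \ BS)) (AS ∩ BS)
    have h3 := card_union_le (U \ AS) (U \ BS)
    omega
  have hcov' := Nat.mul_le_mul_left (8 * d) hcov
  nlinarith

set_option maxHeartbeats 1000000 in
lemma core {X : Type*} [Fintype X] [DecidableEq X] {K n f e e2 d h h' : ℕ}
    (U : Fin K → Finset X) (A B A' B' : ℕ → Fin K → Finset X) (ς ρ : X → Bool)
    (hd : 0 < d) (hh : 0 < h) (hf : 2 * h + 1 ≤ f) (hK : K = 16 * d * f)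
    (hN : Fintype.card X = 32 * d * e) (hN2 : Fintype.card X = 8 * h * e2)
    (hX : 0 < Fintype.card X) (hh' : 1024 * d ^ 2 * h ≤ h')
    (hU : K * Fintype.card X ≤ d * ∑ x, #(U x))
    (Aanti : ∀ a b x, a ≤ b → A b x ⊆ A a x) (Banti : ∀ a b x, a ≤ b → B b x ⊆ B a x)
    (T : Fin K → Finset X → Prop) [∀ x V, Decidable (T x V)]
    (hT : ∀ x V, T x V → ∃ a b, a + b = n ∧ Fintype.card X ≤ h * #(A a x ∩ V) ∧
      Fintype.card X ≤ h * #(B b x ∩ V))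
    (G1A : ∀ S : Finset (Fin K), #S ≤ 2 * h + 1 → ∀ a ≤ n,
      #{x | x ∉ S ∧ Fintype.card X ≤ 8 * d * #(U x \ S.biUnion fun x => A a x ∩ U x) ∧
        ¬ T x (U x \ S.biUnion fun x => A a x ∩ U x)} < f)
    (G1B : ∀ S : Finset (Fin K), #S ≤ 2 * h + 1 → ∀ a ≤ n,
      #{x | x ∉ S ∧ Fintype.card X ≤ 8 * d * #(U x \ S.biUnion fun x => B a x ∩ U x) ∧
        ¬ T x (U x \ S.biUnion fun x => B a x ∩ U x)} < f)
    (G2 : ∀ S : Finset (Fin K), #S ≤ 2 * h + 1 → ∀ a b, a + b = n →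
      8 * e ≤ #((S.biUnion fun x => A a x ∩ U x) ∩ (S.biUnion fun x => B b x ∩ U x)) →
      e ≤ #{y ∈ (S.biUnion fun x => A a x ∩ U x) ∩ (S.biUnion fun x => B b x ∩ U x) | ς y = true})
    (G3A : ∀ x, ∀ a ≤ n + 1, 8 * e2 ≤ #(A a x ∩ U x) → e2 ≤ #{y ∈ A a x ∩ U x | ς y = false})
    (G3B : ∀ x, ∀ a ≤ n + 1, 8 * e2 ≤ #(B a x ∩ U x) → e2 ≤ #{y ∈ B a x ∩ U x | ς y = false})
    (hA1 : ∀ a x y, y ∈ A a x → ς y = false → y ∈ A' a x)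
    (hB1 : ∀ a x y, y ∈ B a x → ς y = false → y ∈ B' a x)
    (hA2 : ∀ a x y, y ∈ A a x → ς y = true → ρ y = true → y ∈ A' (a + 1) x)
    (hB2 : ∀ a x y, y ∈ B a x → ς y = true → ρ y = false → y ∈ B' (a + 1) x) :
    ∃ a b, a + b = n + 1 ∧ K * Fintype.card X ≤ h' * ∑ x, #(A' a x ∩ U x) ∧
      K * Fintype.card X ≤ h' * ∑ x, #(B' b x ∩ U x) := by
  set N := Fintype.card X with hNdef
  have he : 0 < e := by
    rcases Nat.eq_zero_or_pos e with h0 | h0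
    · subst h0; omega
    · exact h0
  -- survival of unselected rows
  have surv : ∀ (C C' : ℕ → Fin K → Finset X),
      (∀ x, ∀ a ≤ n + 1, 8 * e2 ≤ #(C a x ∩ U x) → e2 ≤ #{y ∈ C a x ∩ U x | ς y = false}) →
      (∀ a x y, y ∈ C a x → ς y = false → y ∈ C' a x) →
      ∀ a ≤ n + 1, f ≤ #{x | N ≤ h * #(C a x ∩ U x)} →
      K * N ≤ h' * ∑ x, #(C' a x ∩ U x) := by
    intro C C' hG hC a ha hfa
    have s1 : ∀ x ∈ univ.filter (fun x => N ≤ h * #(C a x ∩ U x)), e2 ≤ #(C' a x ∩ U x) := by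
      intro x hx
      rw [mem_filter] at hx
      have : h * (8 * e2) ≤ h * #(C a x ∩ U x) := by
        calc h * (8 * e2) = N := by rw [hN2]; ring
          _ ≤ _ := hx.2
      refine le_trans (hG x a ha (Nat.le_of_mul_le_mul_left this hh)) (card_le_card ?_)
      intro y hy
      simp only [mem_filter, mem_inter] at hy ⊢
      exact ⟨hC _ _ _ hy.1.1 hy.2, hy.1.2⟩
    have s2 : f * e2 ≤ ∑ x, #(C' a x ∩ U x) := by
      calc f * e2 ≤ #{x | N ≤ h * #(C a x ∩ U x)} * e2 := Nat.mul_le_mul_right _ hfa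
        _ = ∑ x ∈ univ.filter (fun x => N ≤ h * #(C a x ∩ U x)), e2 := by simp
        _ ≤ ∑ x ∈ univ.filter (fun x => N ≤ h * #(C a x ∩ U x)), #(C' a x ∩ U x) := sum_le_sum s1
        _ ≤ _ := sum_le_sum_of_subset (subset_univ _)
    calc K * N = (128 * d * h) * (f * e2) := by rw [hN2, hK]; ring
      _ ≤ h' * (f * e2) := by
          apply Nat.mul_le_mul_right
          refine le_trans ?_ hh'
          apply Nat.mul_le_mul_right
          nlinarith
      _ ≤ _ := Nat.mul_le_mul_left _ s2
  by_contra hcon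
  push Not at hcon
  set J : Finset (Fin K) := {x | N ≤ 2 * d * #(U x)} with hJdef
  have hJ : 8 * f ≤ #J := by
    have t1 : ∀ x, 2 * d * #(U x) ≤ (if x ∈ J then 2 * d * N else 0) + N := by
      intro x
      split_ifs with hx
      · have : #(U x) ≤ N := card_le_univ _
        have := Nat.mul_le_mul_left (2 * d) this
        omega
      · simp [hJdef] at hx; omega
    have t2 := sum_le_sum (s := univ) fun x _ => t1 x
    rw [sum_add_distrib, ← mul_sum, ← sum_filter] at t2
    simp only [filter_mem_eq_inter, univ_inter, sum_const, smul_eq_mul, card_univ,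
      Fintype.card_fin] at t2
    have t3 : K * N ≤ (#J * (2 * d)) * N := by nlinarith
    have t4 := Nat.le_of_mul_le_mul_right t3 hX
    have t6 := hK.symm.le.trans t4
    have t5 : (2 * d) * (8 * f) ≤ (2 * d) * #J := by linarith
    exact Nat.le_of_mul_le_mul_left t5 (by omega)
  have hbad := G1A ∅ (by simp) 0 (by omega)
  simp only [biUnion_empty, sdiff_empty, notMem_empty, not_false_eq_true, true_and] at hbad
  set Bd : Finset (Fin K) := {x | N ≤ 8 * d * #(U x) ∧ ¬ T x (U x)} with hBd
  have hTU : ∀ x ∈ J, x ∉ Bd → T x (U x) := by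
    intro x hx hx'
    simp only [hBd, mem_filter, mem_univ, true_and, not_and, not_not] at hx'
    apply hx'
    simp only [hJdef, mem_filter, mem_univ, true_and] at hx
    nlinarith
  have hmono : ∀ {P Q : Finset X}, P ⊆ Q → N ≤ h * #P → N ≤ h * #Q := fun hPQ hP =>
    hP.trans (Nat.mul_le_mul_left _ (card_le_card hPQ))
  have hJB : f ≤ #(J \ Bd) := by
    have := le_card_sdiff Bd J
    omega
  have hα0 : f ≤ #{x | N ≤ h * #(A 0 x ∩ U x)} := by
    refine hJB.trans (card_le_card ?_)
    intro x hx
    rw [mem_sdiff] at hx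
    obtain ⟨a, b, hab, h1, h2⟩ := hT x _ (hTU x hx.1 hx.2)
    simp only [mem_filter, mem_univ, true_and]
    exact hmono (inter_subset_inter_right (Aanti _ _ _ (Nat.zero_le a))) h1
  have hβ0 : f ≤ #{x | N ≤ h * #(B 0 x ∩ U x)} := by
    refine hJB.trans (card_le_card ?_)
    intro x hx
    rw [mem_sdiff] at hx
    obtain ⟨a, b, hab, h1, h2⟩ := hT x _ (hTU x hx.1 hx.2)
    simp only [mem_filter, mem_univ, true_and]
    exact hmono (inter_subset_inter_right (Banti _ _ _ (Nat.zero_le b))) h2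
  have hno : ∀ a b, a + b = n + 1 → f ≤ #{x | N ≤ h * #(A a x ∩ U x)} →
      #{x | N ≤ h * #(B b x ∩ U x)} < f := by
    intro a b hab ha
    by_contra hb
    push Not at hb
    have h1 := surv A A' G3A hA1 a (by omega) ha
    have h2 := surv B B' G3B hB1 b (by omega) hb
    have := hcon a b hab h1
    omega
  obtain ⟨a, han, hαa, hαa1⟩ : ∃ a ≤ n, f ≤ #{x | N ≤ h * #(A a x ∩ U x)} ∧
      #{x | N ≤ h * #(A (a + 1) x ∩ U x)} < f := by
    by_contra hc
    push Not at hc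
    have : ∀ a ≤ n + 1, f ≤ #{x | N ≤ h * #(A a x ∩ U x)} := by
      intro a
      induction a with
      | zero => intro _; exact hα0
      | succ a ih => intro ha; exact hc a (by omega) (ih (by omega))
    have := hno (n + 1) 0 (by omega) (this _ le_rfl)
    omega
  obtain ⟨b, hab⟩ : ∃ b, a + b = n := ⟨n - a, by omega⟩
  have hβ1 := hno a (b + 1) (by omega) hαa
  set ExA : Finset (Fin K) := {x | N ≤ h * #(A (a + 1) x ∩ U x)} with hExA
  set ExB : Finset (Fin K) := {x | N ≤ h * #(B (b + 1) x ∩ U x)} with hExB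
  set J' := (J \ ExA) \ ExB with hJ'
  have hJ'c : 6 * f ≤ #J' := by
    have h1 := le_card_sdiff ExA J
    have h2 : #(J \ ExA) - #ExB ≤ #J' := le_card_sdiff ExB (J \ ExA)
    omega
  have htype : ∀ x ∈ J', ∀ V ⊆ U x, T x V → N ≤ h * #(A a x ∩ V) ∧ N ≤ h * #(B b x ∩ V) := by
    intro x hx V hV hTV
    obtain ⟨a1, b1, hab1, h1, h2⟩ := hT x V hTV
    simp only [hJ', mem_sdiff, hExA, hExB, mem_filter, mem_univ, true_and] at hx
    have ha : a1 ≤ a := by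
      by_contra hlt
      exact hx.1.2 (hmono (inter_subset_inter (Aanti _ _ _ (by omega)) hV) h1)
    have hb : b1 ≤ b := by
      by_contra hlt
      exact hx.2 (hmono (inter_subset_inter (Banti _ _ _ (by omega)) hV) h2)
    obtain rfl : a1 = a := by omega
    obtain rfl : b1 = b := by omega
    exact ⟨h1, h2⟩
  -- B_b dense as well
  have hβb : f ≤ #{x | N ≤ h * #(B b x ∩ U x)} := by
    have h1 := le_card_sdiff Bd J'
    refine le_trans (by omega : f ≤ #(J' \ Bd)) (card_le_card ?_)
    intro x hx
    rw [mem_sdiff] at hx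
    have hxJ : x ∈ J := (mem_sdiff.1 (mem_sdiff.1 hx.1).1).1
    simp only [mem_filter, mem_univ, true_and]
    exact (htype x hx.1 _ subset_rfl (hTU x hxJ hx.2)).2
  -- weights
  let w : Fin K → ℕ := fun x => #(A' (a + 1) x ∩ U x) + #(B' (b + 1) x ∩ U x)
  have hw : ∀ J'' ⊆ J', 3 * f ≤ #J'' → ∃ S ⊆ J'', #S ≤ 2 * h + 1 ∧ e ≤ ∑ x ∈ S, w x := by
    intro J'' hJ'' hc
    obtain ⟨S, hS, hSc, hD⟩ := greedy (fun x => A a x ∩ U x) (fun x => B b x ∩ U x) J'' h d hX (by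
      intro S hS hSc hlt
      have g1 := G1A S (by omega) a han
      have g2 := G1B S (by omega) b (by omega)
      set F1 : Finset (Fin K) := {x | x ∉ S ∧ N ≤ 8 * d * #(U x \ S.biUnion fun x => A a x ∩ U x) ∧
        ¬ T x (U x \ S.biUnion fun x => A a x ∩ U x)} with hF1
      set F2 : Finset (Fin K) := {x | x ∉ S ∧ N ≤ 8 * d * #(U x \ S.biUnion fun x => B b x ∩ U x) ∧
        ¬ T x (U x \ S.biUnion fun x => B b x ∩ U x)} with hF2
      have hne : 0 < #(((J'' \ S) \ F1) \ F2) := by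
        have h1 := le_card_sdiff S J''
        have h2 := le_card_sdiff F1 (J'' \ S)
        have h3 := le_card_sdiff F2 ((J'' \ S) \ F1)
        omega
      obtain ⟨x, hx⟩ := card_pos.1 hne
      simp only [mem_sdiff] at hx
      obtain ⟨⟨⟨hxJ, hxS⟩, hx1⟩, hx2⟩ := hx
      refine ⟨x, mem_sdiff.2 ⟨hxJ, hxS⟩, ?_⟩
      simp only [hF1, mem_filter, mem_univ, true_and, not_and, not_not] at hx1
      simp only [hF2, mem_filter, mem_univ, true_and, not_and, not_not] at hx2
      have hx1 := hx1 hxS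
      have hx2 := hx2 hxS
      have hxJ' := hJ'' hxJ
      have hxd : N ≤ 2 * d * #(U x) := by
        have : x ∈ J := (mem_sdiff.1 (mem_sdiff.1 hxJ').1).1
        simpa [hJdef] using this
      set AS := S.biUnion fun x => A a x ∩ U x with hAS
      set BS := S.biUnion fun x => B b x ∩ U x with hBS
      by_cases c1 : N ≤ 8 * d * #(U x \ AS)
      · left
        refine hmono ?_ (htype x hxJ' _ sdiff_subset (hx1 c1)).1
        intro y; simp only [mem_inter, mem_sdiff]; tauto
      · by_cases c2 : N ≤ 8 * d * #(U x \ BS)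
        · right
          refine hmono ?_ (htype x hxJ' _ sdiff_subset (hx2 c2)).2
          intro y; simp only [mem_inter, mem_sdiff]; tauto
        · exfalso
          exact cov_aux _ _ _ d N hxd (not_le.1 c1) (not_le.1 c2) hlt)
    refine ⟨S, hS, hSc, ?_⟩
    have hD8 : 8 * e ≤ #((S.biUnion fun x => A a x ∩ U x) ∩ (S.biUnion fun x => B b x ∩ U x)) := by
      have : (4 * d) * (8 * e) ≤
          4 * d * #((S.biUnion fun x => A a x ∩ U x) ∩ (S.biUnion fun x => B b x ∩ U x)) := by
        calc (4 * d) * (8 * e) = N := by rw [hN]; ring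
          _ ≤ _ := hD
      exact Nat.le_of_mul_le_mul_left this (by omega)
    refine (G2 S hSc a b hab hD8).trans ?_
    have hsub : {y ∈ (S.biUnion fun x => A a x ∩ U x) ∩ (S.biUnion fun x => B b x ∩ U x) | ς y = true}
        ⊆ S.biUnion fun x => (A' (a + 1) x ∩ U x) ∪ (B' (b + 1) x ∩ U x) := by
      intro y hy
      simp only [mem_filter, mem_inter, mem_biUnion] at hy
      obtain ⟨⟨⟨x1, hx1, hy1⟩, ⟨x2, hx2, hy2⟩⟩, hs⟩ := hy
      simp only [mem_biUnion, mem_union, mem_inter]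
      cases hr : ρ y with
      | true => exact ⟨x1, hx1, Or.inl ⟨hA2 _ _ _ hy1.1 hs hr, hy1.2⟩⟩
      | false => exact ⟨x2, hx2, Or.inr ⟨hB2 _ _ _ hy2.1 hs hr, hy2.2⟩⟩
    refine (card_le_card hsub).trans (card_biUnion_le.trans (sum_le_sum ?_))
    intro x _
    exact card_union_le _ _
  have hW := weight w (3 * f) (2 * h + 1) e J' he hw J' subset_rfl
  have hW2 : ∑ x ∈ J', w x ≤ ∑ x, #(A' (a + 1) x ∩ U x) + ∑ x, #(B' (b + 1) x ∩ U x) := by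
    rw [← sum_add_distrib]
    exact sum_le_sum_of_subset (subset_univ _)
  set WA := ∑ x, #(A' (a + 1) x ∩ U x)
  set WB := ∑ x, #(B' (b + 1) x ∩ U x)
  have h3 : 3 * f * e ≤ (2 * h + 1) * (WA + WB) := by
    have h1 : 6 * f * e ≤ #J' * e := Nat.mul_le_mul_right _ hJ'c
    have h2 := Nat.mul_le_mul_left (2 * h + 1) hW2
    nlinarith
  have h4 : f * e ≤ h * (WA + WB) := by
    have : (2 * h + 1) * (WA + WB) ≤ (3 * h) * (WA + WB) := Nat.mul_le_mul_right _ (by omega)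
    nlinarith
  have h5 : ∀ W, WA + WB ≤ 2 * W → K * N ≤ h' * W := by
    intro W hWW
    calc K * N = (512 * d ^ 2) * (f * e) := by rw [hN, hK]; ring
      _ ≤ (512 * d ^ 2) * (h * (2 * W)) :=
          Nat.mul_le_mul_left _ (h4.trans (Nat.mul_le_mul_left _ hWW))
      _ = (1024 * d ^ 2 * h) * W := by ring
      _ ≤ _ := Nat.mul_le_mul_right _ hh'
  rcases le_total WA WB with hle | hle
  · have := hcon a (b + 1) (by omega) (surv A A' G3A hA1 a (by omega) hαa)
    exact absurd this (not_lt.2 (h5 WB (by omega)))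
  · have := hcon (a + 1) b (by omega) (h5 WA (by omega))
    exact absurd this (not_lt.2 (surv B B' G3B hB1 b (by omega) hβb))
end DNC

namespace DNC
open Finset

/-- Number of selected lines through `z` of colour true. -/
noncomputable def red {X L : Type} [Fintype L] (inc : X → L → Prop) (σ χ : L → Bool) (z : X) : ℕ :=
  open Classical in ∑ l, if inc z l ∧ σ l = true ∧ χ l = true then 1 else 0

/-- Complementary colouring. -/
def nt {L : Type} (χ : L → Bool) : L → Bool := fun l => !(χ l)

/-- Points with at least `a` true lines and no false lines. -/
noncomputable def AA {X L : Type} [Fintype X] [Fintype L] (inc : X → L → Prop) (σ χ : L → Bool)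
    (a : ℕ) : Finset X :=
  open Classical in {z | a ≤ red inc σ χ z ∧ red inc σ (nt χ) z = 0}

def Good {X L : Type} [Fintype X] [DecidableEq X] [Fintype L] (inc : X → L → Prop) (n h : ℕ)
    (σ : L → Bool) (V : Finset X) : Prop :=
  ∀ χ : L → Bool, ∃ a b, a + b = n ∧ Fintype.card X ≤ h * #(AA inc σ χ a ∩ V) ∧
    Fintype.card X ≤ h * #(AA inc σ (nt χ) b ∩ V)

def QQ {X L : Type} [Fintype X] [DecidableEq X] [Fintype L] (inc : X → L → Prop) (n d h g : ℕ) : Prop :=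
  ∀ V : Finset X, Fintype.card X ≤ d * #V →
    2 ^ g * Nat.card {σ : L → Bool // ¬ Good inc n h σ V} ≤ 2 ^ Fintype.card L

/-- Incidences of the grid with one more dimension. -/
def stepInc {X L : Type} (K : ℕ) (inc : X → L → Prop) : Fin K × X → (Fin K × L) ⊕ X → Prop
  | (x, y), Sum.inl (x', l) => x = x' ∧ inc y l
  | (_, y), Sum.inr y' => y = y'

lemma nt_nt {L : Type} (χ : L → Bool) : nt (nt χ) = χ := by
  funext l; simp [nt]

lemma red_step {X L : Type} [Fintype X] [DecidableEq X] [Fintype L] (K : ℕ) (inc : X → L → Prop)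
    (σ χ : (Fin K × L) ⊕ X → Bool) (x : Fin K) (y : X) :
    red (stepInc K inc) σ χ (x, y) =
      red inc (fun l => σ (Sum.inl (x, l))) (fun l => χ (Sum.inl (x, l))) y +
        (if σ (Sum.inr y) = true ∧ χ (Sum.inr y) = true then 1 else 0) := by
  classical
  unfold red
  rw [Fintype.sum_sum_type, Fintype.sum_prod_type]
  congr 1
  · rw [Finset.sum_eq_single x]
    · simp [stepInc]
    · intro x' _ hx
      apply Finset.sum_eq_zero
      intro l _
      rw [if_neg]
      rintro ⟨h, _⟩
      exact hx h.1.symm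
    · simp
  · rw [Finset.sum_eq_single y]
    · simp [stepInc]
    · intro y' _ hx
      rw [if_neg]
      rintro ⟨h, _⟩
      exact hx h.symm
    · simp

lemma AA_anti {X L : Type} [Fintype X] [Fintype L] (inc : X → L → Prop) (σ χ : L → Bool)
    {a b : ℕ} (h : a ≤ b) : AA inc σ χ b ⊆ AA inc σ χ a := by
  intro z
  simp only [AA, mem_filter, mem_univ, true_and]
  rintro ⟨h1, h2⟩
  exact ⟨h.trans h1, h2⟩

lemma card_slices {K : ℕ} {X : Type} [Fintype X] [DecidableEq X] (W : Finset (Fin K × X)) :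
    #W = ∑ x, #{y | (x, y) ∈ W} := by
  simp only [card_filter]
  rw [← Fintype.sum_prod_type (f := fun z : Fin K × X => if z ∈ W then 1 else 0)]
  simp

lemma fiber {α β : Type*} [Fintype α] [Fintype β] (P : α → β → Prop) (p M : ℕ)
    (h : ∀ a, p * Nat.card {b // P a b} ≤ M) :
    p * Nat.card {t : α × β // P t.1 t.2} ≤ Fintype.card α * M := by
  classical
  let Φ : {t : α × β // P t.1 t.2} ≃ Σ a : α, {b // P a b} :=
    { toFun := fun t => ⟨t.1.1, t.1.2, t.2⟩
      invFun := fun t => ⟨(t.1, t.2.1), t.2.2⟩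
      left_inv := fun _ => rfl
      right_inv := fun _ => rfl }
  rw [Nat.card_congr Φ, Nat.card_sigma, mul_sum]
  refine (sum_le_sum fun a _ => h a).trans ?_
  simp

lemma fiber' {α β : Type*} [Fintype α] [Fintype β] (P : α → Prop) (p M : ℕ)
    (h : p * Nat.card {b // P b} ≤ M) :
    p * Nat.card {t : α × β // P t.1} ≤ M * Fintype.card β := by
  have := fiber (fun (_ : β) a => P a) p M (fun _ => h)
  rw [mul_comm M]
  refine le_trans (le_of_eq ?_) this
  congr 1
  refine Nat.card_congr ((Equiv.prodComm α β).subtypeEquiv ?_)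
  intro a; simp

lemma ub_S {K : ℕ} {L Ω : Type} [Fintype L] [Fintype Ω]
    (P : Finset (Fin K) → (Fin K → L → Bool) → ℕ → Ω → Prop) (p s n M : ℕ)
    (hinv : ∀ S χ χ' a ω, (∀ x ∈ S, χ x = χ' x) → P S χ a ω → P S χ' a ω)
    (hP : ∀ S, #S ≤ s → ∀ χ, ∀ a ≤ n,
      2 ^ (p + K + s * Fintype.card L + (n + 1)) * Nat.card {ω // P S χ a ω} ≤ M) :
    2 ^ p * Nat.card {ω // ∃ S, #S ≤ s ∧ ∃ χ, ∃ a, a ≤ n ∧ P S χ a ω} ≤ M := by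
  classical
  let I1 : Finset (Finset (Fin K)) := {S | #S ≤ s}
  let I2 : Finset (Fin K) → Finset (Fin K → L → Bool) := fun S =>
    Fintype.piFinset (fun x => if x ∈ S then univ else {fun _ => false})
  have h1 : #I1 ≤ 2 ^ K := by
    refine (card_le_univ _).trans ?_
    simp
  have h2 : ∀ S ∈ I1, #(I2 S) ≤ 2 ^ (s * Fintype.card L) := by
    intro S hS
    simp only [I1, mem_filter, mem_univ, true_and] at hS
    simp only [I2, Fintype.card_piFinset]
    calc ∏ x, #(if x ∈ S then univ else {fun _ => false} : Finset (L → Bool))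
        = ∏ x, (if x ∈ S then 2 ^ Fintype.card L else 1) := by
          apply prod_congr rfl; intro x _
          split_ifs <;> simp
      _ = (2 ^ Fintype.card L) ^ #S := by simp
      _ ≤ _ := by
          rw [← pow_mul, mul_comm s]
          exact Nat.pow_le_pow_right (by norm_num) (Nat.mul_le_mul_left _ hS)
  have h3 : #(range (n + 1)) ≤ 2 ^ (n + 1) := by
    simpa using (Nat.lt_two_pow_self (n := n + 1)).le
  have main : 2 ^ p * Nat.card {ω // ∃ S ∈ I1, ∃ χ ∈ I2 S, ∃ a ∈ range (n + 1), P S χ a ω} ≤ M := by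
    refine union_bound I1 _ p K M h1 fun S hS => ?_
    refine union_bound (I2 S) _ _ (s * Fintype.card L) M (h2 S hS) fun χ _ => ?_
    refine union_bound _ _ _ (n + 1) M h3 fun a ha => ?_
    rw [mem_range] at ha
    exact hP S (by simpa [I1] using hS) χ a (by omega)
  refine le_trans (Nat.mul_le_mul_left _ ?_) main
  refine Nat.card_le_card_of_injective (fun ω => ⟨ω.1, ?_⟩) ?_
  · obtain ⟨ω, S, hS, χ, a, ha, h⟩ := ω
    refine ⟨S, by simpa [I1] using hS, fun x => if x ∈ S then χ x else fun _ => false, ?_, a,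
      by simpa using by omega, ?_⟩
    · simp only [I2, Fintype.mem_piFinset]
      intro x
      split_ifs <;> simp
    · refine hinv _ _ _ _ _ ?_ h
      intro x hx; simp [hx]
  · intro a b h
    simpa [Subtype.ext_iff] using h

lemma card_mono {Ω : Type*} [Finite Ω] {P Q : Ω → Prop} (h : ∀ ω, P ω → Q ω) :
    Nat.card {ω // P ω} ≤ Nat.card {ω // Q ω} :=
  Nat.card_le_card_of_injective (fun ω => ⟨ω.1, h _ ω.2⟩) (by
    intro a b h
    simpa [Subtype.ext_iff] using h)

lemma card_or {Ω : Type*} [Finite Ω] {P Q : Ω → Prop} :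
    Nat.card {ω // P ω ∨ Q ω} ≤ Nat.card {ω // P ω} + Nat.card {ω // Q ω} := by
  classical
  have := Fintype.ofFinite Ω
  have e1 : ∀ Q : Ω → Prop, Nat.card {ω // Q ω} = #{ω | Q ω} := by
    intro Q
    rw [Nat.card_eq_fintype_card, Fintype.card_subtype]
  simp only [e1]
  refine (card_le_card ?_).trans (card_union_le _ _)
  intro ω
  simp

section
variable {X L : Type} [Fintype X] [DecidableEq X] [Fintype L]

/-- The remaining part of slice `x`. -/
noncomputable def VV {K : ℕ} (inc : X → L → Prop) (U : Fin K → Finset X) (S : Finset (Fin K))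
    (χ σ : Fin K → L → Bool) (a : ℕ) (x : Fin K) : Finset X :=
  U x \ S.biUnion fun x => AA inc (σ x) (χ x) a ∩ U x

lemma VV_congr {K : ℕ} (inc : X → L → Prop) (U : Fin K → Finset X) (S : Finset (Fin K))
    (χ σ χ' σ' : Fin K → L → Bool) (a : ℕ) (x : Fin K) (h : ∀ x ∈ S, χ x = χ' x)
    (h' : ∀ x ∈ S, σ x = σ' x) : VV inc U S χ σ a x = VV inc U S χ' σ' a x := by
  unfold VV
  congr 1
  apply biUnion_congr rfl
  intro x hx
  rw [h x hx, h' x hx]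

open Classical in
lemma E1_bound {K n f d h g p s : ℕ} (inc : X → L → Prop) (hQ : QQ inc n (8 * d) h g)
    (U : Fin K → Finset X)
    (hg : p + K + s * Fintype.card L + (n + 1) + K ≤ g * f) :
    2 ^ p * Nat.card {σ : Fin K → L → Bool // ∃ S, #S ≤ s ∧ ∃ χ, ∃ a, a ≤ n ∧
      f ≤ #{x | x ∉ S ∧ Fintype.card X ≤ 8 * d * #(VV inc U S χ σ a x) ∧
        ¬ Good inc n h (σ x) (VV inc U S χ σ a x)}} ≤ Fintype.card (Fin K → L → Bool) := by
  refine ub_S (fun S χ a σ => f ≤ #{x | x ∉ S ∧ Fintype.card X ≤ 8 * d * #(VV inc U S χ σ a x) ∧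
        ¬ Good inc n h (σ x) (VV inc U S χ σ a x)}) p s n _ ?_ ?_
  · intro S χ χ' a σ hS hf
    simp only [VV_congr inc U S χ σ χ' σ a _ hS (fun _ _ => rfl)] at hf
    exact hf
  · intro S hS χ a ha
    have key : 2 ^ (p + K + s * Fintype.card L + (n + 1)) *
        Nat.card {σ : Fin K → L → Bool // ∃ F ∈ (univ.powersetCard f : Finset (Finset (Fin K))),
          ∀ x ∈ F, x ∉ S ∧ Fintype.card X ≤ 8 * d * #(VV inc U S χ σ a x) ∧
            ¬ Good inc n h (σ x) (VV inc U S χ σ a x)} ≤ Fintype.card (Fin K → L → Bool) := by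
      refine union_bound _ _ _ K _ ?_ ?_
      · refine (card_le_univ _).trans ?_
        simp
      · intro F hF
        rw [mem_powersetCard] at hF
        by_cases hd : Disjoint F S
        · have := indep S F hd (fun σ x v => Fintype.card X ≤ 8 * d * #(VV inc U S χ σ a x) ∧
            ¬ Good inc n h v (VV inc U S χ σ a x)) g ?_ ?_
          · rw [hF.2] at this
            refine le_trans (Nat.mul_le_mul (Nat.pow_le_pow_right (by norm_num) hg) ?_) this
            exact card_mono fun σ hσ x hx => (hσ x hx).2
          · intro σ σ' hσ x v
            rw [VV_congr inc U S χ σ χ σ' a x (fun _ _ => rfl) hσ]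
          · intro σ x
            by_cases hV : Fintype.card X ≤ 8 * d * #(VV inc U S χ σ a x)
            · have := hQ _ hV
              simpa [hV] using this
            · simp [hV]
        · have : IsEmpty {σ : Fin K → L → Bool //
            ∀ x ∈ F, x ∉ S ∧ Fintype.card X ≤ 8 * d * #(VV inc U S χ σ a x) ∧
              ¬ Good inc n h (σ x) (VV inc U S χ σ a x)} := by
            constructor
            rintro ⟨σ, hσ⟩
            exact hd (disjoint_left.2 fun x hx => (hσ x hx).1)
          rw [Nat.card_of_isEmpty]
          simp
    refine le_trans (Nat.mul_le_mul_left _ (card_mono ?_)) key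
    intro σ hσ
    obtain ⟨F, hF, hc⟩ := exists_subset_card_eq hσ
    refine ⟨F, mem_powersetCard.2 ⟨subset_univ _, hc⟩, ?_⟩
    intro x hx
    have := hF hx
    simpa using this

/-- The doubly covered set. -/
noncomputable def DD {K : ℕ} (inc : X → L → Prop) (U : Fin K → Finset X) (S : Finset (Fin K))
    (χ σ : Fin K → L → Bool) (a b : ℕ) : Finset X :=
  (S.biUnion fun x => AA inc (σ x) (χ x) a ∩ U x) ∩
    (S.biUnion fun x => AA inc (σ x) (nt (χ x)) b ∩ U x)

lemma E2_bound {K n e p s : ℕ} (inc : X → L → Prop)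
    (U : Fin K → Finset X) (σ : Fin K → L → Bool)
    (hg : p + K + s * Fintype.card L + (n + 1) ≤ e) :
    2 ^ p * Nat.card {ς : X → Bool // ∃ S, #S ≤ s ∧ ∃ χ, ∃ a, a ≤ n ∧
      8 * e ≤ #(DD inc U S χ σ a (n - a)) ∧ #{y ∈ DD inc U S χ σ a (n - a) | ς y = true} < e} ≤
      2 ^ Fintype.card X := by
  refine ub_S (Ω := X → Bool) (L := L) (K := K)
    (fun S χ a (ς : X → Bool) => 8 * e ≤ #(DD inc U S χ σ a (n - a)) ∧
    #{y ∈ DD inc U S χ σ a (n - a) | ς y = true} < e) p s n (2 ^ Fintype.card X) ?_ ?_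
  · intro S χ χ' a ς hS hf
    have : DD inc U S χ σ a (n - a) = DD inc U S χ' σ a (n - a) := by
      unfold DD
      congr 1 <;>
      · apply biUnion_congr rfl
        intro x hx
        rw [hS x hx]
    rw [this] at hf
    exact hf
  · intro S hS χ a ha
    by_cases hD : 8 * e ≤ #(DD inc U S χ σ a (n - a))
    · refine le_trans (Nat.mul_le_mul (Nat.pow_le_pow_right (by norm_num) hg) ?_)
        (chernoff _ e true hD)
      exact card_mono fun ς h => h.2
    · simp [hD]

open Classical in
lemma E3_bound {K n e p : ℕ} (inc : X → L → Prop)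
    (U : Fin K → Finset X) (σ : Fin K → L → Bool)
    (hg : p + K + Fintype.card L + (n + 2) ≤ e) :
    2 ^ p * Nat.card {ς : X → Bool // ∃ x ∈ (univ : Finset (Fin K)),
      ∃ χ ∈ (univ : Finset (L → Bool)), ∃ a ∈ range (n + 2),
      8 * e ≤ #(AA inc (σ x) χ a ∩ U x) ∧ #{y ∈ AA inc (σ x) χ a ∩ U x | ς y = false} < e} ≤
      2 ^ Fintype.card X := by
  refine union_bound _ _ p K _ ?_ fun x _ => ?_
  · simpa using (Nat.lt_two_pow_self (n := K)).le
  refine union_bound _ _ _ (Fintype.card L) _ ?_ fun χ _ => ?_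
  · simp
  refine union_bound _ _ _ (n + 2) _ ?_ fun a _ => ?_
  · simpa using (Nat.lt_two_pow_self (n := n + 2)).le
  by_cases hD : 8 * e ≤ #(AA inc (σ x) χ a ∩ U x)
  · refine le_trans (Nat.mul_le_mul (Nat.pow_le_pow_right (by norm_num) hg) ?_)
      (chernoff _ e false hD)
    exact card_mono fun ς h => h.2
  · simp [hD]

/-- Splitting of a selection on the bigger grid. -/
def splitEquiv (X L : Type) (K : ℕ) :
    ((Fin K × L) ⊕ X → Bool) ≃ (Fin K → L → Bool) × (X → Bool) :=
  (Equiv.sumArrowEquivProdArrow _ _ _).trans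
    (Equiv.prodCongr (Equiv.curry _ _ _) (Equiv.refl _))

set_option maxHeartbeats 1000000 in
lemma step_QQ {K n f e e2 d h h' g g' : ℕ} (inc : X → L → Prop) (hQ : QQ inc n (8 * d) h g)
    (hd : 0 < d) (hh : 0 < h) (hf : 2 * h + 1 ≤ f) (hK : K = 16 * d * f)
    (hN : Fintype.card X = 32 * d * e) (hN2 : Fintype.card X = 8 * h * e2)
    (hX : 0 < Fintype.card X) (hh' : 1024 * d ^ 2 * h ≤ h')
    (hg1 : (g' + 2) + K + (2 * h + 1) * Fintype.card L + (n + 1) + K ≤ g * f)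
    (hg2 : (g' + 2) + K + (2 * h + 1) * Fintype.card L + (n + 1) ≤ e)
    (hg3 : (g' + 2) + K + Fintype.card L + (n + 2) ≤ e2) :
    QQ (stepInc K inc) (n + 1) d h' g' := by
  classical
  intro W hW
  let U : Fin K → Finset X := fun x => {y | (x, y) ∈ W}
  have hU : K * Fintype.card X ≤ d * ∑ x, #(U x) := by
    rw [← card_slices W]
    simpa using hW
  let P1 : (Fin K → L → Bool) → Prop := fun σ => ∃ S, #S ≤ 2 * h + 1 ∧ ∃ χ, ∃ a, a ≤ n ∧
      f ≤ #{x | x ∉ S ∧ Fintype.card X ≤ 8 * d * #(VV inc U S χ σ a x) ∧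
        ¬ Good inc n h (σ x) (VV inc U S χ σ a x)}
  let P2 : (Fin K → L → Bool) → (X → Bool) → Prop := fun σ ς =>
    ∃ S, #S ≤ 2 * h + 1 ∧ ∃ χ, ∃ a, a ≤ n ∧
      8 * e ≤ #(DD inc U S χ σ a (n - a)) ∧ #{y ∈ DD inc U S χ σ a (n - a) | ς y = true} < e
  let P3 : (Fin K → L → Bool) → (X → Bool) → Prop := fun σ ς =>
    ∃ x ∈ (univ : Finset (Fin K)), ∃ χ ∈ (univ : Finset (L → Bool)), ∃ a ∈ range (n + 2),
      8 * e2 ≤ #(AA inc (σ x) χ a ∩ U x) ∧ #{y ∈ AA inc (σ x) χ a ∩ U x | ς y = false} < e2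
  have b1 := fiber' (β := X → Bool) P1 _ _ (E1_bound (p := g' + 2) (f := f) inc hQ U hg1)
  have b2 := fiber P2 _ _ (fun σ => E2_bound (p := g' + 2) inc U σ hg2)
  have b3 := fiber P3 _ _ (fun σ => E3_bound (p := g' + 2) (n := n) inc U σ hg3)
  have hcL : Fintype.card (Fin K → L → Bool) * 2 ^ Fintype.card X =
      2 ^ Fintype.card ((Fin K × L) ⊕ X) := by
    simp [pow_add, ← pow_mul, mul_comm]
  have hcX : Fintype.card (X → Bool) = 2 ^ Fintype.card X := by simp
  rw [hcX, hcL] at b1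
  rw [hcL] at b2 b3
  have main : ∀ σ' : (Fin K × L) ⊕ X → Bool, ¬ Good (stepInc K inc) (n + 1) h' σ' W →
      (P1 (splitEquiv X L K σ').1 ∨ P2 (splitEquiv X L K σ').1 (splitEquiv X L K σ').2) ∨
        P3 (splitEquiv X L K σ').1 (splitEquiv X L K σ').2 := by
    intro σ' hbad
    by_contra hno
    apply hbad
    push Not at hno
    obtain ⟨⟨n1, n2⟩, n3⟩ := hno
    intro χ'
    set σ := (splitEquiv X L K σ').1 with hσ
    set ς := (splitEquiv X L K σ').2 with hς
    have eσ : ∀ x l, σ' (Sum.inl (x, l)) = σ x l := fun _ _ => rfl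
    have eς : ∀ y, σ' (Sum.inr y) = ς y := fun _ => rfl
    let χ : Fin K → L → Bool := fun x l => χ' (Sum.inl (x, l))
    let ρ : X → Bool := fun y => χ' (Sum.inr y)
    have r1 : ∀ x y, red (stepInc K inc) σ' χ' (x, y) = red inc (σ x) (χ x) y +
        (if ς y = true ∧ ρ y = true then 1 else 0) := fun x y => red_step K inc σ' χ' x y
    have r2 : ∀ x y, red (stepInc K inc) σ' (nt χ') (x, y) = red inc (σ x) (nt (χ x)) y +
        (if ς y = true ∧ (!(ρ y)) = true then 1 else 0) :=
      fun x y => red_step K inc σ' (nt χ') x y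
    have hT : ∀ x V, Good inc n h (σ x) V → ∃ a b, a + b = n ∧
        Fintype.card X ≤ h * #(AA inc (σ x) (χ x) a ∩ V) ∧
        Fintype.card X ≤ h * #(AA inc (σ x) (nt (χ x)) b ∩ V) := fun x V hV => hV (χ x)
    have hsl : ∀ (A0 : Finset (Fin K × X)),
        ∑ x, #((univ.filter fun y => (x, y) ∈ A0) ∩ U x) = #(A0 ∩ W) := by
      intro A0
      rw [card_slices]
      apply sum_congr rfl
      intro x _
      congr 1
      ext y
      simp [U]
    have hc := core (K := K) (n := n) (f := f) (e := e) (e2 := e2) (d := d) (h := h) (h' := h') U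
      (fun a x => AA inc (σ x) (χ x) a) (fun a x => AA inc (σ x) (nt (χ x)) a)
      (fun a x => {y | (x, y) ∈ AA (stepInc K inc) σ' χ' a})
      (fun a x => {y | (x, y) ∈ AA (stepInc K inc) σ' (nt χ') a}) ς ρ hd hh hf hK hN hN2 hX hh' hU
      (fun a b x hab => AA_anti _ _ _ hab) (fun a b x hab => AA_anti _ _ _ hab)
      (fun x V => Good inc n h (σ x) V) hT ?_ ?_ ?_ ?_ ?_ ?_ ?_ ?_ ?_
    · obtain ⟨a, b, hab, h1, h2⟩ := hc
      refine ⟨a, b, hab, ?_, ?_⟩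
      · rw [hsl] at h1
        simpa using h1
      · rw [hsl] at h2
        simpa using h2
    · intro S hS a ha
      by_contra hlt
      exact n1 ⟨S, hS, χ, a, ha, not_lt.1 hlt⟩
    · intro S hS a ha
      by_contra hlt
      exact n1 ⟨S, hS, fun x => nt (χ x), a, ha, not_lt.1 hlt⟩
    · intro S hS a b hab h8
      by_contra hlt
      obtain rfl : b = n - a := by omega
      exact n2 ⟨S, hS, χ, a, by omega, h8, not_le.1 hlt⟩
    · intro x a ha h8
      by_contra hlt
      exact n3 ⟨x, mem_univ _, χ x, mem_univ _, a, mem_range.2 (by omega), h8, not_le.1 hlt⟩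
    · intro x a ha h8
      by_contra hlt
      exact n3 ⟨x, mem_univ _, nt (χ x), mem_univ _, a, mem_range.2 (by omega), h8, not_le.1 hlt⟩
    · intro a x y hy hs
      simp only [AA, mem_filter, mem_univ, true_and] at hy ⊢
      rw [r1, r2, hs]
      simpa using hy
    · intro a x y hy hs
      simp only [AA, mem_filter, mem_univ, true_and, nt_nt] at hy ⊢
      rw [r1, r2, hs]
      simpa using hy
    · intro a x y hy hs hr
      simp only [AA, mem_filter, mem_univ, true_and] at hy ⊢
      rw [r1, r2, hs, hr]
      simpa using hy
    · intro a x y hy hs hr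
      simp only [AA, mem_filter, mem_univ, true_and, nt_nt] at hy ⊢
      rw [r1, r2, hs, hr]
      simpa using hy
  have c1 := card_mono main
  have c2 := card_or (P := fun σ' : (Fin K × L) ⊕ X → Bool =>
    P1 (splitEquiv X L K σ').1 ∨ P2 (splitEquiv X L K σ').1 (splitEquiv X L K σ').2)
    (Q := fun σ' => P3 (splitEquiv X L K σ').1 (splitEquiv X L K σ').2)
  have c3 := card_or (P := fun σ' : (Fin K × L) ⊕ X → Bool => P1 (splitEquiv X L K σ').1)
    (Q := fun σ' => P2 (splitEquiv X L K σ').1 (splitEquiv X L K σ').2)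
  have tr : ∀ Q : (Fin K → L → Bool) × (X → Bool) → Prop,
      Nat.card {σ' // Q (splitEquiv X L K σ')} = Nat.card {t // Q t} := fun Q =>
    Nat.card_congr ((splitEquiv X L K).subtypeEquiv fun _ => Iff.rfl)
  rw [tr (fun t => P1 t.1), tr (fun t => P2 t.1 t.2)] at c3
  rw [tr (fun t => P3 t.1 t.2)] at c2
  generalize Nat.card {t : (Fin K → L → Bool) × (X → Bool) // P1 t.1} = m1 at *
  generalize Nat.card {t : (Fin K → L → Bool) × (X → Bool) // P2 t.1 t.2} = m2 at *
  generalize Nat.card {t : (Fin K → L → Bool) × (X → Bool) // P3 t.1 t.2} = m3 at *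
  have c4 := Nat.mul_le_mul_left (2 ^ g') (c1.trans (c2.trans (Nat.add_le_add_right c3 _)))
  rw [pow_add] at b1 b2 b3
  refine c4.trans ?_
  clear c4 c1 c2 c3
  nlinarith
end
end DNC

namespace DNC
open Finset

/-- A grid of dimension `n` realised by lines and points in the plane. -/
def Real0 {X L : Type} [Fintype X] [Fintype L] (inc : X → L → Prop) (n K N : ℕ) : Prop :=
  ∃ (al be : X → ℝ) (ξ η : L → ℝ),
    Fintype.card X = N ∧ K * Fintype.card L = n * N ∧
    (∀ l, Nat.card {z // inc z l} ≤ K) ∧ (∀ z, Nat.card {l // inc z l} ≤ n) ∧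
    (∀ z l, inc z l ↔ η l = al z * ξ l + be z) ∧
    (∀ l l', ξ l = ξ l' → η l = η l' → l = l') ∧
    (∀ l, ∃ k : ℕ, k ≤ n ∧ ξ l = k) ∧
    (∀ t : ℕ, n < t → ∀ z z', al z * t + be z = al z' * t + be z' → z = z')

lemma exists_B {X L : Type} [Fintype X] [Fintype L] (K n : ℕ) (al be : X → ℝ) (ξ η : L → ℝ) :
    ∃ B : ℝ, (∀ y l (x x' : Fin K), B * (((x : ℕ) : ℝ) - (x' : ℕ)) * (ξ l - (n + 1)) ≠ 0 →
        B * (((x : ℕ) : ℝ) - (x' : ℕ)) * (ξ l - (n + 1)) ≠ η l - (al y * ξ l + be y)) ∧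
      (∀ l l' (x x' : Fin K), B * (((x : ℕ) : ℝ) - (x' : ℕ)) * (ξ l - (n + 1)) ≠ 0 →
        B * (((x : ℕ) : ℝ) - (x' : ℕ)) * (ξ l - (n + 1)) ≠ η l' - η l) ∧
      (∀ y y' (t : ℕ) (x x' : Fin K), B * (((x : ℕ) : ℝ) - (x' : ℕ)) * ((t : ℝ) - (n + 1)) ≠ 0 →
        B * (((x : ℕ) : ℝ) - (x' : ℕ)) * ((t : ℝ) - (n + 1)) ≠
          (al y' * t + be y') - (al y * t + be y)) ∧ B ≠ 0 := by
  let S1 : Set ℝ := Set.range fun p : X × L × Fin K × Fin K =>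
    (η p.2.1 - (al p.1 * ξ p.2.1 + be p.1)) /
      ((((p.2.2.1 : ℕ) : ℝ) - (p.2.2.2 : ℕ)) * (ξ p.2.1 - (n + 1)))
  let S2 : Set ℝ := Set.range fun p : L × L × Fin K × Fin K =>
    (η p.2.1 - η p.1) /
      ((((p.2.2.1 : ℕ) : ℝ) - (p.2.2.2 : ℕ)) * (ξ p.1 - (n + 1)))
  let S3 : Set ℝ := Set.range fun p : X × X × ℕ × Fin K × Fin K =>
    ((al p.2.1 * p.2.2.1 + be p.2.1) - (al p.1 * p.2.2.1 + be p.1)) /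
      ((((p.2.2.2.1 : ℕ) : ℝ) - (p.2.2.2.2 : ℕ)) * ((p.2.2.1 : ℝ) - (n + 1)))
  have cX : Countable X := Finite.to_countable
  have cL : Countable L := Finite.to_countable
  have hS : (S1 ∪ S2 ∪ S3 ∪ {0}).Countable :=
    (((Set.countable_range _).union (Set.countable_range _)).union (Set.countable_range _)).union
      (Set.countable_singleton 0)
  obtain ⟨B, hB⟩ := (hS.dense_compl ℝ).nonempty
  simp only [Set.mem_compl_iff, Set.mem_union, not_or, Set.mem_singleton_iff] at hB
  obtain ⟨⟨⟨h1, h2⟩, h3⟩, h4⟩ := hB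
  refine ⟨B, ?_, ?_, ?_, h4⟩
  · intro y l x x' hne heq
    apply h1
    refine ⟨(y, l, x, x'), ?_⟩
    have hne' : (((x : ℕ) : ℝ) - (x' : ℕ)) * (ξ l - (n + 1)) ≠ 0 := by
      intro h0; apply hne; rw [mul_assoc, h0, mul_zero]
    simp only
    rw [div_eq_iff hne', ← heq, mul_assoc]
  · intro l l' x x' hne heq
    apply h2
    refine ⟨(l, l', x, x'), ?_⟩
    have hne' : (((x : ℕ) : ℝ) - (x' : ℕ)) * (ξ l - (n + 1)) ≠ 0 := by
      intro h0; apply hne; rw [mul_assoc, h0, mul_zero]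
    simp only
    rw [div_eq_iff hne', ← heq, mul_assoc]
  · intro y y' t x x' hne heq
    apply h3
    refine ⟨(y, y', t, x, x'), ?_⟩
    have hne' : (((x : ℕ) : ℝ) - (x' : ℕ)) * ((t : ℝ) - (n + 1)) ≠ 0 := by
      intro h0; apply hne; rw [mul_assoc, h0, mul_zero]
    simp only
    rw [div_eq_iff hne', ← heq, mul_assoc]

lemma step_real {X L : Type} [Fintype X] [DecidableEq X] [Fintype L] (inc : X → L → Prop)
    (n K N : ℕ) (h : Real0 inc n K N) : Real0 (stepInc K inc) (n + 1) K (K * N) := by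
  obtain ⟨al, be, ξ, η, hX, hL, hd1, hd2, hinc, hinj, hξ, hval⟩ := h
  obtain ⟨B, hB1, hB2, hB3, hB0⟩ := exists_B K n al be ξ η
  have hx0 : ∀ x x' : Fin K, x ≠ x' → ((x : ℕ) : ℝ) - (x' : ℕ) ≠ 0 := by
    intro x x' hne h0
    apply hne
    apply Fin.ext
    have : ((x : ℕ) : ℝ) = (x' : ℕ) := by linarith
    exact_mod_cast this
  have hξ0 : ∀ l, ξ l - (n + 1) ≠ 0 := by
    intro l h0
    obtain ⟨k, hk, hk'⟩ := hξ l
    have : (k : ℝ) ≤ n := by exact_mod_cast hk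
    linarith
  refine ⟨fun z => al z.2 + B * (z.1 : ℕ), fun z => be z.2 - B * (z.1 : ℕ) * (n + 1),
    Sum.elim (fun p => ξ p.2) (fun _ => (n : ℝ) + 1),
    Sum.elim (fun p => η p.2 + B * (p.1 : ℕ) * (ξ p.2 - (n + 1)))
      (fun y => al y * ((n : ℝ) + 1) + be y), ?_, ?_, ?_, ?_, ?_, ?_, ?_, ?_⟩
  · simp [hX]
  · simp only [Fintype.card_sum, Fintype.card_prod, Fintype.card_fin]
    rw [hL, hX]; ring
  · rintro (⟨x, l⟩ | y)
    · refine le_trans ?_ (hd1 l)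
      refine Nat.card_le_card_of_injective
        (fun z : {z // stepInc K inc z (Sum.inl (x, l))} => ⟨z.1.2, z.2.2⟩) ?_
      rintro ⟨⟨x1, y1⟩, h1⟩ ⟨⟨x2, y2⟩, h2⟩ he
      have e1 : x1 = x := h1.1
      have e2 : x2 = x := h2.1
      have e3 : y1 = y2 := congrArg Subtype.val he
      subst e1 e2 e3
      rfl
    · have : Nat.card (Fin K) = K := by simp
      refine le_trans ?_ this.le
      refine Nat.card_le_card_of_injective
        (fun z : {z // stepInc K inc z (Sum.inr y)} => z.1.1) ?_
      rintro ⟨⟨x1, y1⟩, h1⟩ ⟨⟨x2, y2⟩, h2⟩ he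
      have e1 : y1 = y := h1
      have e2 : y2 = y := h2
      have e3 : x1 = x2 := he
      subst e1 e2 e3
      rfl
  · rintro ⟨x, y⟩
    have h1 : Nat.card (Option {l // inc y l}) ≤ n + 1 := by
      rw [Finite.card_option]
      have := hd2 y
      omega
    refine le_trans ?_ h1
    refine Nat.card_le_card_of_surjective (fun o : Option {l // inc y l} =>
      (match o with
        | none => ⟨Sum.inr y, rfl⟩
        | some l => ⟨Sum.inl (x, l.1), rfl, l.2⟩ : {l // stepInc K inc (x, y) l})) ?_
    rintro ⟨(⟨x', l⟩ | y'), hl⟩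
    · obtain ⟨h1, h2⟩ := hl
      subst h1
      exact ⟨some ⟨l, h2⟩, rfl⟩
    · have h1 : y = y' := hl
      subst h1
      exact ⟨none, rfl⟩
  · rintro ⟨x, y⟩ (⟨x', l⟩ | y')
    · simp only [stepInc, Sum.elim_inl]
      constructor
      · rintro ⟨rfl, h⟩
        rw [(hinc _ _).1 h]; ring
      · intro h
        by_cases hx : x = x'
        · refine ⟨hx, (hinc _ _).2 ?_⟩
          subst hx
          linarith
        · exfalso
          refine hB1 y l x x' ?_ ?_
          · exact mul_ne_zero (mul_ne_zero hB0 (hx0 _ _ hx)) (hξ0 l)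
          · linarith
    · simp only [stepInc, Sum.elim_inr]
      constructor
      · rintro rfl; ring
      · intro h
        refine hval (n + 1) (by omega) _ _ ?_
        push_cast
        linarith
  · rintro (⟨x, l⟩ | y) (⟨x', l'⟩ | y') h1 h2
    · simp only [Sum.elim_inl] at h1 h2
      by_cases hx : x = x'
      · subst hx
        rw [h1] at h2
        have := hinj l l' h1 (by linarith)
        rw [this]
      · exfalso
        refine hB2 l l' x x' ?_ ?_
        · exact mul_ne_zero (mul_ne_zero hB0 (hx0 _ _ hx)) (hξ0 l)
        · rw [← h1] at h2
          linarith
    · simp only [Sum.elim_inl, Sum.elim_inr] at h1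
      exact absurd (by linarith) (hξ0 l)
    · simp only [Sum.elim_inl, Sum.elim_inr] at h1
      exact absurd (by linarith) (hξ0 l')
    · simp only [Sum.elim_inr] at h2
      rw [hval (n + 1) (by omega) y y' (by push_cast; exact h2)]
  · rintro (⟨x, l⟩ | y)
    · obtain ⟨k, hk, h⟩ := hξ l
      exact ⟨k, by omega, h⟩
    · exact ⟨n + 1, le_rfl, by simp⟩
  · rintro t ht ⟨x, y⟩ ⟨x', y'⟩ h
    simp only at h
    by_cases hx : x = x'
    · subst hx
      rw [hval t (by omega) y y' (by linarith)]
    · exfalso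
      have ht' : (t : ℝ) - (n + 1) ≠ 0 := by
        have : ((n + 1 : ℕ) : ℝ) < t := by exact_mod_cast ht
        push_cast at this
        intro h0; linarith
      refine hB3 y y' t x x' ?_ ?_
      · exact mul_ne_zero (mul_ne_zero hB0 (hx0 _ _ hx)) ht'
      · linarith

lemma base_real (K N : ℕ) : Real0 (fun (_ : Fin N) (l : Empty) => l.elim) 0 K N := by
  refine ⟨fun _ => 0, fun y => (y : ℕ), fun l => l.elim, fun l => l.elim, ?_, ?_, ?_, ?_, ?_, ?_,
    ?_, ?_⟩
  · simp
  · simp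
  · rintro ⟨⟩
  · intro z; simp
  · rintro _ ⟨⟩
  · rintro ⟨⟩
  · rintro ⟨⟩
  · intro t _ z z' h
    apply Fin.ext
    simpa using h

lemma base_QQ (N d g : ℕ) : QQ (fun (_ : Fin N) (l : Empty) => l.elim) 0 d d g := by
  intro V hV
  have hr : ∀ (σ χ : Empty → Bool) z,
      red (fun (_ : Fin N) (l : Empty) => l.elim) σ χ z = 0 := by
    intro σ χ z; simp [red]
  have hA : ∀ (σ χ : Empty → Bool), AA (fun (_ : Fin N) (l : Empty) => l.elim) σ χ 0 = univ := by
    intro σ χ; simp [AA, hr]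
  have : IsEmpty {σ : Empty → Bool // ¬ Good (fun (_ : Fin N) (l : Empty) => l.elim) 0 d σ V} := by
    constructor
    rintro ⟨σ, h⟩
    apply h
    intro χ
    refine ⟨0, 0, rfl, ?_, ?_⟩ <;> simpa [hA] using hV
  rw [Nat.card_of_isEmpty]
  simp

/-- The exponent of the density loss. -/
def uu (m n : ℕ) : ℕ := 3 * m + n * (10 + 6 * m)

lemma grid (m : ℕ) (hm : 1 ≤ m) (n : ℕ) (hn : n ≤ m) :
    ∃ (X L : Type) (_ : Fintype X) (_ : DecidableEq X) (_ : Fintype L) (inc : X → L → Prop),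
      Real0 inc n (2 ^ (2 * uu m m)) (2 ^ (2 * uu m m * n + (3 * uu m m))) ∧
      QQ inc n (2 ^ (3 * (m - n))) (2 ^ uu m n)
        (2 ^ (2 * uu m m * n + uu m m - uu m n)) := by
  induction n with
  | zero =>
    refine ⟨Fin (2 ^ (3 * uu m m)), Empty, inferInstance, inferInstance, inferInstance,
      fun _ l => l.elim, ?_, ?_⟩
    · simpa using base_real (2 ^ (2 * uu m m)) (2 ^ (3 * uu m m))
    · simpa [uu] using base_QQ _ _ _
  | succ n ih =>
    obtain ⟨X, L, i1, i2, i3, inc, hR, hQ⟩ := ih (by omega)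
    refine ⟨Fin (2 ^ (2 * uu m m)) × X, (Fin (2 ^ (2 * uu m m)) × L) ⊕ X, inferInstance,
      inferInstance, inferInstance, stepInc _ inc, ?_, ?_⟩
    · have := step_real inc _ _ _ hR
      rw [← pow_add] at this
      convert this using 2
      ring
    · obtain ⟨_, _, _, _, hX, hL, _⟩ := hR
      have hu' : uu m (n + 1) = uu m n + (10 + 6 * m) := by simp only [uu]; ring
      have hum : uu m n + (10 + 6 * m) ≤ uu m m := by
        rw [← hu']; unfold uu
        exact Nat.add_le_add_left (Nat.mul_le_mul_right _ hn) _
      have hu3 : 3 * m ≤ uu m n := by unfold uu; omega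
      generalize uu m (n + 1) = u' at *
      generalize uu m n = u at *
      generalize uu m m = v at *
      obtain ⟨δ, hδ⟩ : ∃ δ, δ = 3 * (m - (n + 1)) := ⟨_, rfl⟩
      have hδ' : 3 * (m - n) = 3 + δ := by omega
      rw [hδ', pow_add] at hQ
      rw [← hδ]
      have hδm : δ ≤ 3 * m := by omega
      obtain ⟨w, hw⟩ : ∃ w, w = 2 * v * n := ⟨_, rfl⟩
      have hw' : 2 * v * (n + 1) = w + 2 * v := by rw [hw]; ring
      rw [hw'] at *
      rw [← hw] at hX hL hQ
      have hE : Fintype.card L ≤ 2 ^ (m + w + v) := by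
        have h1 : 2 ^ (2 * v) * Fintype.card L ≤ 2 ^ (2 * v) * 2 ^ (m + w + v) := by
          rw [hL]
          calc n * 2 ^ (w + 3 * v) ≤ 2 ^ m * 2 ^ (w + 3 * v) :=
                Nat.mul_le_mul_right _ ((by omega : n ≤ m).trans (Nat.lt_two_pow_self).le)
            _ = _ := by rw [← pow_add, ← pow_add]; congr 1; omega
        exact Nat.le_of_mul_le_mul_left h1 (by positivity)
      have mono : ∀ {a b : ℕ}, a ≤ b → 2 ^ a ≤ 2 ^ b := fun h => Nat.pow_le_pow_right (by norm_num) h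
      obtain ⟨z, hz⟩ : ∃ z, z + (u + 7 + 3 * m) = w + 3 * v := ⟨w + 3 * v - (u + 7 + 3 * m), by omega⟩
      have z1 : 2 ^ (w + 2 * v + v - u') ≤ 2 ^ z := mono (by omega)
      have z2 : 2 ^ (2 * v) ≤ 2 ^ z := mono (by omega)
      have z3 : (2 * 2 ^ u + 1) * Fintype.card L ≤ 2 ^ z := by
        have : 2 * 2 ^ u + 1 ≤ 2 ^ (u + 2) := by
          have := Nat.one_le_two_pow (n := u)
          rw [pow_add]; omega
        calc _ ≤ 2 ^ (u + 2) * 2 ^ (m + w + v) := Nat.mul_le_mul this hE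
          _ = 2 ^ (u + 2 + (m + w + v)) := by rw [← pow_add]
          _ ≤ _ := mono (by omega)
      have z4 : n + 4 ≤ 2 ^ z :=
        (by omega : n + 4 ≤ z).trans (Nat.lt_two_pow_self).le
      have z5 : Fintype.card L ≤ (2 * 2 ^ u + 1) * Fintype.card L :=
        Nat.le_mul_of_pos_left _ (by positivity)
      have z8 : 8 * 2 ^ z = 2 ^ (z + 3) := by rw [pow_add]; ring
      refine step_QQ (f := 2 ^ (2 * v - 4 - δ)) (e := 2 ^ (w + 3 * v - 5 - δ))
        (e2 := 2 ^ (w + 3 * v - 3 - u)) (h := 2 ^ u) inc hQ (by positivity) (by positivity)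
        ?_ ?_ ?_ ?_ ?_ ?_ ?_ ?_ ?_
      · have h1 : 2 * 2 ^ u + 1 ≤ 2 ^ (u + 2) := by
          have := Nat.one_le_two_pow (n := u)
          rw [pow_add]; omega
        exact h1.trans (mono (by omega))
      · rw [show (16 : ℕ) = 2 ^ 4 by norm_num, ← pow_add, ← pow_add]; congr 1; omega
      · rw [hX, show (32 : ℕ) = 2 ^ 5 by norm_num, ← pow_add, ← pow_add]; congr 1; omega
      · rw [hX, show (8 : ℕ) = 2 ^ 3 by norm_num, ← pow_add, ← pow_add]; congr 1; omega
      · rw [hX]; positivity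
      · rw [show (1024 : ℕ) = 2 ^ 10 by norm_num, ← pow_mul, ← pow_add, ← pow_add]
        exact mono (by omega)
      · have h1 : 2 ^ (z + 3) ≤ 2 ^ (w + v - u) * 2 ^ (2 * v - 4 - δ) := by
          rw [← pow_add]; exact mono (by omega)
        omega
      · have h1 : 2 ^ (z + 3) ≤ 2 ^ (w + 3 * v - 5 - δ) := mono (by omega)
        omega
      · have h1 : 2 ^ (z + 3) ≤ 2 ^ (w + 3 * v - 3 - u) := mono (by omega)
        omega
end DNC

namespace DNC
open Finset

lemma final_num (r : ℕ) (hr : 4096 ≤ r) :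
    2 ^ (2 * uu (2 * r) (2 * r)) * (2 * r) ≤ r ^ (5 * r ^ 2) := by
  have h1 : 2 * r ≤ 2 ^ (r + 1) := by
    rw [pow_succ, mul_comm]
    exact Nat.mul_le_mul_right _ (Nat.lt_two_pow_self).le
  calc 2 ^ (2 * uu (2 * r) (2 * r)) * (2 * r) ≤ 2 ^ (2 * uu (2 * r) (2 * r)) * 2 ^ (r + 1) :=
        Nat.mul_le_mul_left _ h1
    _ = 2 ^ (2 * uu (2 * r) (2 * r) + (r + 1)) := by rw [← pow_add]
    _ ≤ 2 ^ (12 * (5 * r ^ 2)) := by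
        apply Nat.pow_le_pow_right (by norm_num)
        unfold uu
        nlinarith
    _ = 4096 ^ (5 * r ^ 2) := by rw [pow_mul, show (2 : ℕ) ^ 12 = 4096 by norm_num]
    _ ≤ _ := Nat.pow_le_pow_left hr _

/-- The non-vertical line of slope `a` and intercept `b`. -/
def ln (a b : ℝ) : Set (Fin 2 → ℝ) := {p | p 1 = a * p 0 + b}

lemma isLine_ln (a b : ℝ) : IsLine (ln a b) := by
  refine ⟨![0, b], ![1, a], ?_, ?_⟩
  · intro h
    have := congrFun h 0
    simp at this
  · ext p
    simp only [ln, Set.mem_setOf_eq]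
    constructor
    · intro h
      refine ⟨p 0, ?_⟩
      funext i
      fin_cases i
      · simp
      · simp [h]; ring
    · rintro ⟨t, rfl⟩
      simp; ring

lemma exists_good {X L : Type} [Fintype X] [DecidableEq X] [Fintype L] (inc : X → L → Prop)
    (n h g : ℕ) (hg : 0 < g) (hQ : QQ inc n 1 h g) : ∃ σ, Good inc n h σ univ := by
  classical
  by_contra hno
  push Not at hno
  have h1 := hQ univ (by simp)
  have h2 : Nat.card {σ : L → Bool // ¬ Good inc n h σ univ} = 2 ^ Fintype.card L := by
    rw [Nat.card_congr (Equiv.subtypeUnivEquiv hno)]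
    simp
  rw [h2] at h1
  have h3 : 1 < 2 ^ g := Nat.one_lt_two_pow (by omega)
  have h4 : 0 < 2 ^ Fintype.card L := by positivity
  nlinarith

lemma red_le {X L : Type} [Fintype L] (inc : X → L → Prop) (σ χ : L → Bool) (z : X) :
    red inc σ χ z ≤ {l | inc z l ∧ σ l = true}.ncard := by
  classical
  unfold red
  rw [← card_filter, ← Set.ncard_coe_finset]
  apply Set.ncard_le_ncard _ (Set.toFinite _)
  intro l
  simp only [coe_filter, mem_univ, true_and, Set.mem_setOf_eq]
  tauto

lemma red_zero {X L : Type} [Fintype L] (inc : X → L → Prop) (σ χ : L → Bool) (z : X)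
    (h : red inc σ χ z = 0) (l : L) (h1 : inc z l) (h2 : σ l = true) : χ l = false := by
  classical
  unfold red at h
  rw [Finset.sum_eq_zero_iff] at h
  have := h l (mem_univ _)
  by_contra hc
  simp at hc
  simp [h1, h2, hc] at this

lemma good_point {X L : Type} [Fintype X] [DecidableEq X] [Fintype L] (inc : X → L → Prop)
    (σ χ : L → Bool) (a h : ℕ) (hX : 0 < Fintype.card X)
    (hc : Fintype.card X ≤ h * #(AA inc σ χ a ∩ univ)) :
    ∃ z, a ≤ red inc σ χ z ∧ red inc σ (nt χ) z = 0 := by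
  have : 0 < #(AA inc σ χ a ∩ univ) := by
    rcases Nat.eq_zero_or_pos #(AA inc σ χ a ∩ univ) with h0 | h0
    · rw [h0] at hc; omega
    · exact h0
  obtain ⟨z, hz⟩ := card_pos.1 this
  refine ⟨z, ?_⟩
  simpa [AA] using hz
end DNC

/-- Theorem 6 of the paper (dual of the non-decomposable covering construction): for every
sufficiently large r, with T = r^(5r²), there are a finite line family L and a finite point
set P in the plane such that (i) every line of L contains at least r points of P, (ii) every
point of P shares a line of L with at most T other points of P, and (iii) P cannot be split
into two parts each meeting every line of L. -/
theorem dual_nondecomposable_covering :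
    ∃ r₀ : ℕ, ∀ r : ℕ, r₀ ≤ r →
      ∃ (L : Set (Set (Fin 2 → ℝ))) (P : Set (Fin 2 → ℝ)),
        L.Finite ∧ P.Finite ∧ (∀ ℓ ∈ L, IsLine ℓ) ∧
        (∀ ℓ ∈ L, r ≤ (ℓ ∩ P).ncard) ∧
        (∀ p ∈ P, {q ∈ P | q ≠ p ∧ ∃ ℓ ∈ L, p ∈ ℓ ∧ q ∈ ℓ}.ncard ≤ r ^ (5 * r ^ 2)) ∧
        (∀ P₁ P₂ : Set (Fin 2 → ℝ), P₁ ∪ P₂ = P → Disjoint P₁ P₂ →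
          ∃ ℓ ∈ L, (∀ p ∈ P₁, p ∉ ℓ) ∨ (∀ p ∈ P₂, p ∉ ℓ)) := by
  classical
  refine ⟨4096, fun r hr => ?_⟩
  obtain ⟨X, L, i1, i2, i3, inc, hR, hQ⟩ := DNC.grid (2 * r) (by omega) (2 * r) le_rfl
  have hnum := DNC.final_num r hr
  generalize 2 ^ (2 * DNC.uu (2 * r) (2 * r)) = K at *
  rw [Nat.sub_self, Nat.mul_zero, pow_zero] at hQ
  obtain ⟨σ, hσ⟩ := DNC.exists_good inc _ _ _ (by positivity) hQ
  obtain ⟨al, be, ξ, η, hX, -, hd1, hd2, hinc, hinj, -, -⟩ := hR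
  have hX0 : 0 < Fintype.card X := by rw [hX]; positivity
  let pt : L → Fin 2 → ℝ := fun l => ![ξ l, η l]
  have hpt : Function.Injective pt := by
    intro l l' h
    refine hinj l l' ?_ ?_
    · simpa [pt] using congrFun h 0
    · simpa [pt] using congrFun h 1
  have hmem : ∀ z l, pt l ∈ DNC.ln (al z) (be z) ↔ inc z l := by
    intro z l
    rw [hinc]
    simp [pt, DNC.ln]
  refine ⟨(fun z => DNC.ln (al z) (be z)) '' {z | r ≤ {l | inc z l ∧ σ l = true}.ncard},
    pt '' {l | σ l = true}, Set.toFinite _, Set.toFinite _, ?_, ?_, ?_, ?_⟩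
  · rintro _ ⟨z, _, rfl⟩
    exact DNC.isLine_ln _ _
  · rintro _ ⟨z, hz, rfl⟩
    refine le_trans hz ?_
    rw [← Set.ncard_image_of_injective _ hpt]
    apply Set.ncard_le_ncard _ (Set.toFinite _)
    rintro _ ⟨l, ⟨h1, h2⟩, rfl⟩
    exact ⟨(hmem z l).2 h1, l, h2, rfl⟩
  · rintro _ ⟨l, hl, rfl⟩
    have h1 : {q ∈ pt '' {l | σ l = true} | q ≠ pt l ∧
        ∃ ℓ ∈ (fun z => DNC.ln (al z) (be z)) '' {z | r ≤ {l | inc z l ∧ σ l = true}.ncard},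
          pt l ∈ ℓ ∧ q ∈ ℓ} ⊆
        Set.range (fun p : Σ z : {z // inc z l}, {l' // inc z.1 l'} => pt p.2.1) := by
      rintro _ ⟨⟨l', hl', rfl⟩, _, _, ⟨z, _, rfl⟩, h3, h4⟩
      exact ⟨⟨⟨z, (hmem _ _).1 h3⟩, ⟨l', (hmem _ _).1 h4⟩⟩, rfl⟩
    refine (Set.ncard_le_ncard h1 (Set.toFinite _)).trans ?_
    rw [← Set.image_univ]
    refine (Set.ncard_image_le (Set.toFinite _)).trans ?_
    rw [Set.ncard_univ, Nat.card_sigma]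
    refine (Finset.sum_le_card_nsmul _ _ (2 * r) fun z _ => hd2 z.1).trans ?_
    rw [Finset.card_univ, ← Nat.card_eq_fintype_card, smul_eq_mul]
    exact (Nat.mul_le_mul_right _ (hd1 l)).trans hnum
  · intro P₁ P₂ hP hdis
    let χ : L → Bool := fun l => decide (pt l ∈ P₁)
    obtain ⟨a, b, hab, ha, hb⟩ := hσ χ
    by_cases har : r ≤ a
    · obtain ⟨z, hz1, hz2⟩ := DNC.good_point _ _ _ _ _ hX0 ha
      refine ⟨_, ⟨z, har.trans (hz1.trans (DNC.red_le _ _ _ _)), rfl⟩, Or.inr ?_⟩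
      intro p hp hpl
      have : p ∈ pt '' {l | σ l = true} := by rw [← hP]; exact Or.inr hp
      obtain ⟨l, hl, rfl⟩ := this
      have h1 := DNC.red_zero _ _ _ _ hz2 l ((hmem _ _).1 hpl) hl
      have h2 : pt l ∈ P₁ := by simpa [DNC.nt, χ] using h1
      exact Set.disjoint_left.1 hdis h2 hp
    · obtain ⟨z, hz1, hz2⟩ := DNC.good_point _ _ _ _ _ hX0 hb
      rw [DNC.nt_nt] at hz2
      refine ⟨_, ⟨z, (by omega : r ≤ b).trans (hz1.trans (DNC.red_le _ _ _ _)), rfl⟩, Or.inl ?_⟩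
      intro p hp hpl
      have : p ∈ pt '' {l | σ l = true} := by rw [← hP]; exact Or.inl hp
      obtain ⟨l, hl, rfl⟩ := this
      have h1 := DNC.red_zero _ _ _ _ hz2 l ((hmem _ _).1 hpl) hl
      have h2 : pt l ∉ P₁ := by simpa [χ] using h1
      exact h2 hp
end

section
/- For every real ε > 0 there exists n₀ such that for every integer n ≥ n₀ there is a set L of n distinct lines in ℝ² with the property that no point of ℝ² lies on four lines of L, yet every subfamily L' ⊆ L with |L'| ≥ n^{5/6+ε} contains three lines passing through a common point. -/
theorem count_step (a e : ℕ) (he : 1 ≤ e) : a ^ e + a ^ (e - 1) ≤ (a + 1) ^ e := by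
  obtain ⟨f, rfl⟩ : ∃ f, e = f + 1 := ⟨e - 1, by omega⟩
  simp only [Nat.add_sub_cancel]
  calc a ^ (f+1) + a ^ f = a ^ f * (a + 1) := by ring
    _ ≤ (a+1)^f * (a+1) := by gcongr; omega
    _ = _ := by ring

/-- Graph container lemma (Kleitman-Winston). -/
theorem graph_container {α : Type*} [DecidableEq α] (G : α → α → Prop) [DecidableRel G]
    (d : ℕ) (hd : 0 < d) : ∀ (a : ℕ) (A : Finset α), A.card = a →
      ∃ F : Finset (Finset α), F.card ≤ (a + 1) ^ (a / d) ∧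
        (∀ C ∈ F, C ⊆ A ∧ ∃ A' ⊆ A, (∀ v ∈ A', (A'.filter (G v)).card < d) ∧
          C.card ≤ A'.card + a / d) ∧
        ∀ I ⊆ A, (∀ x ∈ I, ∀ y ∈ I, ¬ G x y) → ∃ C ∈ F, I ⊆ C := by
  intro a
  induction a using Nat.strong_induction_on with
  | _ a ih =>
  intro A hA
  by_cases h : ∀ v ∈ A, (A.filter (G v)).card < d
  · refine ⟨{A}, ?_, ?_, ?_⟩
    · simpa using Nat.one_le_pow _ _ (by omega)
    · intro C hC
      rw [Finset.mem_singleton] at hC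
      subst hC
      exact ⟨subset_rfl, C, subset_rfl, h, Nat.le_add_right _ _⟩
    · intro I hI _
      exact ⟨A, by simp, hI⟩
  · push Not at h
    obtain ⟨v, hv, hdeg⟩ := h
    have hpos : 0 < a := by rw [← hA]; exact Finset.card_pos.2 ⟨v, hv⟩
    have c1 : (A.erase v).card = a - 1 := by rw [Finset.card_erase_of_mem hv, hA]
    set A2 := (A.erase v).filter (fun u => ¬ G v u) with hA2
    have c2 : A2.card ≤ a - d := by
      have h1 : A2 ⊆ A.filter (fun u => ¬ G v u) :=
        Finset.filter_subset_filter _ (Finset.erase_subset _ _)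
      have h2 := Finset.card_le_card h1
      have h3 := Finset.card_filter_add_card_filter_not (s := A) (G v)
      omega
    have hda : d ≤ a := hdeg.trans ((Finset.card_filter_le _ _).trans hA.le)
    obtain ⟨F1, n1, p1, k1⟩ := ih (a - 1) (by omega) _ c1
    obtain ⟨F2, n2, p2, k2⟩ := ih A2.card (by omega) A2 rfl
    have e1 : 1 ≤ a / d := (Nat.one_le_div_iff hd).2 hda
    have e2 : (a - d) / d = a / d - 1 := by
      rw [Nat.div_eq_sub_div hd hda]; rfl
    have e3 : A2.card / d ≤ a / d - 1 := e2 ▸ Nat.div_le_div_right c2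
    refine ⟨F1 ∪ F2.image (insert v), ?_, ?_, ?_⟩
    · calc _ ≤ F1.card + F2.card :=
            (Finset.card_union_le _ _).trans (Nat.add_le_add_left Finset.card_image_le _)
        _ ≤ a ^ (a / d) + a ^ (a / d - 1) := by
            gcongr
            · refine n1.trans ?_
              rw [Nat.sub_add_cancel hpos]
              exact Nat.pow_le_pow_right hpos (Nat.div_le_div_right (by omega))
            · refine n2.trans ?_
              exact (Nat.pow_le_pow_left (by omega) _).trans (Nat.pow_le_pow_right hpos e3)
        _ ≤ _ := count_step _ _ e1
    · intro C hC
      rcases Finset.mem_union.1 hC with hC | hC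
      · obtain ⟨s, A', hA', q1, q2⟩ := p1 C hC
        refine ⟨s.trans (Finset.erase_subset _ _), A', hA'.trans (Finset.erase_subset _ _), q1, ?_⟩
        have := Nat.div_le_div_right (c := d) (show a - 1 ≤ a by omega)
        omega
      · obtain ⟨C, hC', rfl⟩ := Finset.mem_image.1 hC
        obtain ⟨s, A', hA', q1, q2⟩ := p2 C hC'
        have hs : A2 ⊆ A := (Finset.filter_subset _ _).trans (Finset.erase_subset _ _)
        refine ⟨Finset.insert_subset hv (s.trans hs), A', hA'.trans hs, q1, ?_⟩
        have := Finset.card_insert_le v C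
        omega
    · intro I hI hind
      by_cases hvI : v ∈ I
      · obtain ⟨C, hC, hIC⟩ := k2 (I.erase v) (by
          intro x hx
          have hx' := Finset.mem_erase.1 hx
          simp only [hA2, Finset.mem_filter, Finset.mem_erase]
          exact ⟨⟨hx'.1, hI hx'.2⟩, hind v hvI x hx'.2⟩)
          (fun x hx y hy => hind x (Finset.mem_of_mem_erase hx) y (Finset.mem_of_mem_erase hy))
        refine ⟨insert v C, Finset.mem_union_right _ (Finset.mem_image_of_mem _ hC), ?_⟩
        intro x hx
        by_cases hxv : x = v
        · simp [hxv]
        · exact Finset.mem_insert_of_mem (hIC (Finset.mem_erase.2 ⟨hxv, hx⟩))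
      · obtain ⟨C, hC, hIC⟩ := k1 I (by
          intro x hx
          exact Finset.mem_erase.2 ⟨fun h => hvI (h ▸ hx), hI hx⟩) hind
        exact ⟨C, Finset.mem_union_left _ hC, hIC⟩


theorem cover_count {α : Type*} [DecidableEq α] (E : Finset (Finset α)) (B : Finset α) (k : ℕ)
    (h1 : ∀ e ∈ E, ∃ v ∈ B, v ∈ e) (h2 : ∀ v ∈ B, (E.filter (fun e => v ∈ e)).card ≤ k) :
    E.card ≤ B.card * k := by
  have : E ⊆ B.biUnion (fun v => E.filter (fun e => v ∈ e)) := by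
    intro e he
    obtain ⟨v, hv, hve⟩ := h1 e he
    exact Finset.mem_biUnion.2 ⟨v, hv, Finset.mem_filter.2 ⟨he, hve⟩⟩
  exact (Finset.card_le_card this).trans (Finset.card_biUnion_le_card_mul _ _ _ h2)

theorem high_count {α : Type*} [DecidableEq α] (E : Finset (Finset α)) (B : Finset α) (k : ℕ)
    (h1 : ∀ e ∈ E, e.card = 2) (h2 : ∀ v ∈ B, k ≤ (E.filter (fun e => v ∈ e)).card) :
    B.card * k ≤ 2 * E.card := by
  have h := Finset.sum_card_bipartiteAbove_eq_sum_card_bipartiteBelow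
    (s := B) (t := E) (fun v e => v ∈ e)
  calc B.card * k ≤ ∑ v ∈ B, (E.filter (fun e => v ∈ e)).card := by
        rw [← smul_eq_mul]; exact Finset.card_nsmul_le_sum _ _ _ h2
    _ = ∑ e ∈ E, (B.filter (fun v => v ∈ e)).card := h
    _ ≤ E.card • 2 := by
        refine Finset.sum_le_card_nsmul _ _ _ fun e he => ?_
        rw [← h1 e he]
        apply Finset.card_le_card
        intro x hx
        exact (Finset.mem_filter.1 hx).2
    _ = _ := by rw [smul_eq_mul, mul_comm]

theorem hyper_aux {α : Type*} [DecidableEq α] (V : Finset α) (H : Finset (Finset α)) (d b : ℕ)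
    (hH3 : ∀ e ∈ H, e.card = 3 ∧ e ⊆ V)
    (hlin : ∀ e ∈ H, ∀ f ∈ H, ∀ x y, x ≠ y → x ∈ e → y ∈ e → x ∈ f → y ∈ f → e = f)
    (hdeg : ∀ v ∈ V, (H.filter (fun e => v ∈ e)).card ≤ (48 * d) ^ 2)
    (hmany : V.card * (48 * d) ^ 2 ≤ 6 * H.card)
    (hd : 4608 ≤ d) (hb1 : V.card ≤ b * (48 * d)) (hb2 : b * (48 * d) ≤ 2 * V.card) :
    ∀ (a : ℕ) (A T : Finset α) (G : Finset (Finset α)), A.card = a → A ⊆ V → T ⊆ V →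
      Disjoint A T → T.card ≤ b →
      (∀ g ∈ G, g.card = 2 ∧ g ⊆ V) → (∀ g ∈ G, ∃ v ∈ T, v ∉ g ∧ insert v g ∈ H) →
      T.card * (96 * d ^ 2) ≤ G.card → G.card ≤ T.card * (48 * d) ^ 2 →
      (∀ v, (G.filter (fun e => v ∈ e)).card ≤ 48 * (48 * d)) →
      ∃ F : Finset (Finset α),
        F.card ≤ (a + 1) ^ (b - T.card) * (V.card + 1) ^ (V.card / d) ∧
        (∀ C ∈ F, C ⊆ V ∧ 4608 * C.card ≤ 4607 * V.card) ∧
        ∀ I, T ⊆ I → I ⊆ A ∪ T → (∀ e ∈ H, ¬ e ⊆ I) → ∃ C ∈ F, I ⊆ C := by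
  intro a
  induction a using Nat.strong_induction_on with
  | _ a ih =>
  intro A T G hAa hAV hTV hAT hTb hG2 hGT hG3 hG4 hG5
  have hd0 : 0 < d := by omega
  have hAM := Finset.card_le_card hAV
  rcases hTb.eq_or_lt with hTb | hTb
  · -- stage two
    obtain ⟨F, f1, f2, f3⟩ := graph_container (fun x y : α => x ≠ y ∧ ({x, y} : Finset α) ∈ G) d
      hd0 _ V rfl
    refine ⟨F, ?_, ?_, ?_⟩
    · rw [hTb]; simpa using f1
    · intro C hC
      obtain ⟨s, A', hA', q1, q2⟩ := f2 C hC
      refine ⟨s, ?_⟩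
      have hsplit := Finset.card_filter_add_card_filter_not (s := G) (fun g => g ⊆ A')
      have g1 : (G.filter (fun g => g ⊆ A')).card ≤ A'.card * d := by
        apply cover_count
        · intro e he
          rw [Finset.mem_filter] at he
          have : e.Nonempty := Finset.card_pos.1 (by rw [(hG2 e he.1).1]; norm_num)
          obtain ⟨x, hx⟩ := this
          exact ⟨x, he.2 hx, hx⟩
        · intro v hv
          refine le_trans ?_ (q1 v hv).le
          apply Finset.card_le_card_of_surjOn (fun u => ({v, u} : Finset α))
          intro e he
          simp only [Finset.coe_filter, Finset.mem_filter, Set.mem_ofPred_eq] at he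
          obtain ⟨⟨heG, heA⟩, hve⟩ := he
          obtain ⟨x, y, hxy, rfl⟩ := Finset.card_eq_two.1 (hG2 e heG).1
          simp only [Finset.mem_insert, Finset.mem_singleton] at hve
          rcases hve with rfl | rfl
          · refine ⟨y, ?_, rfl⟩
            simp only [Finset.coe_filter, Set.mem_ofPred_eq]
            exact ⟨heA (by simp), hxy, heG⟩
          · refine ⟨x, ?_, Finset.pair_comm _ _⟩
            simp only [Finset.coe_filter, Set.mem_ofPred_eq]
            exact ⟨heA (by simp), hxy.symm, Finset.pair_comm x v ▸ heG⟩
      have g2 : (G.filter (fun g => ¬ g ⊆ A')).card ≤ (V \ A').card * (48 * (48 * d)) := by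
        apply cover_count
        · intro e he
          rw [Finset.mem_filter] at he
          obtain ⟨x, hx, hx'⟩ := Finset.not_subset.1 he.2
          exact ⟨x, Finset.mem_sdiff.2 ⟨(hG2 e he.1).2 hx, hx'⟩, hx⟩
        · intro v _
          exact (Finset.card_le_card (Finset.filter_subset_filter _ (Finset.filter_subset _ _))).trans
            (hG5 v)
      have g3 := Finset.card_sdiff_add_card_eq_card hA'
      rw [hTb] at hG3
      have g4 : V.card / d * d ≤ V.card := Nat.div_mul_le_self _ _
      have g4' : 4608 * (V.card / d) ≤ V.card := by nlinarith
      have g5 : 2 * V.card ≤ A'.card + (V \ A').card * 2304 := by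
        have : (2 * V.card) * d ≤ (A'.card + (V \ A').card * 2304) * d := by nlinarith
        exact Nat.le_of_mul_le_mul_right this hd0
      omega
    · intro I hTI hI hind
      refine f3 I (hI.trans (Finset.union_subset hAV hTV)) ?_
      rintro x hx y hy ⟨hxy, hg⟩
      obtain ⟨v, hv, _, hvH⟩ := hGT _ hg
      refine hind _ hvH ?_
      intro z hz
      simp only [Finset.mem_insert, Finset.mem_singleton] at hz
      rcases hz with rfl | rfl | rfl
      · exact hTI hv
      · exact hx
      · exact hy
  · set hi := V.filter (fun v => 48 * (48 * d) ≤ (G.filter (fun e => v ∈ e)).card) with hhi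
    set H' := H.filter (fun e => e ⊆ A ∧ Disjoint e hi) with hH'
    by_cases hsmall : ∀ v ∈ A, (H'.filter (fun e => v ∈ e)).card ≤ 96 * d ^ 2
    · refine ⟨{A ∪ T}, ?_, ?_, ?_⟩
      · rw [Finset.card_singleton]
        exact Nat.one_le_iff_ne_zero.2 (by positivity)
      · intro C hC
        rw [Finset.mem_singleton] at hC
        subst hC
        refine ⟨Finset.union_subset hAV hTV, ?_⟩
        have hsplit := Finset.card_filter_add_card_filter_not (s := H)
          (fun e => e ⊆ A ∧ Disjoint e hi)
        have g1 : H'.card ≤ A.card * (96 * d ^ 2) := by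
          apply cover_count _ _ _ _ hsmall
          intro e he
          rw [hH', Finset.mem_filter] at he
          have : e.Nonempty := Finset.card_pos.1 (by rw [(hH3 e he.1).1]; norm_num)
          obtain ⟨x, hx⟩ := this
          exact ⟨x, he.2.1 hx, hx⟩
        have g2 : (H.filter (fun e => ¬ (e ⊆ A ∧ Disjoint e hi))).card
            ≤ ((V \ A) ∪ hi).card * (48 * d) ^ 2 := by
          apply cover_count
          · intro e he
            rw [Finset.mem_filter] at he
            by_cases heA : e ⊆ A
            · have : ¬ Disjoint e hi := fun h => he.2 ⟨heA, h⟩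
              obtain ⟨x, hx, hx'⟩ := Finset.not_disjoint_iff.1 this
              exact ⟨x, Finset.mem_union_right _ hx', hx⟩
            · obtain ⟨x, hx, hx'⟩ := Finset.not_subset.1 heA
              exact ⟨x, Finset.mem_union_left _ (Finset.mem_sdiff.2 ⟨(hH3 e he.1).2 hx, hx'⟩), hx⟩
          · intro v hv
            refine (Finset.card_le_card (Finset.filter_subset_filter _
              (Finset.filter_subset _ _))).trans (hdeg v ?_)
            rcases Finset.mem_union.1 hv with h | h
            · exact (Finset.mem_sdiff.1 h).1
            · exact (Finset.mem_filter.1 h).1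
        have g3 := Finset.card_sdiff_add_card_eq_card hAV
        have g4 : hi.card * (48 * (48 * d)) ≤ 2 * G.card :=
          high_count _ _ _ (fun e he => (hG2 e he).1) (fun v hv => (Finset.mem_filter.1 hv).2)
        have g5 := Finset.card_union_le (V \ A) hi
        have g6 := Finset.card_union_le A T
        have g7 : hi.card ≤ 2 * (b * d) := by
          have h1 : T.card * (48 * d) ^ 2 ≤ b * (48 * d) ^ 2 := by gcongr
          have : hi.card * (2304 * d) ≤ (2 * (b * d)) * (2304 * d) := by nlinarith
          exact Nat.le_of_mul_le_mul_right this (by omega)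
        have g8 : 4 * V.card ≤ A.card + 24 * ((V \ A).card + hi.card) := by
          have h1 : ((V \ A) ∪ hi).card * (48 * d) ^ 2 ≤ ((V \ A).card + hi.card) * (48 * d) ^ 2 := by
            gcongr
          have : (4 * V.card) * (96 * d ^ 2) ≤
            (A.card + 24 * ((V \ A).card + hi.card)) * (96 * d ^ 2) := by
            rw [← hH'] at hsplit
            nlinarith
          exact Nat.le_of_mul_le_mul_right this (by positivity)
        have g9 : b * (48 * 4608) ≤ 2 * V.card := le_trans (by gcongr) hb2
        have g10 : b * (48 * d) = 48 * (b * d) := by ring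
        omega
      · intro I _ hI _
        exact ⟨_, Finset.mem_singleton_self _, hI⟩
    · push Not at hsmall
      obtain ⟨v, hvA, hvd⟩ := hsmall
      have hpos : 0 < a := by rw [← hAa]; exact Finset.card_pos.2 ⟨v, hvA⟩
      have c1 : (A.erase v).card = a - 1 := by rw [Finset.card_erase_of_mem hvA, hAa]
      have hvT : v ∉ T := Finset.disjoint_left.1 hAT hvA
      have hAeV : A.erase v ⊆ V := (Finset.erase_subset _ _).trans hAV
      obtain ⟨F1, n1, p1, k1⟩ := ih (a - 1) (by omega) (A.erase v) T G c1 hAeV hTV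
        (Finset.disjoint_of_subset_left (Finset.erase_subset _ _) hAT) hTb.le hG2 hGT hG3 hG4 hG5
      set Lk := (H'.filter (fun e => v ∈ e)).image (fun e => e.erase v) with hLk
      have mLk : ∀ g, g ∈ Lk → v ∉ g ∧ insert v g ∈ H ∧ insert v g ⊆ A ∧
          Disjoint (insert v g) hi := by
        intro g hg
        obtain ⟨e, he, rfl⟩ := Finset.mem_image.1 hg
        rw [Finset.mem_filter, hH', Finset.mem_filter] at he
        rw [Finset.insert_erase he.2]
        exact ⟨Finset.notMem_erase _ _, he.1.1, he.1.2.1, he.1.2.2⟩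
      have cLk : Lk.card = (H'.filter (fun e => v ∈ e)).card := by
        apply Finset.card_image_of_injOn
        intro e he f hf hef
        simp only [Finset.coe_filter, Set.mem_ofPred_eq] at he hf
        rw [← Finset.insert_erase he.2, ← Finset.insert_erase hf.2]
        exact congrArg (insert v) hef
      have cLk2 : Lk.card ≤ (48 * d) ^ 2 := by
        rw [cLk]
        exact (Finset.card_le_card (Finset.filter_subset_filter _
          (Finset.filter_subset _ _))).trans (hdeg v (hAV hvA))
      have hLk2 : ∀ g ∈ Lk, g.card = 2 ∧ g ⊆ V := by
        intro g hg
        obtain ⟨h1, h2, h3, _⟩ := mLk g hg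
        have := (hH3 _ h2).1
        rw [Finset.card_insert_of_notMem h1] at this
        exact ⟨by omega, ((Finset.subset_insert _ _).trans h3).trans hAV⟩
      have hdisj : Disjoint G Lk := by
        rw [Finset.disjoint_left]
        intro g hgG hgL
        obtain ⟨h1, h2, h3, _⟩ := mLk g hgL
        obtain ⟨u, huT, hug, huH⟩ := hGT g hgG
        obtain ⟨x, y, hxy, rfl⟩ := Finset.card_eq_two.1 (hG2 g hgG).1
        have := hlin _ h2 _ huH x y hxy (by simp) (by simp) (by simp) (by simp)
        have hu : u ∈ insert v ({x, y} : Finset α) := by rw [this]; simp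
        exact Finset.disjoint_left.1 hAT (h3 hu) huT
      have cT : (insert v T).card = T.card + 1 := Finset.card_insert_of_notMem hvT
      obtain ⟨F2, n2, p2, k2⟩ := ih (a - 1) (by omega) (A.erase v) (insert v T) (G ∪ Lk) c1 hAeV
        (Finset.insert_subset (hAV hvA) hTV)
        (by
          rw [Finset.disjoint_left]
          intro x hx hx'
          rcases Finset.mem_insert.1 hx' with h | h
          · exact (Finset.mem_erase.1 hx).1 h
          · exact Finset.disjoint_left.1 hAT (Finset.mem_of_mem_erase hx) h)
        (by omega)
        (by
          intro g hg
          rcases Finset.mem_union.1 hg with h | h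
          · exact hG2 g h
          · exact hLk2 g h)
        (by
          intro g hg
          rcases Finset.mem_union.1 hg with h | h
          · obtain ⟨u, hu, hh⟩ := hGT g h
            exact ⟨u, Finset.mem_insert_of_mem hu, hh⟩
          · exact ⟨v, Finset.mem_insert_self _ _, (mLk g h).1, (mLk g h).2.1⟩)
        (by rw [Finset.card_union_of_disjoint hdisj, cT]; linarith)
        (by rw [Finset.card_union_of_disjoint hdisj, cT]; linarith)
        (by
          intro y
          rw [Finset.filter_union]
          refine (Finset.card_union_le _ _).trans ?_
          by_cases hy : (Lk.filter (fun e => y ∈ e)) = ∅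
          · rw [hy]; simpa using hG5 y
          · obtain ⟨g, hg⟩ := Finset.nonempty_iff_ne_empty.2 hy
            rw [Finset.mem_filter] at hg
            obtain ⟨h1, h2, h3, h4⟩ := mLk g hg.1
            have hyhi : y ∉ hi := Finset.disjoint_left.1 h4 (Finset.mem_insert_of_mem hg.2)
            have hyV : y ∈ V := (hLk2 g hg.1).2 hg.2
            have hlow : (G.filter (fun e => y ∈ e)).card < 48 * (48 * d) := by
              by_contra hcon
              exact hyhi (Finset.mem_filter.2 ⟨hyV, not_lt.1 hcon⟩)
            have hone : (Lk.filter (fun e => y ∈ e)).card ≤ 1 := by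
              rw [Finset.card_le_one]
              intro g1 hg1 g2 hg2
              rw [Finset.mem_filter] at hg1 hg2
              obtain ⟨s1, s2, _, _⟩ := mLk g1 hg1.1
              obtain ⟨t1, t2, _, _⟩ := mLk g2 hg2.1
              have hvy : v ≠ y := fun h => s1 (h ▸ hg1.2)
              have := hlin _ s2 _ t2 v y hvy (by simp) (by simp [hg1.2]) (by simp) (by simp [hg2.2])
              rw [← Finset.erase_insert s1, ← Finset.erase_insert t1, this]
            omega)
      refine ⟨F1 ∪ F2, ?_, ?_, ?_⟩
      · set X := (V.card + 1) ^ (V.card / d)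
        rw [Nat.sub_add_cancel hpos] at n1 n2
        rw [cT] at n2
        calc _ ≤ F1.card + F2.card := Finset.card_union_le _ _
          _ ≤ a ^ (b - T.card) * X + a ^ (b - (T.card + 1)) * X := add_le_add n1 n2
          _ = (a ^ (b - T.card) + a ^ (b - T.card - 1)) * X := by rw [add_mul, Nat.sub_sub]
          _ ≤ _ := by
            gcongr
            exact count_step _ _ (by omega)
      · intro C hC
        rcases Finset.mem_union.1 hC with hC | hC
        · exact p1 C hC
        · exact p2 C hC
      · intro I hTI hI hind
        by_cases hvI : v ∈ I
        · obtain ⟨C, hC, hIC⟩ := k2 I (Finset.insert_subset hvI hTI) (by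
            intro x hx
            have := hI hx
            simp only [Finset.mem_union, Finset.mem_erase, Finset.mem_insert] at this ⊢
            tauto) hind
          exact ⟨C, Finset.mem_union_right _ hC, hIC⟩
        · obtain ⟨C, hC, hIC⟩ := k1 I hTI (by
            intro x hx
            have := hI hx
            have : x ≠ v := fun h => hvI (h ▸ hx)
            simp only [Finset.mem_union, Finset.mem_erase] at *
            tauto) hind
          exact ⟨C, Finset.mem_union_left _ hC, hIC⟩

/-- Container lemma for linear 3-uniform hypergraphs. -/
theorem hyper_container {α : Type*} [DecidableEq α] (V : Finset α) (H : Finset (Finset α)) (d : ℕ)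
    (hH3 : ∀ e ∈ H, e.card = 3 ∧ e ⊆ V)
    (hlin : ∀ e ∈ H, ∀ f ∈ H, ∀ x y, x ≠ y → x ∈ e → y ∈ e → x ∈ f → y ∈ f → e = f)
    (hdeg : ∀ v ∈ V, (H.filter (fun e => v ∈ e)).card ≤ (48 * d) ^ 2)
    (hmany : V.card * (48 * d) ^ 2 ≤ 6 * H.card)
    (hd : 4608 ≤ d) (hV : 48 * d ≤ V.card) :
    ∃ F : Finset (Finset α),
        F.card ≤ (V.card + 1) ^ (2 * (V.card / d)) ∧
        (∀ C ∈ F, C ⊆ V ∧ 4608 * C.card ≤ 4607 * V.card) ∧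
        ∀ I, I ⊆ V → (∀ e ∈ H, ¬ e ⊆ I) → ∃ C ∈ F, I ⊆ C := by
  have hd0 : 0 < d := by omega
  set b := V.card / (48 * d) + 1 with hb
  have h1 := Nat.div_add_mod V.card (48 * d)
  have h2 := Nat.mod_lt V.card (show 48 * d > 0 by omega)
  have h3 : 1 ≤ V.card / (48 * d) := (Nat.one_le_div_iff (by omega)).2 hV
  have e0 : b * (48 * d) = (48 * d) * (V.card / (48 * d)) + 48 * d := by rw [hb]; ring
  have hb1 : V.card ≤ b * (48 * d) := by omega
  have hb2 : b * (48 * d) ≤ 2 * V.card := by omega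
  obtain ⟨F, f1, f2, f3⟩ := hyper_aux V H d b hH3 hlin hdeg hmany hd hb1 hb2 V.card V ∅ ∅ rfl
    subset_rfl (by simp) (by simp) (by simp) (by simp) (by simp) (by simp) (by simp) (by simp)
  refine ⟨F, f1.trans ?_, f2, fun I hI hind => f3 I (by simp) (by simpa using hI) hind⟩
  rw [← pow_add]
  apply Nat.pow_le_pow_right (by omega)
  have : b ≤ V.card / d := by
    rw [Nat.le_div_iff_mul_le hd0]
    have : b * (48 * d) = 48 * (b * d) := by ring
    omega
  simp only [Finset.card_empty]
  omega


/-- Collinearity of three points of `ℤ³`. -/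
def Coll (a b c : ℤ × ℤ × ℤ) : Prop :=
  (b.1 - a.1) * (c.2.1 - a.2.1) = (b.2.1 - a.2.1) * (c.1 - a.1) ∧
  (b.1 - a.1) * (c.2.2 - a.2.2) = (b.2.2 - a.2.2) * (c.1 - a.1) ∧
  (b.2.1 - a.2.1) * (c.2.2 - a.2.2) = (b.2.2 - a.2.2) * (c.2.1 - a.2.1)

/-- Primitive vectors, in Bezout form. -/
def Prim (v : ℤ × ℤ × ℤ) : Prop := ∃ x y z : ℤ, x * v.1 + y * v.2.1 + z * v.2.2 = 1

/-- The grid `{0,…,m-1}³`. -/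
noncomputable def grid (m : ℕ) : Finset (ℤ × ℤ × ℤ) :=
  Finset.Ico (0 : ℤ) m ×ˢ Finset.Ico (0 : ℤ) m ×ˢ Finset.Ico (0 : ℤ) m

theorem grid_card (m : ℕ) : (grid m).card = m ^ 3 := by
  simp [grid, Finset.card_product]; ring

theorem mem_grid {m : ℕ} {p : ℤ × ℤ × ℤ} : p ∈ grid m ↔
    (0 ≤ p.1 ∧ p.1 < m) ∧ (0 ≤ p.2.1 ∧ p.2.1 < m) ∧ (0 ≤ p.2.2 ∧ p.2.2 < m) := by
  simp [grid, Finset.mem_product]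

/-- The box `{1,…,r}³`. -/
noncomputable def box (r : ℕ) : Finset (ℤ × ℤ × ℤ) :=
  Finset.Icc (1 : ℤ) r ×ˢ Finset.Icc (1 : ℤ) r ×ˢ Finset.Icc (1 : ℤ) r

theorem box_card (r : ℕ) : (box r).card = r ^ 3 := by
  simp [box, Finset.card_product]; ring

theorem mem_box {m : ℕ} {p : ℤ × ℤ × ℤ} : p ∈ box m ↔
    (1 ≤ p.1 ∧ p.1 ≤ m) ∧ (1 ≤ p.2.1 ∧ p.2.1 ≤ m) ∧ (1 ≤ p.2.2 ∧ p.2.2 ≤ m) := by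
  simp [box, Finset.mem_product]

theorem exists_prim (v : ℤ × ℤ × ℤ) (hv : v.1 ≠ 0 ∨ v.2.1 ≠ 0 ∨ v.2.2 ≠ 0) :
    ∃ (g : ℕ) (u : ℤ × ℤ × ℤ), 0 < g ∧ Prim u ∧
      v.1 = g * u.1 ∧ v.2.1 = g * u.2.1 ∧ v.2.2 = g * u.2.2 := by
  obtain ⟨a, b, c⟩ := v
  simp only at hv
  obtain ⟨h, s', t', e1, dha, dhb⟩ : ∃ h s' t' : ℤ, h = a * s' + b * t' ∧ h ∣ a ∧ h ∣ b :=
    ⟨Int.gcd a b, _, _, Int.gcd_eq_gcd_ab a b, Int.gcd_dvd_left _ _, Int.gcd_dvd_right _ _⟩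
  obtain ⟨g, s, t, e2, dh, dc⟩ : ∃ (g : ℕ) (s t : ℤ), (g : ℤ) = h * s + c * t ∧
      (g : ℤ) ∣ h ∧ (g : ℤ) ∣ c :=
    ⟨Int.gcd h c, _, _, Int.gcd_eq_gcd_ab h c, Int.gcd_dvd_left _ _, Int.gcd_dvd_right _ _⟩
  obtain ⟨a', ha'⟩ := dh.trans dha
  obtain ⟨b', hb'⟩ := dh.trans dhb
  obtain ⟨c', hc'⟩ := dc
  have hg0 : (g : ℤ) ≠ 0 := by
    intro h0
    rw [h0, zero_mul] at ha' hb' hc'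
    tauto
  refine ⟨g, (a', b', c'), by omega, ?_, ha', hb', hc'⟩
  refine ⟨s' * s, t' * s, t, ?_⟩
  apply mul_left_cancel₀ hg0
  simp only
  linear_combination (-s' * s) * ha' - t' * s * hb' - t * hc' - e2 - s * e1

theorem sum_inv_cube (n : ℕ) (hn : 1 ≤ n) :
    ∑ g ∈ Finset.Icc 2 n, (1 : ℚ) / (g : ℚ) ^ 3 ≤ (1 - 1 / n) / 2 := by
  induction n, hn using Nat.le_induction with
  | base => simp
  | succ n hn ih =>
    rw [Finset.sum_Icc_succ_top (by omega)]
    refine (add_le_add_left ih _).trans ?_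
    have hn' : (1 : ℚ) ≤ n := by exact_mod_cast hn
    push_cast
    have : (1 : ℚ) / (n + 1) ^ 3 ≤ 1 / (2 * n * (n + 1)) := by
      apply one_div_le_one_div_of_le (by positivity)
      nlinarith [mul_nonneg (show (0 : ℚ) ≤ n + 1 by positivity) (show (0 : ℚ) ≤ n ^ 2 + 1 by positivity)]
    have e : (1 : ℚ) / (2 * n * (n + 1)) = (1 / n - 1 / (n + 1)) / 2 := by
      field_simp; ring
    linarith

open Classical in
theorem prim_count (r : ℕ) : r ^ 3 ≤ 2 * ((box r).filter Prim).card := by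
  rcases Nat.eq_zero_or_pos r with rfl | hr
  · simp
  have hsplit := Finset.card_filter_add_card_filter_not (s := box r) Prim
  rw [box_card] at hsplit
  have hsub : (box r).filter (fun v => ¬ Prim v) ⊆ (Finset.Icc 2 r).biUnion
      (fun g => (box (r / g)).image (fun u => ((g : ℤ) * u.1, (g : ℤ) * u.2.1, (g : ℤ) * u.2.2))) := by
    intro v hv
    rw [Finset.mem_filter, mem_box] at hv
    obtain ⟨⟨⟨h1, h1'⟩, ⟨h2, h2'⟩, h3, h3'⟩, hp⟩ := hv
    obtain ⟨g, u, hg, hu, e1, e2, e3⟩ := exists_prim v (Or.inl (by omega))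
    have hg1 : g ≠ 1 := by
      rintro rfl
      apply hp
      obtain ⟨x, y, z, h⟩ := hu
      exact ⟨x, y, z, by rw [e1, e2, e3]; simpa using h⟩
    have hgz : (0 : ℤ) < g := by exact_mod_cast hg
    have key : ∀ t : ℤ, 1 ≤ (g : ℤ) * t → (g : ℤ) * t ≤ r → 1 ≤ t ∧ t ≤ ((r / g : ℕ) : ℤ) := by
      intro t ht ht'
      constructor
      · by_contra hc
        have : t ≤ 0 := by omega
        nlinarith
      · push_cast
        rw [Int.le_ediv_iff_mul_le hgz]
        linarith
    have k1 := key u.1 (by omega) (by omega)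
    have k2 := key u.2.1 (by omega) (by omega)
    have k3 := key u.2.2 (by omega) (by omega)
    rw [Finset.mem_biUnion]
    refine ⟨g, ?_, ?_⟩
    · rw [Finset.mem_Icc]
      refine ⟨by omega, ?_⟩
      have : (g : ℤ) ≤ r := by nlinarith
      exact_mod_cast this
    · rw [Finset.mem_image]
      exact ⟨u, mem_box.2 ⟨k1, k2, k3⟩, by rw [← e1, ← e2, ← e3]⟩
  have hcard : ((box r).filter (fun v => ¬ Prim v)).card ≤ ∑ g ∈ Finset.Icc 2 r, (r / g) ^ 3 := by
    refine (Finset.card_le_card hsub).trans (Finset.card_biUnion_le.trans ?_)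
    refine Finset.sum_le_sum fun g _ => ?_
    exact Finset.card_image_le.trans (box_card _).le
  have hsum : ((∑ g ∈ Finset.Icc 2 r, (r / g) ^ 3 : ℕ) : ℚ) ≤ (r : ℚ) ^ 3 / 2 := by
    push_cast
    calc ∑ g ∈ Finset.Icc 2 r, (((r / g : ℕ) : ℚ)) ^ 3
        ≤ ∑ g ∈ Finset.Icc 2 r, (r : ℚ) ^ 3 * (1 / (g : ℚ) ^ 3) := by
          refine Finset.sum_le_sum fun g _ => ?_
          have : ((r / g : ℕ) : ℚ) ≤ (r : ℚ) / g := Nat.cast_div_le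
          calc _ ≤ ((r : ℚ) / g) ^ 3 := by gcongr
            _ = _ := by rw [div_pow]; ring
      _ = (r : ℚ) ^ 3 * ∑ g ∈ Finset.Icc 2 r, (1 / (g : ℚ) ^ 3) := by rw [Finset.mul_sum]
      _ ≤ (r : ℚ) ^ 3 * ((1 - 1 / r) / 2) := by gcongr; exact sum_inv_cube r hr
      _ ≤ (r : ℚ) ^ 3 * (1 / 2) := by
          gcongr
          have : (0 : ℚ) ≤ 1 / r := by positivity
          linarith
      _ = _ := by ring
  have : 2 * ((box r).filter (fun v => ¬ Prim v)).card ≤ r ^ 3 := by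
    have : ((2 * ((box r).filter (fun v => ¬ Prim v)).card : ℕ) : ℚ) ≤ ((r ^ 3 : ℕ) : ℚ) := by
      push_cast
      have h' : (((box r).filter (fun v => ¬ Prim v)).card : ℚ) ≤
        ((∑ g ∈ Finset.Icc 2 r, (r / g) ^ 3 : ℕ) : ℚ) := by exact_mod_cast hcard
      linarith
    exact_mod_cast this
  omega

theorem prim_mul {u w : ℤ × ℤ × ℤ} (hw : Prim w)
    (h1 : u.1 * w.2.1 = u.2.1 * w.1) (h2 : u.1 * w.2.2 = u.2.2 * w.1)
    (h3 : u.2.1 * w.2.2 = u.2.2 * w.2.1) :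
    ∃ k : ℤ, u.1 = k * w.1 ∧ u.2.1 = k * w.2.1 ∧ u.2.2 = k * w.2.2 := by
  obtain ⟨x, y, z, h⟩ := hw
  refine ⟨x * u.1 + y * u.2.1 + z * u.2.2, ?_, ?_, ?_⟩
  · linear_combination (-u.1) * h + y * h1 + z * h2
  · linear_combination (-u.2.1) * h - x * h1 + z * h3
  · linear_combination (-u.2.2) * h - x * h2 - y * h3

theorem prim_eq {r : ℕ} {v w : ℤ × ℤ × ℤ} (hv : v ∈ box r) (hw : w ∈ box r) (pv : Prim v)
    (pw : Prim w) (k l : ℤ) (hk : k ≠ 0)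
    (h1 : k * v.1 = l * w.1) (h2 : k * v.2.1 = l * w.2.1) (h3 : k * v.2.2 = l * w.2.2) : v = w := by
  rw [mem_box] at hv hw
  have c1 : v.1 * w.2.1 = v.2.1 * w.1 := by
    apply mul_left_cancel₀ hk; linear_combination w.2.1 * h1 - w.1 * h2
  have c2 : v.1 * w.2.2 = v.2.2 * w.1 := by
    apply mul_left_cancel₀ hk; linear_combination w.2.2 * h1 - w.1 * h3
  have c3 : v.2.1 * w.2.2 = v.2.2 * w.2.1 := by
    apply mul_left_cancel₀ hk; linear_combination w.2.2 * h2 - w.2.1 * h3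
  obtain ⟨s, s1, s2, s3⟩ := prim_mul pw c1 c2 c3
  obtain ⟨t, t1, t2, t3⟩ := prim_mul (u := w) (w := v) pv (by linarith) (by linarith) (by linarith)
  have hs : 0 < s := by
    by_contra hc
    nlinarith
  have ht : 0 < t := by
    by_contra hc
    nlinarith
  have hst : s * t = 1 := by
    have : v.1 ≠ 0 := by omega
    apply mul_right_cancel₀ this
    rw [one_mul]
    conv_rhs => rw [s1, t1]
    ring
  have : s = 1 := by nlinarith
  subst this
  exact Prod.ext (by linarith) (Prod.ext (by linarith) (by linarith))

/-- Canonical representative of `p` modulo `v`. -/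
def rep (v p : ℤ × ℤ × ℤ) : ℤ × ℤ × ℤ :=
  let t := min (p.1 / v.1) (min (p.2.1 / v.2.1) (p.2.2 / v.2.2))
  (p.1 - t * v.1, p.2.1 - t * v.2.1, p.2.2 - t * v.2.2)

theorem rep_eq {v p q : ℤ × ℤ × ℤ} (h : rep v p = rep v q) :
    ∃ k : ℤ, q.1 - p.1 = k * v.1 ∧ q.2.1 - p.2.1 = k * v.2.1 ∧ q.2.2 - p.2.2 = k * v.2.2 := by
  simp only [rep, Prod.mk.injEq] at h
  obtain ⟨h1, h2, h3⟩ := h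
  generalize min (p.1 / v.1) (min (p.2.1 / v.2.1) (p.2.2 / v.2.2)) = s at *
  generalize min (q.1 / v.1) (min (q.2.1 / v.2.1) (q.2.2 / v.2.2)) = t at *
  exact ⟨t - s, by linarith, by linarith, by linarith⟩

/-- Boundary slabs of the grid. -/
noncomputable def slab (r m : ℕ) : Finset (ℤ × ℤ × ℤ) :=
  (Finset.Ico (0 : ℤ) r ×ˢ Finset.Ico (0 : ℤ) m ×ˢ Finset.Ico (0 : ℤ) m) ∪
  ((Finset.Ico (0 : ℤ) m ×ˢ Finset.Ico (0 : ℤ) r ×ˢ Finset.Ico (0 : ℤ) m) ∪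
  (Finset.Ico (0 : ℤ) m ×ˢ Finset.Ico (0 : ℤ) m ×ˢ Finset.Ico (0 : ℤ) r))

theorem slab_card (r m : ℕ) : (slab r m).card ≤ 3 * r * m ^ 2 := by
  unfold slab
  refine (Finset.card_union_le _ _).trans ?_
  refine (Nat.add_le_add_left (Finset.card_union_le _ _) _).trans ?_
  simp only [Finset.card_product, Int.card_Ico, sub_zero, Int.toNat_natCast]
  apply le_of_eq; ring

theorem rep_mem {r m : ℕ} {v p : ℤ × ℤ × ℤ} (hv : v ∈ box r) (hp : p ∈ grid m) :
    rep v p ∈ slab r m := by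
  rw [mem_box] at hv
  rw [mem_grid] at hp
  obtain ⟨a, b, c⟩ := p
  obtain ⟨x, y, z⟩ := v
  simp only at hv hp
  obtain ⟨⟨hx, hx'⟩, ⟨hy, hy'⟩, hz, hz'⟩ := hv
  obtain ⟨⟨ha, ha'⟩, ⟨hb, hb'⟩, hc, hc'⟩ := hp
  simp only [rep]
  have key : ∀ a x t : ℤ, 1 ≤ x → 0 ≤ t → t ≤ a / x → 0 ≤ a - t * x ∧ a - t * x ≤ a := by
    intro a x t hx ht hta
    have := Int.le_ediv_iff_mul_le (show 0 < x by omega) (a := t) (b := a)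
    have := this.1 hta
    have : 0 ≤ t * x := by positivity
    omega
  have key2 : ∀ a x : ℤ, 1 ≤ x → a - a / x * x < x := by
    intro a x hx
    have := Int.emod_lt_of_pos a (show 0 < x by omega)
    have := Int.emod_add_mul_ediv a x
    linarith [mul_comm x (a / x)]
  have na : 0 ≤ a / x := Int.ediv_nonneg ha (by omega)
  have nb : 0 ≤ b / y := Int.ediv_nonneg hb (by omega)
  have nc : 0 ≤ c / z := Int.ediv_nonneg hc (by omega)
  set t := min (a / x) (min (b / y) (c / z)) with ht
  have t0 : 0 ≤ t := le_min na (le_min nb nc)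
  have k1 := key a x t hx t0 (min_le_left _ _)
  have k2 := key b y t hy t0 ((min_le_right _ _).trans (min_le_left _ _))
  have k3 := key c z t hz t0 ((min_le_right _ _).trans (min_le_right _ _))
  have hor : t = a / x ∨ t = b / y ∨ t = c / z := by omega
  simp only [slab, Finset.mem_union, Finset.mem_product, Finset.mem_Ico]
  rcases hor with h | h | h
  · left
    have := key2 a x hx
    rw [← h] at this
    omega
  · right; left
    have := key2 b y hy
    rw [← h] at this
    omega
  · right; right
    have := key2 c z hz
    rw [← h] at this
    omega

theorem matching {α β : Type*} [DecidableEq α] [DecidableEq β] (f : α → β) (B : Finset β) :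
    ∀ (n : ℕ) (S : Finset α), S.card = n → (∀ p ∈ S, f p ∈ B) →
      ∃ M : Finset (Finset α), (∀ e ∈ M, e.card = 3 ∧ e ⊆ S ∧ ∀ x ∈ e, ∀ y ∈ e, f x = f y) ∧
        (∀ e ∈ M, ∀ e' ∈ M, ∀ x, x ∈ e → x ∈ e' → e = e') ∧ S.card ≤ 3 * M.card + 2 * B.card := by
  intro n
  induction n using Nat.strong_induction_on with
  | _ n ih =>
  intro S hS hB
  by_cases h : S.card ≤ 2 * B.card
  · exact ⟨∅, by simp, by simp, by simpa using h⟩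
  · push Not at h
    obtain ⟨y, hy, hcard⟩ := Finset.exists_lt_card_fiber_of_mul_lt_card_of_maps_to
      (s := S) (t := B) (f := f) (n := 2) hB (by omega)
    obtain ⟨e, he, he3⟩ := Finset.exists_subset_card_eq (show 3 ≤ _ from hcard)
    have heS : e ⊆ S := he.trans (Finset.filter_subset _ _)
    have hc := Finset.card_sdiff_add_card_eq_card heS
    obtain ⟨M, m1, m2, m3⟩ := ih (S \ e).card (by omega) (S \ e) rfl
      (fun p hp => hB p (Finset.mem_sdiff.1 hp).1)
    have hdis : ∀ g ∈ M, ∀ x, x ∈ g → x ∉ e := fun g hg x hx =>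
      (Finset.mem_sdiff.1 ((m1 g hg).2.1 hx)).2
    have heM : e ∉ M := by
      intro heM
      obtain ⟨x, hx⟩ := Finset.card_pos.1 (show 0 < e.card by omega)
      exact hdis e heM x hx hx
    refine ⟨insert e M, ?_, ?_, ?_⟩
    · intro g hg
      rcases Finset.mem_insert.1 hg with rfl | hg
      · refine ⟨he3, heS, fun x hx z hz => ?_⟩
        rw [(Finset.mem_filter.1 (he hx)).2, (Finset.mem_filter.1 (he hz)).2]
      · exact ⟨(m1 g hg).1, (m1 g hg).2.1.trans Finset.sdiff_subset, (m1 g hg).2.2⟩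
    · intro g hg g' hg' x hx hx'
      rcases Finset.mem_insert.1 hg with h1 | h1 <;> rcases Finset.mem_insert.1 hg' with h2 | h2
      · rw [h1, h2]
      · exact absurd (h1 ▸ hx) (hdis g' h2 x hx')
      · exact absurd (h2 ▸ hx') (hdis g h1 x hx)
      · exact m2 g h1 g' h2 x hx hx'
    · rw [Finset.card_insert_of_notMem heM]
      omega

/-- Supersaturation: a linear 3-graph of collinear triples. -/
theorem supersat (m r : ℕ) (S D : Finset (ℤ × ℤ × ℤ)) (hS : S ⊆ grid m) (hD : D ⊆ box r)
    (hprim : ∀ v ∈ D, Prim v) (hbig : 12 * r * m ^ 2 ≤ S.card) :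
    ∃ H : Finset (Finset (ℤ × ℤ × ℤ)), (∀ e ∈ H, e.card = 3 ∧ e ⊆ S) ∧
      (∀ e ∈ H, ∀ f ∈ H, ∀ x y, x ≠ y → x ∈ e → y ∈ e → x ∈ f → y ∈ f → e = f) ∧
      (∀ v ∈ S, (H.filter (fun e => v ∈ e)).card ≤ D.card) ∧
      S.card * D.card ≤ 6 * H.card ∧
      ∀ e ∈ H, ∀ x ∈ e, ∀ y ∈ e, ∀ z ∈ e, Coll x y z := by
  have hM : ∀ v : ℤ × ℤ × ℤ, ∃ M : Finset (Finset (ℤ × ℤ × ℤ)), v ∈ D →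
      ((∀ e ∈ M, e.card = 3 ∧ e ⊆ S ∧ ∀ x ∈ e, ∀ y ∈ e, rep v x = rep v y) ∧
        (∀ e ∈ M, ∀ e' ∈ M, ∀ x, x ∈ e → x ∈ e' → e = e') ∧
        S.card ≤ 6 * M.card) := by
    intro v
    by_cases hv : v ∈ D
    · obtain ⟨M, m1, m2, m3⟩ := matching (rep v) (slab r m) _ S rfl
        (fun p hp => rep_mem (hD hv) (hS hp))
      refine ⟨M, fun _ => ⟨m1, m2, ?_⟩⟩
      have := slab_card r m
      have e : 12 * r * m ^ 2 = 4 * (3 * r * m ^ 2) := by ring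
      omega
    · exact ⟨∅, fun h => absurd h hv⟩
  choose M hM using hM
  have same : ∀ v ∈ D, ∀ w ∈ D, ∀ e ∈ M v, ∀ f ∈ M w, ∀ x y, x ≠ y → x ∈ e → y ∈ e → x ∈ f →
      y ∈ f → v = w := by
    intro v hv w hw e he f hf x y hxy hxe hye hxf hyf
    obtain ⟨k, k1, k2, k3⟩ := rep_eq (((hM v hv).1 e he).2.2 x hxe y hye)
    obtain ⟨l, l1, l2, l3⟩ := rep_eq (((hM w hw).1 f hf).2.2 x hxf y hyf)
    refine prim_eq (hD hv) (hD hw) (hprim v hv) (hprim w hw) k l ?_ (by rw [← k1, ← l1])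
      (by rw [← k2, ← l2]) (by rw [← k3, ← l3])
    rintro rfl
    apply hxy
    ext <;> linarith
  refine ⟨D.biUnion M, ?_, ?_, ?_, ?_, ?_⟩
  · intro e he
    obtain ⟨v, hv, hev⟩ := Finset.mem_biUnion.1 he
    exact ⟨((hM v hv).1 e hev).1, ((hM v hv).1 e hev).2.1⟩
  · intro e he f hf x y hxy hxe hye hxf hyf
    obtain ⟨v, hv, hev⟩ := Finset.mem_biUnion.1 he
    obtain ⟨w, hw, hfw⟩ := Finset.mem_biUnion.1 hf
    have := same v hv w hw e hev f hfw x y hxy hxe hye hxf hyf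
    subst this
    exact (hM v hv).2.1 e hev f hfw x hxe hxf
  · intro p _
    rw [Finset.filter_biUnion]
    refine (Finset.card_biUnion_le_card_mul _ _ 1 ?_).trans (by simp)
    intro v hv
    rw [Finset.card_le_one]
    intro e he f hf
    rw [Finset.mem_filter] at he hf
    exact (hM v hv).2.1 e he.1 f hf.1 p he.2 hf.2
  · rw [Finset.card_biUnion]
    · rw [Finset.mul_sum, mul_comm, ← smul_eq_mul]
      exact Finset.card_nsmul_le_sum _ _ _ (fun v hv => (hM v hv).2.2)
    · intro v hv w hw hvw
      rw [Function.onFun, Finset.disjoint_left]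
      intro e he he'
      apply hvw
      obtain ⟨x, hx, y, hy, hxy⟩ := Finset.one_lt_card.1
        (show 1 < e.card by rw [((hM v hv).1 e he).1]; norm_num)
      exact same v hv w hw e he e he' x y hxy hx hy hx hy
  · intro e he x hx y hy z hz
    obtain ⟨v, hv, hev⟩ := Finset.mem_biUnion.1 he
    obtain ⟨k, k1, k2, k3⟩ := rep_eq (((hM v hv).1 e hev).2.2 x hx y hy)
    obtain ⟨l, l1, l2, l3⟩ := rep_eq (((hM v hv).1 e hev).2.2 x hx z hz)
    refine ⟨?_, ?_, ?_⟩
    · rw [k1, k2, l1, l2]; ring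
    · rw [k1, k3, l1, l3]; ring
    · rw [k2, k3, l2, l3]; ring

/-- No three distinct collinear points. -/
def NoThree (I : Finset (ℤ × ℤ × ℤ)) : Prop :=
  ∀ a ∈ I, ∀ b ∈ I, ∀ c ∈ I, a ≠ b → a ≠ c → b ≠ c → ¬ Coll a b c

theorem one_step (m w : ℕ) (V : Finset (ℤ × ℤ × ℤ)) (hV : V ⊆ grid m) (hw : 8 ≤ w)
    (h1 : 864 * w ^ 2 * m ^ 2 ≤ V.card) (h2 : V.card ≤ 3456 * w ^ 2 * m ^ 2) (hwm : w ≤ m ^ 2) :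
    ∃ F : Finset (Finset (ℤ × ℤ × ℤ)),
        F.card ≤ (m ^ 3 + 1) ^ (768 * m ^ 2 / w) ∧
        (∀ C ∈ F, C ⊆ V ∧ 4608 * C.card ≤ 4607 * V.card) ∧
        ∀ I, I ⊆ V → NoThree I → ∃ C ∈ F, I ⊆ C := by
  classical
  have hpc := prim_count (72 * w ^ 2)
  obtain ⟨D, hDs, hDc⟩ := Finset.exists_subset_card_eq
    (s := (box (72 * w ^ 2)).filter Prim) (n := (48 * (9 * w ^ 3)) ^ 2) (by
      have : (72 * w ^ 2) ^ 3 = 2 * (48 * (9 * w ^ 3)) ^ 2 := by ring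
      omega)
  obtain ⟨H, a1, a2, a3, a4, a5⟩ := supersat m (72 * w ^ 2) V D hV
    (hDs.trans (Finset.filter_subset _ _)) (fun v hv => (Finset.mem_filter.1 (hDs hv)).2)
    (by rw [← mul_assoc]; exact h1)
  rw [hDc] at a3 a4
  have hw3 : 512 ≤ w ^ 3 := by
    calc 512 = 8 ^ 3 := by norm_num
      _ ≤ w ^ 3 := by gcongr
  have hbig : 48 * (9 * w ^ 3) ≤ V.card := by
    refine le_trans ?_ h1
    calc 48 * (9 * w ^ 3) = 432 * w ^ 2 * w := by ring
      _ ≤ 864 * w ^ 2 * m ^ 2 := by gcongr; norm_num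
  obtain ⟨F, f1, f2, f3⟩ := hyper_container V H (9 * w ^ 3) a1 a2 a3 a4 (by omega) hbig
  refine ⟨F, f1.trans ?_, f2, fun I hI hno => f3 I hI ?_⟩
  · have hVm : V.card ≤ m ^ 3 := (Finset.card_le_card hV).trans (grid_card m).le
    have hexp : 2 * (V.card / (9 * w ^ 3)) ≤ 768 * m ^ 2 / w := by
      rw [Nat.le_div_iff_mul_le (by omega)]
      have h3 : V.card / (9 * w ^ 3) * (9 * w ^ 3) ≤ V.card := Nat.div_mul_le_self _ _
      have h4 : (V.card / (9 * w ^ 3) * w) * (9 * w ^ 2) ≤ (384 * m ^ 2) * (9 * w ^ 2) := by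
        calc _ = V.card / (9 * w ^ 3) * (9 * w ^ 3) := by ring
          _ ≤ 3456 * w ^ 2 * m ^ 2 := h3.trans h2
          _ = _ := by ring
      have h5 := Nat.le_of_mul_le_mul_right h4 (by positivity)
      linarith
    exact (Nat.pow_le_pow_left (by omega) _).trans (Nat.pow_le_pow_right (by omega) hexp)
  · intro e he heI
    obtain ⟨a, b, c, hab, hac, hbc, rfl⟩ := Finset.card_eq_three.1 (a1 e he).1
    exact hno a (heI (by simp)) b (heI (by simp)) c (heI (by simp)) hab hac hbc
      (a5 _ he a (by simp) b (by simp) c (by simp))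

theorem containers (w : ℕ) (hw : 8 ≤ w) : ∀ (j : ℕ) (V : Finset (ℤ × ℤ × ℤ)), V ⊆ grid (w ^ 3) →
    (V.card : ℝ) * (4607 / 4608) ^ j ≤ 864 * w ^ 8 →
    ∃ F : Finset (Finset (ℤ × ℤ × ℤ)),
        F.card ≤ ((w ^ 9 + 1) ^ (768 * w ^ 5)) ^ j ∧
        (∀ C ∈ F, C.card ≤ 864 * w ^ 8) ∧
        ∀ I, I ⊆ V → NoThree I → ∃ C ∈ F, I ⊆ C := by
  classical
  intro j
  induction j with
  | zero =>
    intro V hV hc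
    refine ⟨{V}, by simp, ?_, fun I hI _ => ⟨V, by simp, hI⟩⟩
    intro C hC
    rw [Finset.mem_singleton] at hC
    subst hC
    have : (C.card : ℝ) ≤ ((864 * w ^ 8 : ℕ) : ℝ) := by push_cast; simpa using hc
    exact_mod_cast this
  | succ j ih =>
    intro V hV hc
    by_cases hsmall : V.card ≤ 864 * w ^ 8
    · refine ⟨{V}, ?_, ?_, fun I hI _ => ⟨V, by simp, hI⟩⟩
      · rw [Finset.card_singleton]
        exact Nat.one_le_iff_ne_zero.2 (by positivity)
      · intro C hC
        rw [Finset.mem_singleton] at hC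
        subst hC
        exact hsmall
    · push Not at hsmall
      set m := w ^ 3 with hm
      have hm0 : 0 < m := by positivity
      have hVm : V.card ≤ m ^ 3 := (Finset.card_le_card hV).trans (grid_card m).le
      set u := Nat.sqrt (V.card / (864 * m ^ 2)) with hu
      have u1 : u ^ 2 * (864 * m ^ 2) ≤ V.card := by
        have : u ^ 2 ≤ V.card / (864 * m ^ 2) := Nat.sqrt_le' _
        exact (Nat.le_div_iff_mul_le (by positivity)).1 this
      have u2 : V.card < (u + 1) ^ 2 * (864 * m ^ 2) := by
        have : V.card / (864 * m ^ 2) < (u + 1) ^ 2 := Nat.lt_succ_sqrt' _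
        exact (Nat.div_lt_iff_lt_mul (by positivity)).1 this
      have u3 : w ≤ u := by
        rw [hu, Nat.le_sqrt', Nat.le_div_iff_mul_le (by positivity)]
        refine le_trans (le_of_eq ?_) hsmall.le
        rw [hm]; ring
      have u4 : u ≤ m ^ 2 := by
        have h1 : u ^ 2 * (864 * m ^ 2) ≤ m * (m ^ 2) := by
          refine u1.trans (hVm.trans (le_of_eq (by ring)))
        have h2 : (864 * u ^ 2) * m ^ 2 ≤ m * m ^ 2 := by linarith
        have h3 := Nat.le_of_mul_le_mul_right h2 (by positivity)
        nlinarith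
      obtain ⟨F0, f1, f2, f3⟩ := one_step m u V hV (hw.trans u3) (by linarith) (by
        refine u2.le.trans ?_
        have : (u + 1) ^ 2 ≤ (2 * u) ^ 2 := Nat.pow_le_pow_left (by omega) 2
        calc _ ≤ (2 * u) ^ 2 * (864 * m ^ 2) := by gcongr
          _ = _ := by ring) u4
      have hX : F0.card ≤ (w ^ 9 + 1) ^ (768 * w ^ 5) := by
        refine f1.trans ?_
        have e1 : m ^ 3 = w ^ 9 := by rw [hm]; ring
        rw [e1]
        apply Nat.pow_le_pow_right (by omega)
        calc 768 * m ^ 2 / u ≤ 768 * m ^ 2 / w := Nat.div_le_div_left u3 (by omega)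
          _ = 768 * w ^ 5 := by
            apply Nat.div_eq_of_eq_mul_left (by omega)
            rw [hm]; ring
      have hstep : ∀ C : Finset (ℤ × ℤ × ℤ), ∃ F : Finset (Finset (ℤ × ℤ × ℤ)), C ∈ F0 →
        (F.card ≤ ((w ^ 9 + 1) ^ (768 * w ^ 5)) ^ j ∧
        (∀ C ∈ F, C.card ≤ 864 * w ^ 8) ∧
        ∀ I, I ⊆ C → NoThree I → ∃ C ∈ F, I ⊆ C) := by
        intro C
        by_cases hC : C ∈ F0
        · obtain ⟨c1, c2⟩ := f2 C hC
          obtain ⟨F, hF⟩ := ih C (c1.trans hV) (by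
            refine le_trans ?_ hc
            have c2' : (4608 : ℝ) * C.card ≤ 4607 * V.card := by exact_mod_cast c2
            have : (C.card : ℝ) ≤ V.card * (4607 / 4608) := by linarith
            rw [pow_succ']
            rw [← mul_assoc]
            gcongr)
          exact ⟨F, fun _ => hF⟩
        · exact ⟨∅, fun h => absurd h hC⟩
      choose Φ hΦ using hstep
      refine ⟨F0.biUnion Φ, ?_, ?_, ?_⟩
      · refine (Finset.card_biUnion_le_card_mul _ _ _ (fun C hC => (hΦ C hC).1)).trans ?_
        rw [pow_succ' _ j]
        exact Nat.mul_le_mul_right _ hX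
      · intro C hC
        obtain ⟨C0, h0, h0'⟩ := Finset.mem_biUnion.1 hC
        exact (hΦ C0 h0).2.1 C h0'
      · intro I hI hno
        obtain ⟨C0, h0, hI0⟩ := f3 I hI hno
        obtain ⟨C, hC, hIC⟩ := (hΦ C0 h0).2.2 I hI0 hno
        exact ⟨C, Finset.mem_biUnion.2 ⟨C0, h0, hC⟩, hIC⟩


/-- Pairs `(x, i)` with `i ≠ 0` and `|i x| ≤ m`. -/
noncomputable def prs (m : ℕ) : Finset (ℤ × ℤ) :=
  (Finset.Icc 1 m).biUnion (fun n =>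
    Finset.Icc (-((m / n : ℕ) : ℤ)) ((m / n : ℕ) : ℤ) ×ˢ ({(n : ℤ), -(n : ℤ)} : Finset ℤ))

theorem prs_card (m : ℕ) : ((prs m).card : ℝ) ≤ 6 * m * (1 + Real.log m) := by
  have h1 : (prs m).card ≤ ∑ n ∈ Finset.Icc 1 m, 6 * (m / n) := by
    unfold prs
    refine Finset.card_biUnion_le.trans (Finset.sum_le_sum fun n hn => ?_)
    rw [Finset.mem_Icc] at hn
    rw [Finset.card_product, Int.card_Icc]
    have h2 : ({(n : ℤ), -(n : ℤ)} : Finset ℤ).card ≤ 2 := Finset.card_le_two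
    have h3 : 1 ≤ m / n := (Nat.one_le_div_iff (by omega)).2 hn.2
    calc _ ≤ (((m / n : ℕ) : ℤ) + 1 - -((m / n : ℕ) : ℤ)).toNat * 2 := by gcongr
      _ ≤ _ := by omega
  have h2 : ((∑ n ∈ Finset.Icc 1 m, 6 * (m / n) : ℕ) : ℝ) ≤ 6 * m * (harmonic m : ℝ) := by
    rw [harmonic_eq_sum_Icc]
    push_cast
    rw [Finset.mul_sum]
    refine Finset.sum_le_sum fun n _ => ?_
    have : ((m / n : ℕ) : ℝ) ≤ (m : ℝ) / n := Nat.cast_div_le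
    rw [mul_assoc, ← div_eq_mul_inv]
    gcongr
  calc ((prs m).card : ℝ) ≤ ((∑ n ∈ Finset.Icc 1 m, 6 * (m / n) : ℕ) : ℝ) := by exact_mod_cast h1
    _ ≤ _ := h2
    _ ≤ _ := by gcongr; exact harmonic_le_one_add_log m

theorem mem_prs {m : ℕ} {x i : ℤ} (hi : i ≠ 0) (him : |i| ≤ m) (h : |i * x| ≤ m) :
    (x, i) ∈ prs m := by
  unfold prs
  rw [Finset.mem_biUnion]
  have e : (i.natAbs : ℤ) = |i| := Int.natCast_natAbs i
  have ipos : 0 < |i| := abs_pos.2 hi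
  refine ⟨i.natAbs, ?_, ?_⟩
  · rw [Finset.mem_Icc]
    omega
  · rw [Finset.mem_product]
    constructor
    · simp only [Finset.mem_Icc]
      rw [← abs_le]
      push_cast
      rw [Int.le_ediv_iff_mul_le ipos, ← abs_mul, mul_comm]
      exact h
    · simp only [Finset.mem_insert, Finset.mem_singleton]
      rw [e]
      rcases abs_choice i with h | h <;> rw [h] <;> simp

/-- Four distinct collinear points. -/
def Four (q : (ℤ × ℤ × ℤ) × (ℤ × ℤ × ℤ) × (ℤ × ℤ × ℤ) × (ℤ × ℤ × ℤ)) : Prop :=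
  q.1 ≠ q.2.1 ∧ q.1 ≠ q.2.2.1 ∧ q.1 ≠ q.2.2.2 ∧ q.2.1 ≠ q.2.2.1 ∧ q.2.1 ≠ q.2.2.2 ∧
    q.2.2.1 ≠ q.2.2.2 ∧ Coll q.1 q.2.1 q.2.2.1 ∧ Coll q.1 q.2.1 q.2.2.2

open Classical in
/-- Ordered collinear quadruples. -/
noncomputable def quads (m : ℕ) :
    Finset ((ℤ × ℤ × ℤ) × (ℤ × ℤ × ℤ) × (ℤ × ℤ × ℤ) × (ℤ × ℤ × ℤ)) :=
  (grid m ×ˢ grid m ×ˢ grid m ×ˢ grid m).filter Four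

theorem quads_card (m : ℕ) : ((quads m).card : ℝ) ≤ m ^ 3 * (6 * m * (1 + Real.log m)) ^ 3 := by
  classical
  have hsub : quads m ⊆ (grid m ×ˢ prs m ×ˢ prs m ×ˢ prs m).image (fun s =>
      (s.1,
       (s.1.1 + s.2.1.2 * s.2.1.1, s.1.2.1 + s.2.1.2 * s.2.2.1.1, s.1.2.2 + s.2.1.2 * s.2.2.2.1),
       (s.1.1 + s.2.2.1.2 * s.2.1.1, s.1.2.1 + s.2.2.1.2 * s.2.2.1.1,
          s.1.2.2 + s.2.2.1.2 * s.2.2.2.1),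
       (s.1.1 + s.2.2.2.2 * s.2.1.1, s.1.2.1 + s.2.2.2.2 * s.2.2.1.1,
          s.1.2.2 + s.2.2.2.2 * s.2.2.2.1))) := by
    rintro ⟨a, b, c, d⟩ hq
    unfold quads at hq
    rw [Finset.mem_filter] at hq
    simp only [Finset.mem_product, Four] at hq
    obtain ⟨⟨ha, hb, hc, hd⟩, hab, hac, had, hbc, hbd, hcd, h1, h2⟩ := hq
    rw [mem_grid] at ha hb hc hd
    have hne : b.1 - a.1 ≠ 0 ∨ b.2.1 - a.2.1 ≠ 0 ∨ b.2.2 - a.2.2 ≠ 0 := by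
      by_contra hcon
      push Not at hcon
      apply hab
      exact Prod.ext (by linarith [hcon.1]) (Prod.ext (by linarith [hcon.2.1]) (by linarith [hcon.2.2]))
    obtain ⟨g, v, hg, hv, e1, e2, e3⟩ :=
      exists_prim (b.1 - a.1, b.2.1 - a.2.1, b.2.2 - a.2.2) hne
    simp only at e1 e2 e3
    have hgz : (g : ℤ) ≠ 0 := by exact_mod_cast hg.ne'
    have par : ∀ c, Coll a b c → ∃ k : ℤ, c.1 - a.1 = k * v.1 ∧ c.2.1 - a.2.1 = k * v.2.1 ∧
        c.2.2 - a.2.2 = k * v.2.2 := by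
      rintro c ⟨q1, q2, q3⟩
      rw [e1, e2] at q1
      rw [e1, e3] at q2
      rw [e2, e3] at q3
      refine prim_mul (u := (c.1 - a.1, c.2.1 - a.2.1, c.2.2 - a.2.2)) hv ?_ ?_ ?_
      · apply mul_left_cancel₀ hgz; simp only; linarith
      · apply mul_left_cancel₀ hgz; simp only; linarith
      · apply mul_left_cancel₀ hgz; simp only; linarith
    obtain ⟨j, j1, j2, j3⟩ := par c h1
    obtain ⟨k, k1, k2, k3⟩ := par d h2
    have hj : j ≠ 0 := by
      rintro rfl
      apply hac
      exact Prod.ext (by linarith) (Prod.ext (by linarith) (by linarith))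
    have hk : k ≠ 0 := by
      rintro rfl
      apply had
      exact Prod.ext (by linarith) (Prod.ext (by linarith) (by linarith))
    have hv0 : v.1 ≠ 0 ∨ v.2.1 ≠ 0 ∨ v.2.2 ≠ 0 := by
      by_contra hcon
      push Not at hcon
      obtain ⟨x, y, z, h⟩ := hv
      rw [hcon.1, hcon.2.1, hcon.2.2] at h
      simp at h
    have bound : ∀ i : ℤ, |i * v.1| ≤ m → |i * v.2.1| ≤ m → |i * v.2.2| ≤ m → |i| ≤ m := by
      intro i i1 i2 i3
      have aux : ∀ x : ℤ, x ≠ 0 → |i * x| ≤ m → |i| ≤ m := by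
        intro x hx hh
        have : 1 ≤ |x| := Int.one_le_abs hx
        rw [abs_mul] at hh
        nlinarith [abs_nonneg i]
      rcases hv0 with h | h | h
      · exact aux _ h i1
      · exact aux _ h i2
      · exact aux _ h i3
    have bd : ∀ x y : ℤ, (0 ≤ x ∧ x < m) → (0 ≤ y ∧ y < m) → |y - x| ≤ m := by
      intro x y hx hy
      rw [abs_le]; omega
    rw [Finset.mem_image]
    refine ⟨(a, (v.1, (g : ℤ)), (v.2.1, j), (v.2.2, k)), ?_, ?_⟩
    · simp only [Finset.mem_product]
      have b1 := bd _ _ ha.1 hb.1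
      have b2 := bd _ _ ha.2.1 hb.2.1
      have b3 := bd _ _ ha.2.2 hb.2.2
      have c1 := bd _ _ ha.1 hc.1
      have c2 := bd _ _ ha.2.1 hc.2.1
      have c3 := bd _ _ ha.2.2 hc.2.2
      have d1 := bd _ _ ha.1 hd.1
      have d2 := bd _ _ ha.2.1 hd.2.1
      have d3 := bd _ _ ha.2.2 hd.2.2
      rw [e1] at b1
      rw [e2] at b2
      rw [e3] at b3
      rw [j1] at c1
      rw [j2] at c2
      rw [j3] at c3
      rw [k1] at d1
      rw [k2] at d2
      rw [k3] at d3
      exact ⟨mem_grid.2 ha, mem_prs hgz (bound _ b1 b2 b3) b1, mem_prs hj (bound _ c1 c2 c3) c2,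
        mem_prs hk (bound _ d1 d2 d3) d3⟩
    · simp only
      rw [← e1, ← e2, ← e3, ← j1, ← j2, ← j3, ← k1, ← k2, ← k3]
      simp
  have h1 : (quads m).card ≤ m ^ 3 * (prs m).card ^ 3 := by
    refine (Finset.card_le_card hsub).trans (Finset.card_image_le.trans (le_of_eq ?_))
    rw [Finset.card_product, Finset.card_product, Finset.card_product, grid_card]
    ring
  calc ((quads m).card : ℝ) ≤ m ^ 3 * ((prs m).card : ℝ) ^ 3 := by exact_mod_cast h1
    _ ≤ _ := by gcongr; exact prs_card m

section prob
variable {α : Type*} [DecidableEq α]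

/-- Bernoulli weight. -/
noncomputable def wt (V : Finset α) (p : ℝ) (W : Finset α) : ℝ :=
  (∏ _i ∈ W, p) * ∏ _i ∈ V \ W, (1 - p)

theorem wt_pos (V : Finset α) (p : ℝ) (h0 : 0 < p) (h1 : p < 1) (W : Finset α) : 0 < wt V p W := by
  unfold wt
  have : 0 < 1 - p := by linarith
  positivity

theorem wt_sum (V : Finset α) (p : ℝ) : ∑ W ∈ V.powerset, wt V p W = 1 := by
  unfold wt
  rw [← Finset.prod_add]
  simp

theorem wt_sub (V : Finset α) (p : ℝ) (T : Finset α) (hT : T ⊆ V) :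
    ∑ W ∈ V.powerset, wt V p W * (if T ⊆ W then 1 else 0) = p ^ T.card := by
  have h := Finset.prod_add (fun _ : α => p) (fun i => if i ∈ T then 0 else 1 - p) V
  have e : ∀ i, p + (if i ∈ T then 0 else 1 - p) = if i ∈ T then p else 1 := by
    intro i; split_ifs <;> ring
  simp only [e] at h
  rw [Finset.prod_ite_mem, Finset.inter_eq_right.2 hT, Finset.prod_const] at h
  rw [h]
  refine Finset.sum_congr rfl fun W hW => ?_
  unfold wt
  rw [mul_assoc]
  congr 1
  split_ifs with hTW
  · rw [mul_one]
    refine Finset.prod_congr rfl fun i hi => ?_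
    rw [if_neg (fun hiT => (Finset.mem_sdiff.1 hi).2 (hTW hiT))]
  · rw [mul_zero]
    obtain ⟨x, hx, hx'⟩ := Finset.not_subset.1 hTW
    rw [eq_comm]
    exact Finset.prod_eq_zero (Finset.mem_sdiff.2 ⟨hT hx, hx'⟩) (if_pos hx)

theorem wt_exp (V : Finset α) (p : ℝ) (hp : 0 ≤ p) (C : Finset α) :
    ∑ W ∈ V.powerset, wt V p W * 2 ^ (W ∩ C).card ≤ (1 + p) ^ C.card := by
  have h := Finset.prod_add (fun i : α => p * (if i ∈ C then 2 else 1)) (fun _ => 1 - p) V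
  have e : ∀ i, p * (if i ∈ C then 2 else 1) + (1 - p) = if i ∈ C then 1 + p else 1 := by
    intro i; split_ifs <;> ring
  simp only [e] at h
  rw [Finset.prod_ite_mem, Finset.prod_const] at h
  calc _ = (1 + p) ^ (V ∩ C).card := by
        rw [h]
        refine Finset.sum_congr rfl fun W hW => ?_
        unfold wt
        rw [Finset.prod_mul_distrib, Finset.prod_ite_mem, Finset.prod_const (2 : ℝ)]
        ring
    _ ≤ _ := pow_le_pow_right₀ (by linarith) (Finset.card_le_card Finset.inter_subset_right)

theorem random_select (V : Finset α) (p N t : ℝ) (h0 : 0 < p) (h1 : p < 1) (hN : 0 < N) (c : ℕ)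
    {ι : Type*} (E : Finset ι) (τ : ι → Finset α) (hτ : ∀ q ∈ E, τ q ⊆ V ∧ (τ q).card = 4)
    (F : Finset (Finset α)) (hF : ∀ C ∈ F, C.card ≤ c)
    (hyp : N + p ^ 4 * E.card + V.card * (F.card * (1 + p) ^ c * 2 ^ (-t)) ≤ p * V.card) :
    ∃ W ⊆ V, N + ((E.filter (fun q => τ q ⊆ W)).card : ℝ) ≤ W.card ∧
      ∀ C ∈ F, ((W ∩ C).card : ℝ) < t := by
  set f : Finset α → ℝ := fun W => (∑ v ∈ V, if ({v} : Finset α) ⊆ W then (1 : ℝ) else 0)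
    - (∑ q ∈ E, if τ q ⊆ W then (1 : ℝ) else 0)
    - V.card * ∑ C ∈ F, 2 ^ (W ∩ C).card * (2 : ℝ) ^ (-t) with hf
  have hexp : N ≤ ∑ W ∈ V.powerset, wt V p W * f W := by
    have e1 : ∑ W ∈ V.powerset, wt V p W * f W =
        (∑ v ∈ V, ∑ W ∈ V.powerset, wt V p W * (if ({v} : Finset α) ⊆ W then (1 : ℝ) else 0))
        - (∑ q ∈ E, ∑ W ∈ V.powerset, wt V p W * (if τ q ⊆ W then (1 : ℝ) else 0))
        - V.card * ∑ C ∈ F, (∑ W ∈ V.powerset, wt V p W * 2 ^ (W ∩ C).card) * (2 : ℝ) ^ (-t) := by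
      simp only [hf, mul_sub, Finset.sum_sub_distrib, Finset.mul_sum, Finset.sum_mul]
      rw [Finset.sum_comm, Finset.sum_comm (s := V.powerset) (t := E),
        Finset.sum_comm (s := V.powerset) (t := F)]
      congr 1
      refine Finset.sum_congr rfl fun C _ => Finset.sum_congr rfl fun W _ => ?_
      ring
    have e2 : (∑ v ∈ V, ∑ W ∈ V.powerset, wt V p W * (if ({v} : Finset α) ⊆ W then (1 : ℝ) else 0))
        = p * V.card := by
      rw [Finset.sum_congr rfl (fun v hv => wt_sub V p {v} (Finset.singleton_subset_iff.2 hv))]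
      simp [mul_comm]
    have e3 : (∑ q ∈ E, ∑ W ∈ V.powerset, wt V p W * (if τ q ⊆ W then (1 : ℝ) else 0))
        = p ^ 4 * E.card := by
      rw [Finset.sum_congr rfl (fun q hq => wt_sub V p (τ q) (hτ q hq).1)]
      rw [Finset.sum_congr rfl (fun q hq => by rw [(hτ q hq).2])]
      simp [mul_comm]
    have e4 : ∑ C ∈ F, (∑ W ∈ V.powerset, wt V p W * 2 ^ (W ∩ C).card) * (2 : ℝ) ^ (-t)
        ≤ F.card * (1 + p) ^ c * 2 ^ (-t) := by
      calc _ ≤ ∑ C ∈ F, (1 + p) ^ c * (2 : ℝ) ^ (-t) := by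
            refine Finset.sum_le_sum fun C hC => ?_
            gcongr
            exact (wt_exp V p h0.le C).trans (pow_le_pow_right₀ (by linarith) (hF C hC))
        _ = _ := by simp; ring
    have e5 : (V.card : ℝ) * ∑ C ∈ F, (∑ W ∈ V.powerset, wt V p W * 2 ^ (W ∩ C).card) * (2 : ℝ) ^ (-t)
        ≤ V.card * (F.card * (1 + p) ^ c * 2 ^ (-t)) := by gcongr
    rw [e1, e2, e3]
    linarith
  have hex : ∃ W ∈ V.powerset, wt V p W * N ≤ wt V p W * f W := by
    apply Finset.exists_le_of_sum_le ⟨∅, by simp⟩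
    rw [← Finset.sum_mul, wt_sum, one_mul]
    exact hexp
  obtain ⟨W, hW, hWN⟩ := hex
  rw [Finset.mem_powerset] at hW
  have hWf : N ≤ f W := le_of_mul_le_mul_left hWN (wt_pos V p h0 h1 W)
  have s1 : (∑ v ∈ V, if ({v} : Finset α) ⊆ W then (1 : ℝ) else 0) = W.card := by
    simp only [Finset.singleton_subset_iff]
    rw [Finset.sum_boole, Finset.filter_mem_eq_inter, Finset.inter_eq_right.2 hW]
  have s2 : (∑ q ∈ E, if τ q ⊆ W then (1 : ℝ) else 0) = (E.filter (fun q => τ q ⊆ W)).card := by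
    rw [Finset.sum_boole]
  have hWf' : N ≤ W.card - ((E.filter (fun q => τ q ⊆ W)).card : ℝ)
      - V.card * ∑ C ∈ F, 2 ^ (W ∩ C).card * (2 : ℝ) ^ (-t) := by
    rw [← s1, ← s2]; exact hWf
  have s3 : 0 ≤ ∑ C ∈ F, 2 ^ (W ∩ C).card * (2 : ℝ) ^ (-t) :=
    Finset.sum_nonneg fun C _ => by positivity
  refine ⟨W, hW, ?_, ?_⟩
  · have : 0 ≤ (V.card : ℝ) * ∑ C ∈ F, 2 ^ (W ∩ C).card * (2 : ℝ) ^ (-t) := by positivity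
    linarith
  · intro C hC
    by_contra hcon
    push Not at hcon
    have s4 : 1 ≤ ∑ C ∈ F, 2 ^ (W ∩ C).card * (2 : ℝ) ^ (-t) := by
      have : (1 : ℝ) ≤ 2 ^ (W ∩ C).card * (2 : ℝ) ^ (-t) := by
        rw [← Real.rpow_natCast, ← Real.rpow_add (by norm_num)]
        exact Real.one_le_rpow (by norm_num) (by linarith)
      exact this.trans (Finset.single_le_sum (f := fun C => 2 ^ (W ∩ C).card * (2 : ℝ) ^ (-t))
        (fun C _ => by positivity) hC)
    have s5 : (W.card : ℝ) ≤ V.card := by exact_mod_cast Finset.card_le_card hW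
    have s6 : (0 : ℝ) ≤ ((E.filter (fun q => τ q ⊆ W)).card : ℝ) := by positivity
    nlinarith [show (0 : ℝ) ≤ V.card by positivity]

end prob

theorem points_of_params (w N j : ℕ) (t p : ℝ) (hw : 8 ≤ w) (hN : 0 < N)
    (hj : (w : ℝ) ^ 9 * (4607 / 4608) ^ j ≤ 864 * w ^ 8) (h0 : 0 < p) (h1 : p < 1)
    (hyp : N + p ^ 4 * (w ^ 9 * (6 * w ^ 3 * (1 + 3 * Real.log w)) ^ 3)
      + w ^ 9 * ((((w : ℝ) ^ 9 + 1) ^ (768 * w ^ 5)) ^ j * (1 + p) ^ (864 * w ^ 8) * 2 ^ (-t))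
        ≤ p * w ^ 9) :
    ∃ W ⊆ grid (w ^ 3), W.card = N ∧
      (∀ a ∈ W, ∀ b ∈ W, ∀ c ∈ W, ∀ d ∈ W, ¬ Four (a, b, c, d)) ∧
      ∀ I ⊆ W, NoThree I → (I.card : ℝ) < t := by
  classical
  have hgc : (grid (w ^ 3)).card = w ^ 9 := by rw [grid_card]; ring
  obtain ⟨F, f1, f2, f3⟩ := containers w hw j (grid (w ^ 3)) subset_rfl (by
    rw [hgc]; push_cast; exact hj)
  have hq := quads_card (w ^ 3)
  have hmem : ∀ q ∈ quads (w ^ 3), (q.1 ∈ grid (w ^ 3) ∧ q.2.1 ∈ grid (w ^ 3) ∧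
      q.2.2.1 ∈ grid (w ^ 3) ∧ q.2.2.2 ∈ grid (w ^ 3)) ∧ Four q := by
    intro q hq
    unfold quads at hq
    rw [Finset.mem_filter] at hq
    simpa only [Finset.mem_product] using hq
  obtain ⟨W, hWV, hWN, hWC⟩ := random_select (grid (w ^ 3)) p N t h0 h1 (by exact_mod_cast hN)
    (864 * w ^ 8) (quads (w ^ 3)) (fun q => {q.1, q.2.1, q.2.2.1, q.2.2.2}) (by
      intro q hq
      obtain ⟨⟨q1, q2, q3, q4⟩, n1, n2, n3, n4, n5, n6, -⟩ := hmem q hq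
      refine ⟨?_, ?_⟩
      · intro x hx
        simp only [Finset.mem_insert, Finset.mem_singleton] at hx
        rcases hx with rfl | rfl | rfl | rfl <;> assumption
      · rw [Finset.card_insert_of_notMem (by simp [n1, n2, n3]),
          Finset.card_insert_of_notMem (by simp [n4, n5]), Finset.card_pair n6]) F f2 (by
      refine le_trans ?_ (hyp.trans (le_of_eq ?_))
      · have f1' : (F.card : ℝ) ≤ (((w : ℝ) ^ 9 + 1) ^ (768 * w ^ 5)) ^ j := by exact_mod_cast f1
        rw [hgc]
        push_cast at hq ⊢
        rw [Real.log_pow] at hq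
        push_cast at hq
        have e : ((w : ℝ) ^ 3) ^ 3 = w ^ 9 := by ring
        rw [e] at hq
        gcongr
      · rw [hgc]; push_cast; ring)
  set Q := (quads (w ^ 3)).filter
    (fun q => ({q.1, q.2.1, q.2.2.1, q.2.2.2} : Finset (ℤ × ℤ × ℤ)) ⊆ W) with hQ
  have hcard : N ≤ (W \ Q.image Prod.fst).card := by
    have c1 : (Q.image Prod.fst).card ≤ Q.card := Finset.card_image_le
    have c2 := Finset.le_card_sdiff (Q.image Prod.fst) W
    have c3 : N + Q.card ≤ W.card := by exact_mod_cast hWN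
    omega
  obtain ⟨W', hW', hW'N⟩ := Finset.exists_subset_card_eq hcard
  have hsub : W' ⊆ W := hW'.trans Finset.sdiff_subset
  refine ⟨W', hsub.trans hWV, hW'N, ?_, ?_⟩
  · intro a ha b hb c hc d hd hfour
    apply (Finset.mem_sdiff.1 (hW' ha)).2
    rw [Finset.mem_image]
    refine ⟨(a, b, c, d), ?_, rfl⟩
    rw [hQ, Finset.mem_filter]
    refine ⟨?_, ?_⟩
    · unfold quads
      rw [Finset.mem_filter]
      simp only [Finset.mem_product]
      exact ⟨⟨hWV (hsub ha), hWV (hsub hb), hWV (hsub hc), hWV (hsub hd)⟩, hfour⟩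
    · intro x hx
      simp only [Finset.mem_insert, Finset.mem_singleton] at hx
      rcases hx with rfl | rfl | rfl | rfl
      · exact hsub ha
      · exact hsub hb
      · exact hsub hc
      · exact hsub hd
  · intro I hI hno
    obtain ⟨C, hC, hIC⟩ := f3 I ((hI.trans hsub).trans hWV) hno
    refine lt_of_le_of_lt ?_ (hWC C hC)
    exact_mod_cast Finset.card_le_card (Finset.subset_inter (hI.trans hsub) hIC)


theorem exponent_bound (w l j x6 y z : ℝ) (hw8 : 8 ≤ w) (hl2 : 2 ≤ l) (hj2 : j ≤ 4609 * l)
    (hlz : 200000 * l ≤ z ^ 2) (hwy : w ≤ 2 * y) (hyz : y = x6 * z) (x60 : 0 < x6) (z1 : 1 ≤ z) :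
    9 * l + (10 * l * (768 * w ^ 5 * j) + 3456 * w ^ 5 +
            -(Real.log 2 * (x6 ^ 5 * z ^ 10))) ≤ 0 := by
  have w5 : (1 : ℝ) ≤ w ^ 5 := one_le_pow₀ (by linarith)
  have c1 : 9 * l ≤ 5 * (w ^ 5 * l ^ 2) := by
    calc 9 * l ≤ 5 * (1 * l ^ 2) := by nlinarith
      _ ≤ _ := by gcongr
  have c2 : 10 * l * (768 * w ^ 5 * j) ≤ 35397120 * (w ^ 5 * l ^ 2) := by
    calc 10 * l * (768 * w ^ 5 * j) ≤ 10 * l * (768 * w ^ 5 * (4609 * l)) := by gcongr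
      _ = _ := by ring
  have c3 : 3456 * (w : ℝ) ^ 5 ≤ 3456 * (w ^ 5 * l ^ 2) := by
    have : 1 ≤ l ^ 2 := by nlinarith
    have := mul_le_mul_of_nonneg_left this (show 0 ≤ w ^ 5 by linarith)
    linarith
  have c4 : (w : ℝ) ^ 5 ≤ 32 * (x6 ^ 5 * z ^ 5) := by
    calc (w : ℝ) ^ 5 ≤ (2 * y) ^ 5 := by gcongr
      _ = _ := by rw [hyz]; ring
  have c5 : (200000 * l) ^ 2 ≤ z ^ 5 := by
    calc (200000 * l) ^ 2 ≤ (z ^ 2) ^ 2 := by gcongr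
      _ = z ^ 4 := by ring
      _ ≤ z ^ 5 := pow_le_pow_right₀ z1 (by norm_num)
  have c6 : 40000000000 * (w ^ 5 * l ^ 2) ≤ 32 * (x6 ^ 5 * z ^ 10) := by
    calc 40000000000 * (w ^ 5 * l ^ 2) = (w : ℝ) ^ 5 * (200000 * l) ^ 2 := by ring
      _ ≤ 32 * (x6 ^ 5 * z ^ 5) * z ^ 5 := by gcongr
      _ = _ := by ring
  have c7 := Real.log_two_gt_d9
  have c8 : 0 < x6 ^ 5 * z ^ 10 := by positivity
  have c9 : (0.5 : ℝ) * (x6 ^ 5 * z ^ 10) ≤ Real.log 2 * (x6 ^ 5 * z ^ 10) := by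
    apply mul_le_mul_of_nonneg_right _ c8.le
    linarith
  linarith

set_option maxHeartbeats 2000000 in
theorem points_exist (ε : ℝ) (hε : 0 < ε) : ∃ n₀ : ℕ, ∀ N : ℕ, n₀ ≤ N →
    ∃ m : ℕ, ∃ W ⊆ grid m, W.card = N ∧
      (∀ a ∈ W, ∀ b ∈ W, ∀ c ∈ W, ∀ d ∈ W, ¬ Four (a, b, c, d)) ∧
      ∀ I ⊆ W, NoThree I → (I.card : ℝ) < (N : ℝ) ^ ((5 : ℝ) / 6 + ε) := by
  obtain ⟨δ, hδ, rfl⟩ : ∃ δ : ℝ, 0 < δ ∧ ε = 10 * δ := ⟨ε / 10, by positivity, by ring⟩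
  have hlo := (isLittleO_log_rpow_atTop (show 0 < 2 * δ by positivity)).bound
    (show 0 < 1 / (200000 * (1 + δ)) by positivity)
  have hev : ∀ᶠ N : ℕ in Filter.atTop, 200000 * ((1 + δ) * Real.log N) ≤ (N : ℝ) ^ (2 * δ) := by
    filter_upwards [tendsto_natCast_atTop_atTop.eventually hlo] with N hN
    rw [Real.norm_eq_abs, Real.norm_eq_abs, abs_of_nonneg (Real.rpow_nonneg (by positivity) _)] at hN
    have := (le_abs_self _).trans hN
    rw [div_mul_eq_mul_div, one_mul, le_div_iff₀ (by positivity)] at this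
    linarith
  obtain ⟨n₁, hn₁⟩ := Filter.eventually_atTop.1 hev
  refine ⟨max n₁ (8 ^ 6), fun N hN => ?_⟩
  have hlog := hn₁ N ((le_max_left _ _).trans hN)
  have hN8 : 8 ^ 6 ≤ N := (le_max_right _ _).trans hN
  have hNr : (8 : ℝ) ^ 6 ≤ N := by exact_mod_cast hN8
  have hN1 : (1 : ℝ) ≤ N := le_trans (by norm_num) hNr
  have hN0 : (0 : ℝ) < N := by linarith
  set y : ℝ := (N : ℝ) ^ ((1 : ℝ) / 6 + δ) with hy
  set w := ⌈y⌉₊ with hw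
  set x6 : ℝ := (N : ℝ) ^ ((1 : ℝ) / 6) with hx6
  have x6p : x6 ^ 6 = N := by
    rw [hx6, ← Real.rpow_natCast, ← Real.rpow_mul hN0.le]; norm_num
  have x60 : 0 < x6 := Real.rpow_pos_of_pos hN0 _
  have x68 : 8 ≤ x6 := by
    by_contra hc
    push Not at hc
    have : x6 ^ 6 < 8 ^ 6 := by gcongr
    linarith
  set z : ℝ := (N : ℝ) ^ δ with hz
  have z1 : 1 ≤ z := Real.one_le_rpow hN1 hδ.le
  have hyz : y = x6 * z := by rw [hy, Real.rpow_add hN0]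
  have hy8 : 8 ≤ y := by rw [hyz]; nlinarith
  have hyw : y ≤ w := Nat.le_ceil y
  have hw8 : (8 : ℝ) ≤ w := hy8.trans hyw
  have hw8' : 8 ≤ w := by exact_mod_cast hw8
  have hwy : (w : ℝ) ≤ 2 * y := by
    have := Nat.ceil_lt_add_one (show 0 ≤ y by linarith)
    linarith
  have hw0 : (0 : ℝ) < w := by linarith
  have hz2 : (N : ℝ) ^ (2 * δ) = z ^ 2 := by
    rw [hz, ← Real.rpow_natCast, ← Real.rpow_mul hN0.le]; congr 1; push_cast; ring
  rw [hz2] at hlog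
  have ht : (N : ℝ) ^ ((5 : ℝ) / 6 + 10 * δ) = x6 ^ 5 * z ^ 10 := by
    rw [hz, hx6, ← Real.rpow_natCast, ← Real.rpow_natCast, ← Real.rpow_mul hN0.le,
      ← Real.rpow_mul hN0.le, ← Real.rpow_add hN0]
    congr 1; push_cast; ring
  set l := Real.log w with hl
  have hl2 : 2 ≤ l := by
    rw [hl, Real.le_log_iff_exp_le hw0]
    refine le_trans ?_ hw8
    have := Real.exp_one_lt_d9
    have e : Real.exp 2 = Real.exp 1 * Real.exp 1 := by rw [← Real.exp_add]; norm_num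
    rw [e]
    nlinarith [Real.exp_pos 1]
  have hlN : l ≤ (1 + δ) * Real.log N := by
    rw [hl, ← Real.log_rpow hN0]
    apply Real.log_le_log hw0
    refine hwy.trans ?_
    rw [Real.rpow_add hN0, Real.rpow_one, hyz, ← hz]
    have h1 : 2 * x6 ≤ N := by
      rw [← x6p]
      have : (2 : ℝ) ≤ x6 ^ 5 := by
        calc (2 : ℝ) ≤ 8 ^ 5 := by norm_num
          _ ≤ x6 ^ 5 := by gcongr
      calc 2 * x6 ≤ x6 ^ 5 * x6 := by gcongr
        _ = _ := by ring
    calc 2 * (x6 * z) = (2 * x6) * z := by ring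
      _ ≤ N * z := by gcongr
  have hlz : 200000 * l ≤ z ^ 2 := by linarith
  have hNw : (N : ℝ) * z ^ 6 ≤ w ^ 6 := by
    calc (N : ℝ) * z ^ 6 = y ^ 6 := by rw [hyz, ← x6p]; ring
      _ ≤ (w : ℝ) ^ 6 := by gcongr
  have hNw' : (N : ℝ) ≤ w ^ 6 := by
    refine le_trans ?_ hNw
    have : 1 ≤ z ^ 6 := one_le_pow₀ z1
    nlinarith
  set j := ⌈4608 * l⌉₊ with hj
  have hj1 : 4608 * l ≤ j := Nat.le_ceil _
  have hj2 : (j : ℝ) ≤ 4609 * l := by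
    have := Nat.ceil_lt_add_one (show 0 ≤ 4608 * l by linarith)
    linarith
  set p : ℝ := 4 * N / w ^ 9 with hp
  have hpw : p * w ^ 9 = 4 * N := by rw [hp]; field_simp
  have hp0 : 0 < p := by positivity
  have hp1 : p < 1 := by
    rw [hp, div_lt_one (by positivity)]
    have : (4 : ℝ) < w ^ 3 := by
      calc (4 : ℝ) < 8 ^ 3 := by norm_num
        _ ≤ (w : ℝ) ^ 3 := by gcongr
    calc 4 * (N : ℝ) ≤ 4 * (w : ℝ) ^ 6 := by gcongr
      _ < (w : ℝ) ^ 3 * (w : ℝ) ^ 6 := by gcongr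
      _ = _ := by ring
  refine ⟨w ^ 3, ?_⟩
  refine points_of_params w N j _ p hw8' (by omega) ?_ hp0 hp1 ?_
  · have h1 : ((4607 : ℝ) / 4608) ^ j ≤ 1 / w := by
      have h2 : (4607 : ℝ) / 4608 ≤ Real.exp (-(1 / 4608)) := by
        have := Real.add_one_le_exp (-(1 / 4608) : ℝ)
        linarith
      calc ((4607 : ℝ) / 4608) ^ j ≤ Real.exp (-(1 / 4608)) ^ j := by gcongr
        _ = Real.exp (-(j / 4608)) := by rw [← Real.exp_nat_mul]; congr 1; ring
        _ ≤ Real.exp (-l) := by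
            apply Real.exp_le_exp.2
            linarith
        _ = 1 / (w : ℝ) := by rw [Real.exp_neg, hl, Real.exp_log hw0, one_div]
    calc (w : ℝ) ^ 9 * (4607 / 4608) ^ j ≤ (w : ℝ) ^ 9 * (1 / (w : ℝ)) := by gcongr
      _ = (w : ℝ) ^ 8 := by field_simp
      _ ≤ _ := by nlinarith [pow_pos hw0 8]
  · have hA : p ^ 4 * (w ^ 9 * (6 * w ^ 3 * (1 + 3 * l)) ^ 3) ≤ N := by
      have e : p ^ 4 * ((w : ℝ) ^ 9 * (6 * w ^ 3 * (1 + 3 * l)) ^ 3)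
          = N * (55296 * (N * (1 + 3 * l)) ^ 3 / w ^ 18) := by
        rw [hp]; field_simp; ring
      rw [e]
      have : 55296 * (N * (1 + 3 * l)) ^ 3 / (w : ℝ) ^ 18 ≤ 1 := by
        rw [div_le_one (by positivity)]
        have h1 : 39 * (1 + 3 * l) ≤ z ^ 6 := by
          have : z ^ 2 ≤ z ^ 6 := pow_le_pow_right₀ z1 (by norm_num)
          linarith
        have h2 : 39 * (N * (1 + 3 * l)) ≤ w ^ 6 := by
          refine le_trans ?_ hNw
          calc 39 * (N * (1 + 3 * l)) = N * (39 * (1 + 3 * l)) := by ring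
            _ ≤ _ := by gcongr
        calc 55296 * (N * (1 + 3 * l)) ^ 3 ≤ (39 * (N * (1 + 3 * l))) ^ 3 := by
              rw [mul_pow 39]
              gcongr
              norm_num
          _ ≤ ((w : ℝ) ^ 6) ^ 3 := by gcongr
          _ = _ := by ring
      calc _ ≤ (N : ℝ) * 1 := by gcongr
        _ = N := mul_one _
    have hB : (w : ℝ) ^ 9 * ((((w : ℝ) ^ 9 + 1) ^ (768 * w ^ 5)) ^ j * (1 + p) ^ (864 * w ^ 8)
        * 2 ^ (-(N : ℝ) ^ ((5 : ℝ) / 6 + 10 * δ))) ≤ 1 := by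
      have b1 : (w : ℝ) ^ 9 = Real.exp (9 * l) := by
        rw [hl, ← Real.exp_log (pow_pos hw0 9), Real.log_pow]; norm_num
      have b2 : (w : ℝ) ^ 9 + 1 ≤ Real.exp (10 * l) := by
        have : Real.exp (10 * l) = (w : ℝ) ^ 10 := by
          rw [hl, ← Real.exp_log (pow_pos hw0 10), Real.log_pow]; norm_num
        rw [this]
        have : (1 : ℝ) ≤ w ^ 9 := one_le_pow₀ (by linarith)
        calc (w : ℝ) ^ 9 + 1 ≤ 8 * (w : ℝ) ^ 9 := by linarith
          _ ≤ (w : ℝ) * (w : ℝ) ^ 9 := by gcongr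
          _ = _ := by ring
      have b3 : (((w : ℝ) ^ 9 + 1) ^ (768 * w ^ 5)) ^ j ≤ Real.exp (10 * l * (768 * w ^ 5 * j)) := by
        rw [← pow_mul]
        calc _ ≤ Real.exp (10 * l) ^ (768 * w ^ 5 * j) := by gcongr
          _ = _ := by rw [← Real.exp_nat_mul]; congr 1; push_cast; ring
      have b4 : (1 + p) ^ (864 * w ^ 8) ≤ Real.exp (3456 * w ^ 5) := by
        calc (1 + p) ^ (864 * w ^ 8) ≤ Real.exp p ^ (864 * w ^ 8) := by
              gcongr
              linarith [Real.add_one_le_exp p]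
          _ = Real.exp (864 * w ^ 8 * p) := by rw [← Real.exp_nat_mul]; push_cast; rfl
          _ ≤ _ := by
              apply Real.exp_le_exp.2
              have : 864 * (w : ℝ) ^ 8 * p = 3456 * (N / w) := by rw [hp]; field_simp; ring
              rw [this]
              gcongr
              rw [div_le_iff₀ hw0]
              calc (N : ℝ) ≤ w ^ 6 := hNw'
                _ = _ := by ring
      have b5 : (2 : ℝ) ^ (-(N : ℝ) ^ ((5 : ℝ) / 6 + 10 * δ)) =
          Real.exp (-(Real.log 2 * (x6 ^ 5 * z ^ 10))) := by
        rw [ht, Real.rpow_def_of_pos (by norm_num)]; congr 1; ring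
      rw [b5]
      calc _ ≤ Real.exp (9 * l) * (Real.exp (10 * l * (768 * w ^ 5 * j)) * Real.exp (3456 * w ^ 5)
            * Real.exp (-(Real.log 2 * (x6 ^ 5 * z ^ 10)))) := by
            refine mul_le_mul b1.le (mul_le_mul_of_nonneg_right (mul_le_mul b3 b4 ?_ ?_) ?_) ?_ ?_ <;>
            positivity
        _ = Real.exp (9 * l + (10 * l * (768 * w ^ 5 * j) + 3456 * w ^ 5 +
            -(Real.log 2 * (x6 ^ 5 * z ^ 10)))) := by
            rw [← Real.exp_add, ← Real.exp_add, ← Real.exp_add]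
        _ ≤ 1 := by
            rw [Real.exp_le_one_iff]
            exact exponent_bound w l j x6 y z hw8 hl2 hj2 hlz hwy hyz x60 z1
    rw [hpw]
    linarith


/-- Slope of the dual line of a grid point. -/
def dslope0 (B : ℤ) (p : ℤ × ℤ × ℤ) : ℤ := p.1 + B * p.2.1 + B ^ 2 * p.2.2

/-- Intercept of the dual line of a grid point. -/
def icpt (B : ℤ) (p : ℤ × ℤ × ℤ) : ℤ := p.2.1 + B ^ 3 * p.2.2

theorem small_dvd {B z : ℤ} (h : |z| < B) (hd : B ∣ z) : z = 0 :=
  Int.eq_zero_of_abs_lt_dvd hd h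

theorem slope_inj {m : ℕ} {B : ℤ} (hB : (m : ℤ) ≤ B) {p q : ℤ × ℤ × ℤ} (hp : p ∈ grid m)
    (hq : q ∈ grid m) (h : dslope0 B p = dslope0 B q) : p = q := by
  rw [mem_grid] at hp hq
  unfold dslope0 at h
  have h1 : p.1 - q.1 = 0 := by
    apply small_dvd (B := B) (by rw [abs_lt]; omega)
    exact ⟨-(p.2.1 - q.2.1) - B * (p.2.2 - q.2.2), by linear_combination h⟩
  have hB0 : B ≠ 0 := by omega
  have h2' : (p.2.1 - q.2.1) + B * (p.2.2 - q.2.2) = 0 := by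
    apply mul_left_cancel₀ hB0
    linear_combination h - h1
  have h2 : p.2.1 - q.2.1 = 0 := by
    apply small_dvd (B := B) (by rw [abs_lt]; omega)
    exact ⟨-(p.2.2 - q.2.2), by linear_combination h2'⟩
  have h3 : p.2.2 - q.2.2 = 0 := by
    apply mul_left_cancel₀ hB0
    linear_combination h2' - h2
  exact Prod.ext (by linarith) (Prod.ext (by linarith) (by linarith))

theorem det_formula (B : ℤ) (a b c : ℤ × ℤ × ℤ) :
    (dslope0 B b - dslope0 B a) * (icpt B c - icpt B a) - (dslope0 B c - dslope0 B a) * (icpt B b - icpt B a)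
    = ((b.1 - a.1) * (c.2.1 - a.2.1) - (b.2.1 - a.2.1) * (c.1 - a.1))
      + B ^ 3 * ((b.1 - a.1) * (c.2.2 - a.2.2) - (b.2.2 - a.2.2) * (c.1 - a.1))
      + (B ^ 4 - B ^ 2) * ((b.2.1 - a.2.1) * (c.2.2 - a.2.2) - (b.2.2 - a.2.2) * (c.2.1 - a.2.1)) := by
  unfold dslope0 icpt; ring

theorem coll_of_det {m : ℕ} {B : ℤ} (hB : 2 * (m : ℤ) ^ 2 < B) {a b c : ℤ × ℤ × ℤ}
    (ha : a ∈ grid m) (hb : b ∈ grid m) (hc : c ∈ grid m)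
    (h : (dslope0 B b - dslope0 B a) * (icpt B c - icpt B a)
      = (dslope0 B c - dslope0 B a) * (icpt B b - icpt B a)) : Coll a b c := by
  have hdet := det_formula B a b c
  rw [h, sub_self] at hdet
  rw [mem_grid] at ha hb hc
  have key : ∀ x y z u : ℤ, |x| ≤ m → |y| ≤ m → |z| ≤ m → |u| ≤ m → |x * y - z * u| < B := by
    intro x y z u hx hy hz hu
    have h1 : |x * y| ≤ m * m := by rw [abs_mul]; gcongr
    have h2 : |z * u| ≤ m * m := by rw [abs_mul]; gcongr
    have := abs_sub (x * y) (z * u)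
    nlinarith
  have bd : ∀ x y : ℤ, (0 ≤ x ∧ x < m) → (0 ≤ y ∧ y < m) → |y - x| ≤ m := by
    intro x y hx hy
    rw [abs_le]; omega
  have b1 := bd _ _ ha.1 hb.1
  have b2 := bd _ _ ha.2.1 hb.2.1
  have b3 := bd _ _ ha.2.2 hb.2.2
  have c1 := bd _ _ ha.1 hc.1
  have c2 := bd _ _ ha.2.1 hc.2.1
  have c3 := bd _ _ ha.2.2 hc.2.2
  have k1 := key _ _ _ _ b1 c2 b2 c1
  have k2 := key _ _ _ _ b1 c3 b3 c1
  have k3 := key _ _ _ _ b2 c3 b3 c2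
  unfold Coll
  rw [← sub_eq_zero, ← sub_eq_zero (a := (b.1 - a.1) * (c.2.2 - a.2.2)),
    ← sub_eq_zero (a := (b.2.1 - a.2.1) * (c.2.2 - a.2.2))]
  generalize (b.1 - a.1) * (c.2.1 - a.2.1) - (b.2.1 - a.2.1) * (c.1 - a.1) = Z at *
  generalize (b.1 - a.1) * (c.2.2 - a.2.2) - (b.2.2 - a.2.2) * (c.1 - a.1) = Y at *
  generalize (b.2.1 - a.2.1) * (c.2.2 - a.2.2) - (b.2.2 - a.2.2) * (c.2.1 - a.2.1) = X at *
  have hB0 : 0 < B := by nlinarith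
  have hZ : Z = 0 := by
    apply small_dvd k1
    exact ⟨-(B ^ 2 * Y) - (B ^ 3 - B) * X, by linear_combination -hdet⟩
  have hYX : B * Y + (B ^ 2 - 1) * X = 0 := by
    apply mul_left_cancel₀ (pow_ne_zero 2 hB0.ne')
    linear_combination -hdet - hZ
  have hX : X = 0 := by
    apply small_dvd k3
    exact ⟨Y + B * X, by linear_combination -hYX⟩
  have hY : Y = 0 := by
    apply mul_left_cancel₀ hB0.ne'
    linear_combination hYX - (B ^ 2 - 1) * hX
  exact ⟨hZ, hY, hX⟩

theorem det_of_coll (B : ℤ) {a b c : ℤ × ℤ × ℤ} (h : Coll a b c) :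
    (dslope0 B b - dslope0 B a) * (icpt B c - icpt B a)
      = (dslope0 B c - dslope0 B a) * (icpt B b - icpt B a) := by
  have hdet := det_formula B a b c
  obtain ⟨h1, h2, h3⟩ := h
  linear_combination hdet + h1 + B ^ 3 * h2 + (B ^ 4 - B ^ 2) * h3

/-- The dual line of a grid point. -/
def dl (B : ℤ) (p : ℤ × ℤ × ℤ) : Set (Fin 2 → ℝ) :=
  {q | q 1 = (dslope0 B p : ℝ) * q 0 + (icpt B p : ℝ)}

theorem mem_dl (B : ℤ) (p : ℤ × ℤ × ℤ) (q : Fin 2 → ℝ) :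
    q ∈ dl B p ↔ q 1 = (dslope0 B p : ℝ) * q 0 + (icpt B p : ℝ) := Iff.rfl

theorem dl_isLine (B : ℤ) (p : ℤ × ℤ × ℤ) : IsLine (dl B p) := by
  refine ⟨![0, (icpt B p : ℝ)], ![1, (dslope0 B p : ℝ)], ?_, ?_⟩
  · intro h
    have := congrFun h 0
    simp at this
  · ext q
    rw [mem_dl]
    constructor
    · intro h
      refine ⟨q 0, ?_⟩
      ext i
      fin_cases i
      · simp
      · simp [h]; ring
    · rintro ⟨t, rfl⟩
      simp; ring

theorem dl_slope {B : ℤ} {p q : ℤ × ℤ × ℤ} (h : dl B p = dl B q) : dslope0 B p = dslope0 B q := by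
  have h0 : (![0, (icpt B p : ℝ)] : Fin 2 → ℝ) ∈ dl B q := by
    rw [← h, mem_dl]; simp
  have h1 : (![1, (dslope0 B p : ℝ) + (icpt B p : ℝ)] : Fin 2 → ℝ) ∈ dl B q := by
    rw [← h, mem_dl]; simp
  rw [mem_dl] at h0 h1
  simp at h0 h1
  have : (dslope0 B p : ℝ) = dslope0 B q := by rw [h0] at h1; linarith
  exact_mod_cast this

/-- The dual of Theorem 1 of the paper: for every ε > 0 and all sufficiently large n there
is a family of n lines in the plane, no four passing through a common point, such that
every subfamily of size at least n^(5/6+ε) contains three concurrent lines. -/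
theorem dual_lines_concurrent_triples :
    ∀ ε : ℝ, 0 < ε → ∃ n₀ : ℕ, ∀ n : ℕ, n₀ ≤ n →
      ∃ L : Set (Set (Fin 2 → ℝ)), L.Finite ∧ L.ncard = n ∧ (∀ ℓ ∈ L, IsLine ℓ) ∧
        (∀ p : Fin 2 → ℝ, {ℓ ∈ L | p ∈ ℓ}.ncard ≤ 3) ∧
        ∀ L' ⊆ L, (n : ℝ) ^ ((5 : ℝ) / 6 + ε) ≤ (L'.ncard : ℝ) →
          ∃ p : Fin 2 → ℝ, ∃ ℓ₁ ∈ L', ∃ ℓ₂ ∈ L', ∃ ℓ₃ ∈ L',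
            ℓ₁ ≠ ℓ₂ ∧ ℓ₁ ≠ ℓ₃ ∧ ℓ₂ ≠ ℓ₃ ∧ p ∈ ℓ₁ ∧ p ∈ ℓ₂ ∧ p ∈ ℓ₃ := by
  intro ε hε
  classical
  obtain ⟨n₀, hn₀⟩ := points_exist ε hε
  refine ⟨n₀, fun n hn => ?_⟩
  obtain ⟨m, W, hWm, hWn, hfour, hthree⟩ := hn₀ n hn
  obtain ⟨B, hB⟩ : ∃ B : ℤ, B = 2 * (m : ℤ) ^ 2 + 1 := ⟨_, rfl⟩
  have hB1 : 2 * (m : ℤ) ^ 2 < B := by omega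
  have hB2 : (m : ℤ) ≤ B := by nlinarith
  have hinj : Set.InjOn (dl B) (W : Set (ℤ × ℤ × ℤ)) := fun p hp q hq h =>
    slope_inj hB2 (hWm hp) (hWm hq) (dl_slope h)
  refine ⟨dl B '' (W : Set (ℤ × ℤ × ℤ)), W.finite_toSet.image _, ?_, ?_, ?_, ?_⟩
  · rw [Set.InjOn.ncard_image hinj, Set.ncard_coe_finset, hWn]
  · rintro _ ⟨p, _, rfl⟩
    exact dl_isLine B p
  · intro q
    set S := W.filter (fun p => q ∈ dl B p) with hS
    have hsub : {ℓ ∈ dl B '' (W : Set (ℤ × ℤ × ℤ)) | q ∈ ℓ} ⊆ dl B '' (S : Set (ℤ × ℤ × ℤ)) := by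
      rintro _ ⟨⟨p, hp, rfl⟩, hq⟩
      exact ⟨p, by simpa [hS] using ⟨hp, hq⟩, rfl⟩
    have h1 := Set.ncard_le_ncard hsub (S.finite_toSet.image _)
    have h2 := Set.ncard_image_le (f := dl B) S.finite_toSet
    rw [Set.ncard_coe_finset] at h2
    refine h1.trans (h2.trans ?_)
    by_contra hcon
    push Not at hcon
    obtain ⟨T, hTS, hT⟩ := Finset.exists_subset_card_eq (show 4 ≤ S.card from hcon)
    obtain ⟨a, T', haT', rfl, hT'⟩ := Finset.card_eq_succ.1 hT
    obtain ⟨b, c, d, hbc, hbd, hcd, rfl⟩ := Finset.card_eq_three.1 hT'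
    simp only [Finset.mem_insert, Finset.mem_singleton, not_or] at haT'
    have mem : ∀ x ∈ insert a ({b, c, d} : Finset (ℤ × ℤ × ℤ)), x ∈ W ∧ q ∈ dl B x :=
      fun x hx => Finset.mem_filter.1 (hTS hx)
    have ma := mem a (by simp)
    have mb := mem b (by simp)
    have mc := mem c (by simp)
    have md := mem d (by simp)
    have hcoll : ∀ x, x ∈ W → q ∈ dl B x → Coll a b x := by
      intro x hx hqx
      apply coll_of_det hB1 (hWm ma.1) (hWm mb.1) (hWm hx)
      have ea := ma.2
      have eb := mb.2
      rw [mem_dl] at ea eb hqx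
      have : ((dslope0 B b : ℝ) - dslope0 B a) * (icpt B x - icpt B a)
          = (dslope0 B x - dslope0 B a) * (icpt B b - icpt B a) := by
        have e1 : (icpt B a : ℝ) = q 1 - dslope0 B a * q 0 := by linarith
        have e2 : (icpt B b : ℝ) = q 1 - dslope0 B b * q 0 := by linarith
        have e3 : (icpt B x : ℝ) = q 1 - dslope0 B x * q 0 := by linarith
        rw [e1, e2, e3]; ring
      exact_mod_cast this
    exact hfour a ma.1 b mb.1 c mc.1 d md.1 ⟨haT'.1, haT'.2.1, haT'.2.2, hbc, hbd, hcd,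
      hcoll c mc.1 mc.2, hcoll d md.1 md.2⟩
  · intro L' hL' hcard
    set I := W.filter (fun p => dl B p ∈ L') with hI
    have hL'I : L' = dl B '' (I : Set (ℤ × ℤ × ℤ)) := by
      ext ℓ
      constructor
      · intro hℓ
        obtain ⟨p, hp, rfl⟩ := hL' hℓ
        exact ⟨p, by simpa [hI] using ⟨hp, hℓ⟩, rfl⟩
      · rintro ⟨p, hp, rfl⟩
        rw [hI, Finset.mem_coe, Finset.mem_filter] at hp
        exact hp.2
    have hcardI : (L'.ncard : ℝ) ≤ I.card := by
      have := Set.ncard_image_le (f := dl B) I.finite_toSet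
      rw [Set.ncard_coe_finset, ← hL'I] at this
      exact_mod_cast this
    have hnot : ¬ NoThree I := by
      intro hno
      have := hthree I (Finset.filter_subset _ _) hno
      linarith
    unfold NoThree at hnot
    push Not at hnot
    obtain ⟨a, ha, b, hb, c, hc, hab, hac, hbc, hcoll⟩ := hnot
    rw [hI, Finset.mem_filter] at ha hb hc
    have hdet : ((dslope0 B b : ℝ) - dslope0 B a) * (icpt B c - icpt B a)
        = (dslope0 B c - dslope0 B a) * (icpt B b - icpt B a) := by
      exact_mod_cast det_of_coll B hcoll
    have hne : (dslope0 B b : ℝ) - dslope0 B a ≠ 0 := by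
      intro h
      have : (dslope0 B a : ℝ) = dslope0 B b := by linarith
      exact hab (slope_inj hB2 (hWm ha.1) (hWm hb.1) (by exact_mod_cast this))
    obtain ⟨X, hX⟩ : ∃ X : ℝ, X * ((dslope0 B b : ℝ) - dslope0 B a) = -(icpt B b - icpt B a) :=
      ⟨-(icpt B b - icpt B a) / ((dslope0 B b : ℝ) - dslope0 B a), by field_simp⟩
    refine ⟨![X, (dslope0 B a : ℝ) * X + icpt B a], dl B a, ha.2, dl B b, hb.2, dl B c, hc.2,
      fun h => hab (hinj ha.1 hb.1 h), fun h => hac (hinj ha.1 hc.1 h),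
      fun h => hbc (hinj hb.1 hc.1 h), ?_, ?_, ?_⟩
    · rw [mem_dl]; simp
    · rw [mem_dl]; simp; linarith
    · rw [mem_dl]; simp
      apply mul_left_cancel₀ hne
      linear_combination (-1 : ℝ) * hdet - ((dslope0 B c : ℝ) - dslope0 B a) * hX
end

section
/- There exists n₀ such that for every integer n ≥ n₀, every integer k with 3 ≤ k < 0.01·(log₂ n)^{1/2}, every real γ with 0.1 < γ ≤ 1, and every subset S ⊆ [n]^k with |S| ≥ γ·n^k, the number of k-element subsets of S contained in a single line is at least γ^{k+1}·n^{2k} / (k!·2^{3k²}·10·2^{3k}·k·log₂ n). -/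
/-- The grid [n]^k = {1, …, n}^k viewed as a subset of ℝᵏ. -/
def gridPts (n k : ℕ) : Set (Fin k → ℝ) :=
  {p | ∀ i, ∃ m : ℕ, 1 ≤ m ∧ m ≤ n ∧ p i = (m : ℝ)}

/-- Double counting: many progressions `x, x+v, …, x+(L-1)v` contain at least `k` points. -/
lemma good_count (k n L M : ℕ) (A : Finset (Fin k → ℤ))
    (hA : A ⊆ Fintype.piFinset (fun _ => Finset.Icc (1 : ℤ) n)) :
    M ^ k * L * A.card ≤
      (((Fintype.piFinset (fun _ : Fin k => Finset.Icc (1 - (L * M : ℕ) : ℤ) n)) ×ˢ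
        (Fintype.piFinset (fun _ : Fin k => Finset.Icc (1 : ℤ) M))).filter
        (fun q => k ≤ ((Finset.range L).filter (fun i : ℕ => q.1 + (i : ℤ) • q.2 ∈ A)).card)).card * L
      + (n + L * M) ^ k * M ^ k * k := by
  set X := Fintype.piFinset (fun _ : Fin k => Finset.Icc (1 - (L * M : ℕ) : ℤ) n) with hX
  set V := Fintype.piFinset (fun _ : Fin k => Finset.Icc (1 : ℤ) M) with hV
  set N : (Fin k → ℤ) × (Fin k → ℤ) → ℕ :=
    fun q => ((Finset.range L).filter (fun i : ℕ => q.1 + (i : ℤ) • q.2 ∈ A)).card with hN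
  have hXc : X.card = (n + L * M) ^ k := by
    rw [hX, Fintype.card_piFinset]
    simp only [Int.card_Icc, Finset.prod_const, Finset.card_univ, Fintype.card_fin]
    congr 1
    omega
  have hVc : V.card = M ^ k := by
    rw [hV, Fintype.card_piFinset]
    simp
  have h1 : M ^ k * L * A.card ≤ ∑ q ∈ X ×ˢ V, N q := by
    have hs : ∀ v ∈ V, ∀ i ∈ Finset.range L,
        A.card ≤ (X.filter (fun x => x + (i : ℤ) • v ∈ A)).card := by
      intro v hv i hi
      apply Finset.card_le_card_of_injOn (fun a => a - (i : ℤ) • v)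
      · intro a ha
        have ha' : a ∈ A := ha
        have h2 := hA ha'
        rw [Fintype.mem_piFinset] at h2
        rw [hV, Fintype.mem_piFinset] at hv
        simp only [Finset.coe_filter, Set.mem_ofPred_eq, sub_add_cancel, ha', and_true]
        rw [hX, Fintype.mem_piFinset]
        intro j
        have h3 := h2 j
        have h4 := hv j
        rw [Finset.mem_Icc] at h3 h4 ⊢
        rw [Finset.mem_range] at hi
        simp only [Pi.sub_apply, Pi.smul_apply, smul_eq_mul]
        have h5 : (i : ℤ) * v j ≤ L * M := by
          apply mul_le_mul
          · exact_mod_cast hi.le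
          · exact h4.2
          · linarith
          · positivity
        have h6 : 0 ≤ (i : ℤ) * v j := mul_nonneg (by positivity) (by linarith)
        push_cast
        constructor <;> linarith
      · intro a _ b _ hab
        simpa using hab
    have e : ∑ q ∈ X ×ˢ V, N q =
        ∑ v ∈ V, ∑ i ∈ Finset.range L, (X.filter (fun x => x + (i : ℤ) • v ∈ A)).card := by
      rw [Finset.sum_product_right]
      refine Finset.sum_congr rfl fun v _ => ?_
      simp only [hN, Finset.card_filter]
      rw [Finset.sum_comm]
    rw [e]
    calc M ^ k * L * A.card = ∑ v ∈ V, ∑ i ∈ Finset.range L, A.card := by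
          simp [hVc, mul_assoc]
      _ ≤ _ := Finset.sum_le_sum fun v hv => Finset.sum_le_sum fun i hi => hs v hv i hi
  refine h1.trans ?_
  calc ∑ q ∈ X ×ˢ V, N q ≤ ∑ q ∈ X ×ˢ V, ((if k ≤ N q then L else 0) + k) := by
        apply Finset.sum_le_sum
        intro q _
        have : N q ≤ L := by
          have h := Finset.card_filter_le (Finset.range L) (fun i : ℕ => q.1 + (i : ℤ) • q.2 ∈ A)
          rwa [Finset.card_range] at h
        split_ifs <;> omega
    _ = _ := by
        rw [Finset.sum_add_distrib, ← Finset.sum_filter]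
        rw [Finset.sum_const, Finset.sum_const, Finset.card_product, hXc, hVc, smul_eq_mul, smul_eq_mul]

/-- Each good progression yields a collinear `k`-subset, each at most `L²` times. -/
lemma good_le (k L : ℕ) (hk : 2 ≤ k) (A : Finset (Fin k → ℤ))
    (G : Finset ((Fin k → ℤ) × (Fin k → ℤ)))
    (hv : ∀ q ∈ G, q.2 ≠ 0)
    (hG : ∀ q ∈ G, k ≤ ((Finset.range L).filter (fun i : ℕ => q.1 + (i : ℤ) • q.2 ∈ A)).card) :
    ∃ F : Finset (Finset (Fin k → ℤ)), G.card ≤ L ^ 2 * F.card ∧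
      ∀ T ∈ F, T ⊆ A ∧ T.card = k ∧ ∃ x v : Fin k → ℤ, ∀ p ∈ T, ∃ i : ℤ, p = x + i • v := by
  classical
  have hT : ∀ q ∈ G, ∃ T : Finset (Fin k → ℤ), T ⊆ A ∧ T.card = k ∧
      ∀ p ∈ T, ∃ i ∈ Finset.range L, p = q.1 + (i : ℤ) • q.2 := by
    intro q hq
    obtain ⟨I, hI, hIc⟩ := Finset.exists_subset_card_eq (hG q hq)
    refine ⟨I.image (fun i : ℕ => q.1 + (i : ℤ) • q.2), ?_, ?_, ?_⟩
    · intro p hp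
      obtain ⟨i, hi, rfl⟩ := Finset.mem_image.1 hp
      exact (Finset.mem_filter.1 (hI hi)).2
    · rw [Finset.card_image_of_injective, hIc]
      intro i j hij
      have h := add_left_cancel hij
      have h2 := smul_left_injective ℤ (hv q hq) h
      exact_mod_cast h2
    · intro p hp
      obtain ⟨i, hi, rfl⟩ := Finset.mem_image.1 hp
      exact ⟨i, (Finset.mem_filter.1 (hI hi)).1, rfl⟩
  choose! f hf1 hf2 hf3 using hT
  refine ⟨G.image f, ?_, ?_⟩
  · apply Finset.card_le_mul_card_image
    intro T hTm
    obtain ⟨q0, hq0, rfl⟩ := Finset.mem_image.1 hTm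
    obtain ⟨a, ha, b, hb, hab⟩ := Finset.one_lt_card.1 (by rw [hf2 q0 hq0]; omega : 1 < (f q0).card)
    have key : ∀ q ∈ G.filter (fun q => f q = f q0), ∃ ij : ℕ × ℕ,
        ij ∈ Finset.range L ×ˢ Finset.range L ∧ a = q.1 + (ij.1 : ℤ) • q.2 ∧
          b = q.1 + (ij.2 : ℤ) • q.2 := by
      intro q hq
      obtain ⟨hq1, hq2⟩ := Finset.mem_filter.1 hq
      obtain ⟨i, hi, hi2⟩ := hf3 q hq1 a (by rw [hq2]; exact ha)
      obtain ⟨j, hj, hj2⟩ := hf3 q hq1 b (by rw [hq2]; exact hb)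
      exact ⟨(i, j), Finset.mk_mem_product hi hj, hi2, hj2⟩
    choose! g hg1 hg2 hg3 using key
    have := Finset.card_le_card_of_injOn (s := G.filter (fun q => f q = f q0))
      (t := Finset.range L ×ˢ Finset.range L) g (fun q hq => hg1 q hq) ?_
    · simpa [sq] using this
    · intro q hq q' hq' hqq
      have e1 := hg2 q hq
      have e2 := hg3 q hq
      have e3 := hg2 q' hq'
      have e4 := hg3 q' hq'
      rw [← hqq] at e3 e4
      have hne : ((g q).2 : ℤ) - ((g q).1 : ℤ) ≠ 0 := by
        intro h
        apply hab
        rw [e1, e2, sub_eq_zero.1 h]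
      have h5 : (((g q).2 : ℤ) - ((g q).1 : ℤ)) • q.2 = (((g q).2 : ℤ) - ((g q).1 : ℤ)) • q'.2 := by
        have h6 : b - a = (((g q).2 : ℤ) - ((g q).1 : ℤ)) • q.2 := by
          rw [sub_smul]
          nth_rewrite 1 [e1, e2]
          abel
        have h7 : b - a = (((g q).2 : ℤ) - ((g q).1 : ℤ)) • q'.2 := by
          rw [sub_smul]
          nth_rewrite 1 [e3, e4]
          abel
        rw [← h6, h7]
      have h8 : q.2 = q'.2 := smul_right_injective _ hne h5
      have h9 : q.1 = q'.1 := by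
        rw [e1, h8] at e3
        exact add_right_cancel e3
      exact Prod.ext h9 h8
  · intro T hTm
    obtain ⟨q, hq, rfl⟩ := Finset.mem_image.1 hTm
    refine ⟨hf1 q hq, hf2 q hq, q.1, q.2, fun p hp => ?_⟩
    obtain ⟨i, _, hi⟩ := hf3 q hq p hp
    exact ⟨i, hi⟩

lemma real_transfer (n k : ℕ) (S : Set (Fin k → ℝ)) (hS : S ⊆ gridPts n k) :
    ∃ A : Finset (Fin k → ℤ), A ⊆ Fintype.piFinset (fun _ => Finset.Icc (1 : ℤ) n) ∧
      A.card = S.ncard ∧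
      ∀ F : Finset (Finset (Fin k → ℤ)),
      (∀ T ∈ F, T ⊆ A ∧ T.card = k ∧ ∃ x v : Fin k → ℤ, ∀ p ∈ T, ∃ i : ℤ, p = x + i • v) →
      F.card ≤ ({T : Set (Fin k → ℝ) | T ⊆ S ∧ T.ncard = k ∧ Collinear ℝ T}).ncard := by
  classical
  set c : (Fin k → ℤ) → (Fin k → ℝ) := fun z i => (z i : ℝ) with hc
  have hci : Function.Injective c := by
    intro a b hab
    funext i
    have := congrFun hab i
    simpa [hc] using this
  set A := (Fintype.piFinset (fun _ : Fin k => Finset.Icc (1 : ℤ) n)).filter (fun z => c z ∈ S) with hA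
  have hAS : c '' (A : Set (Fin k → ℤ)) = S := by
    ext p
    constructor
    · rintro ⟨z, hz, rfl⟩
      exact (Finset.mem_filter.1 (Finset.mem_coe.1 hz)).2
    · intro hp
      choose m hm1 hm2 hm3 using hS hp
      have hcp : c (fun i => (m i : ℤ)) = p := by
        funext i
        simp [hc, hm3 i]
      refine ⟨fun i => (m i : ℤ), ?_, hcp⟩
      rw [Finset.mem_coe, hA, Finset.mem_filter, hcp, Fintype.mem_piFinset]
      refine ⟨fun i => ?_, hp⟩
      rw [Finset.mem_Icc]
      exact ⟨by exact_mod_cast hm1 i, by exact_mod_cast hm2 i⟩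
  refine ⟨A, Finset.filter_subset _ _, ?_, ?_⟩
  · rw [← hAS, Set.ncard_image_of_injective _ hci, Set.ncard_coe_finset]
  · intro F hF
    have hfin : S.Finite := by
      rw [← hAS]
      exact (Finset.finite_toSet A).image c
    have hinj : Function.Injective (fun T : Finset (Fin k → ℤ) => c '' (T : Set (Fin k → ℤ))) := by
      intro T T' h
      exact Finset.coe_injective (hci.image_injective h)
    rw [← Set.ncard_coe_finset F, ← Set.ncard_image_of_injective _ hinj]
    apply Set.ncard_le_ncard
    · rintro _ ⟨T, hT, rfl⟩
      obtain ⟨h1, h2, x, v, h3⟩ := hF T hT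
      refine ⟨?_, ?_, ?_⟩
      · rw [← hAS]
        exact Set.image_mono (Finset.coe_subset.2 h1)
      · show (c '' (T : Set (Fin k → ℤ))).ncard = k
        rw [Set.ncard_image_of_injective _ hci, Set.ncard_coe_finset, h2]
      · show Collinear ℝ (c '' (T : Set (Fin k → ℤ)))
        rw [collinear_iff_exists_forall_eq_smul_vadd]
        refine ⟨c x, c v, ?_⟩
        rintro _ ⟨p, hp, rfl⟩
        obtain ⟨i, rfl⟩ := h3 p hp
        refine ⟨(i : ℝ), ?_⟩
        funext j
        simp [hc]
        ring
    · exact hfin.finite_subsets.subset fun T hT => hT.1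

lemma pow_aux (k : ℕ) (hk : 3 ≤ k) : 120 * k ^ 2 ≤ 8 ^ (k + 1) := by
  induction k, hk using Nat.le_induction with
  | base => norm_num
  | succ m hm ih =>
    rw [pow_succ 8 (m + 1)]
    nlinarith

lemma e_aux (k : ℕ) (hk : 3 ≤ k) : (1 + 1 / (k : ℝ)) ^ k ≤ 3 := by
  have hk0 : (0 : ℝ) < k := by positivity
  calc (1 + 1 / (k : ℝ)) ^ k ≤ (Real.exp (1 / (k : ℝ))) ^ k := by
        gcongr
        linarith [Real.add_one_le_exp (1 / (k : ℝ))]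
    _ = Real.exp 1 := by
        rw [← Real.exp_nat_mul]
        congr 1
        field_simp
    _ ≤ 3 := by linarith [Real.exp_one_lt_d9]

/-- Lemma 4.4 of the paper (supersaturation in [n]^k for r = k): for n large,
3 ≤ k < 0.01·(log₂ n)^(1/2) and 0.1 < γ ≤ 1, every S ⊆ [n]^k of size at least γ·n^k spans
at least γ^(k+1)·n^(2k)/(k!·2^(3k²)·10·2^(3k)·k·log₂ n) collinear k-tuples. -/
theorem supersaturation_grid_k :
    ∃ n₀ : ℕ, ∀ n : ℕ, n₀ ≤ n → ∀ k : ℕ, 3 ≤ k →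
      (k : ℝ) < 0.01 * (Real.logb 2 (n : ℝ)) ^ ((1 : ℝ) / 2) →
      ∀ γ : ℝ, 0.1 < γ → γ ≤ 1 →
      ∀ S : Set (Fin k → ℝ), S ⊆ gridPts n k → γ * (n : ℝ) ^ k ≤ (S.ncard : ℝ) →
        γ ^ (k + 1) * (n : ℝ) ^ (2 * k) /
            ((Nat.factorial k : ℝ) * 2 ^ (3 * k ^ 2) * 10 * 2 ^ (3 * k) * (k : ℝ) *
              Real.logb 2 (n : ℝ)) ≤
          (({T : Set (Fin k → ℝ) | T ⊆ S ∧ T.ncard = k ∧ Collinear ℝ T}).ncard : ℝ) := by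
  refine ⟨1, fun n hn k hk hkn γ hγ hγ1 S hS hSc => ?_⟩
  set l := Real.logb 2 (n : ℝ) with hl
  have hk3 : (3 : ℝ) ≤ k := by exact_mod_cast hk
  have hn1 : (1 : ℝ) ≤ n := by exact_mod_cast hn
  have hl0 : 0 ≤ l := Real.logb_nonneg (by norm_num) hn1
  have hlk : 10000 * (k : ℝ) ^ 2 ≤ l := by
    rw [← Real.sqrt_eq_rpow] at hkn
    have h1 := Real.sq_sqrt hl0
    have h2 := Real.sqrt_nonneg l
    nlinarith
  have hln : l * 0.69 ≤ n := by
    have h1 : l * Real.log 2 = Real.log n := by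
      rw [hl, Real.logb]
      have := Real.log_pos (by norm_num : (1 : ℝ) < 2)
      field_simp
    have h2 := Real.log_le_sub_one_of_pos (by linarith : (0 : ℝ) < n)
    nlinarith [Real.log_two_gt_d9]
  obtain ⟨A, hA, hAc, hF⟩ := real_transfer n k S hS
  set L := 60 * k with hL
  set M := n / (60 * k ^ 2) with hM
  have hMle : M * (60 * k ^ 2) ≤ n := Nat.div_mul_le_self _ _
  have hMge : n ≤ M * (120 * k ^ 2) := by
    have h1 : 60 * k ^ 2 ≤ n := by
      have : (60 * (k : ℝ) ^ 2) ≤ n := by nlinarith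
      exact_mod_cast this
    have h2 : n < 60 * k ^ 2 * (M + 1) := Nat.lt_mul_div_succ n (by positivity)
    have h3 : 1 ≤ M := (Nat.one_le_div_iff (by positivity)).2 h1
    nlinarith
  have hgc := good_count k n L M A hA
  set G := (((Fintype.piFinset (fun _ : Fin k => Finset.Icc (1 - (L * M : ℕ) : ℤ) n)) ×ˢ
        (Fintype.piFinset (fun _ : Fin k => Finset.Icc (1 : ℤ) M))).filter
        (fun q => k ≤ ((Finset.range L).filter (fun i : ℕ => q.1 + (i : ℤ) • q.2 ∈ A)).card)) with hGdef
  obtain ⟨F, hGF, hFp⟩ := good_le k L (by omega) A G (by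
      intro q hq h0
      have h1 := (Finset.mem_product.1 (Finset.mem_filter.1 hq).1).2
      rw [Fintype.mem_piFinset] at h1
      have h2 := h1 ⟨0, by omega⟩
      rw [h0, Finset.mem_Icc] at h2
      simp at h2) (fun q hq => (Finset.mem_filter.1 hq).2)
  have hFc := hF F hFp
  set W := ({T : Set (Fin k → ℝ) | T ⊆ S ∧ T.ncard = k ∧ Collinear ℝ T}).ncard with hW
  have hGW : (G.card : ℝ) ≤ (60 * k) ^ 2 * W := by
    have : G.card ≤ L ^ 2 * W := hGF.trans (Nat.mul_le_mul_left _ hFc)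
    rw [hL] at this
    exact_mod_cast this
  have hgcR : (M : ℝ) ^ k * (60 * k) * S.ncard ≤ G.card * (60 * k)
      + ((n : ℝ) + 60 * k * M) ^ k * (M : ℝ) ^ k * k := by
    rw [hAc, hL] at hgc
    exact_mod_cast hgc
  have hbox : ((n : ℝ) + 60 * k * M) ^ k ≤ 3 * (n : ℝ) ^ k := by
    have h1 : (M : ℝ) * (60 * (k : ℝ) ^ 2) ≤ n := by exact_mod_cast hMle
    have h2 : (n : ℝ) + 60 * k * M ≤ (1 + 1 / (k : ℝ)) * n := by
      have : 60 * k * M ≤ (n : ℝ) / k := by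
        rw [le_div_iff₀ (by linarith)]
        linarith
      calc (n : ℝ) + 60 * k * M ≤ n + n / k := by linarith
        _ = _ := by ring
    calc ((n : ℝ) + 60 * k * M) ^ k ≤ ((1 + 1 / (k : ℝ)) * n) ^ k := by gcongr
      _ = (1 + 1 / (k : ℝ)) ^ k * (n : ℝ) ^ k := mul_pow _ _ _
      _ ≤ _ := by gcongr; exact e_aux k hk
  have hmain : (M : ℝ) ^ k * (n : ℝ) ^ k * (3 * k) ≤ (60 * k) ^ 3 * W := by
    have hMk : (0 : ℝ) ≤ (M : ℝ) ^ k := by positivity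
    have hnk : (0 : ℝ) ≤ (n : ℝ) ^ k := by positivity
    have h1 : (0.1 : ℝ) * (n : ℝ) ^ k ≤ S.ncard := le_trans (by gcongr) hSc
    have h2 : (M : ℝ) ^ k * (60 * k) * (0.1 * (n : ℝ) ^ k) ≤ (M : ℝ) ^ k * (60 * k) * S.ncard := by
      gcongr
    have h3 : ((n : ℝ) + 60 * k * M) ^ k * (M : ℝ) ^ k * k ≤ 3 * (n : ℝ) ^ k * (M : ℝ) ^ k * k := by
      gcongr
    have h4 : (G.card : ℝ) * (60 * k) ≤ (60 * k) ^ 2 * W * (60 * k) := by gcongr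
    nlinarith
  have hpow : (n : ℝ) ^ k ≤ (M : ℝ) ^ k * (2 ^ (3 * k ^ 2) * 2 ^ (3 * k)) := by
    have h1 : n ^ k ≤ (M * 8 ^ (k + 1)) ^ k := by
      gcongr
      exact hMge.trans (Nat.mul_le_mul_left _ (pow_aux k hk))
    have h2 : (M * 8 ^ (k + 1)) ^ k = M ^ k * (2 ^ (3 * k ^ 2) * 2 ^ (3 * k)) := by
      rw [mul_pow, ← pow_add, show (8 : ℕ) = 2 ^ 3 by norm_num, ← pow_mul, ← pow_mul]
      congr 2
      ring
    rw [h2] at h1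
    exact_mod_cast h1
  have hlpos : 0 < l := by nlinarith
  have hfac : (1 : ℝ) ≤ (Nat.factorial k : ℝ) := by exact_mod_cast Nat.factorial_pos k
  rw [div_le_iff₀ (by positivity)]
  set Q : ℝ := 2 ^ (3 * k ^ 2) * 2 ^ (3 * k) with hQ
  have hQ0 : 0 < Q := by positivity
  have hγp : γ ^ (k + 1) ≤ 1 := pow_le_one₀ (by linarith) hγ1
  have hW0 : (0 : ℝ) ≤ W := by positivity
  have s1 : (n : ℝ) ^ (2 * k) * (3 * k) ≤ (60 * k) ^ 3 * W * Q := by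
    calc (n : ℝ) ^ (2 * k) * (3 * k) = (n : ℝ) ^ k * (n : ℝ) ^ k * (3 * k) := by
          rw [two_mul, pow_add]
      _ ≤ ((M : ℝ) ^ k * Q) * (n : ℝ) ^ k * (3 * k) := by gcongr
      _ = ((M : ℝ) ^ k * (n : ℝ) ^ k * (3 * k)) * Q := by ring
      _ ≤ _ := by gcongr
  have s2 : (n : ℝ) ^ (2 * k) ≤ 72000 * k ^ 2 * (W * Q) := by
    have : (n : ℝ) ^ (2 * k) * (3 * k) ≤ 72000 * k ^ 2 * (W * Q) * (3 * k) := by linarith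
    exact le_of_mul_le_mul_right this (by positivity)
  calc γ ^ (k + 1) * (n : ℝ) ^ (2 * k) ≤ 1 * (n : ℝ) ^ (2 * k) := by gcongr
    _ ≤ 72000 * k ^ 2 * (W * Q) := by linarith
    _ ≤ (10 * k * l) * (W * Q) := by
        have h1 : 72000 * (k : ℝ) ^ 2 ≤ 10 * k * l := by nlinarith
        gcongr
    _ ≤ (Nat.factorial k : ℝ) * ((10 * k * l) * (W * Q)) :=
        le_mul_of_one_le_left (by positivity) hfac
    _ = _ := by rw [hQ]; ring
end
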